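/- Let α ∈ (0,1) be a Liouville number. For every lift g of an orientation-preserving C^∞ circle diffeomorphism with rotation number ρ(g) = α, every r ∈ ℕ and every ε > 0, there exists a lift f of an orientation-preserving C^∞ circle diffeomorphism with rotation number ρ(f) = α such that d_r(f, g) < ε and the circle diffeomorphism induced by f has ratio set r(f) = {0, 1} (i.e. it is of type III₀). -/

import Mathlib

noncomputable section
open MeasureTheory Filter Topology

/-- A lift of an orientation-preserving `C^∞` circle diffeomorphism: a `C^∞` map
`f : ℝ → ℝ` with `f (x+1) = f x + 1` and everywhere positive derivative. -/
def IsCircleDiffeoLift (f : ℝ → ℝ) : Prop :=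
  ContDiff ℝ (⊤ : ℕ∞) f ∧ (∀ x : ℝ, f (x + 1) = f x + 1) ∧ ∀ x : ℝ, 0 < deriv f x

/-- The `C^r` norm `‖φ‖_r = max_{0 ≤ i ≤ r} sup_x |φ^{(i)}(x)|`. -/
def CrNorm (r : ℕ) (φ : ℝ → ℝ) : ℝ :=
  (Finset.range (r + 1)).sup' (Finset.nonempty_range_iff.mpr r.succ_ne_zero)
    fun i => ⨆ x : ℝ, |iteratedDeriv i φ x|

/-- `d_r(f, g) = max {‖f - g‖_r, ‖f⁻¹ - g⁻¹‖_r}`. -/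
def liftDist (r : ℕ) (f g : ℝ → ℝ) : ℝ :=
  max (CrNorm r (fun x => f x - g x))
    (CrNorm r (fun x => Function.invFun f x - Function.invFun g x))

/-- `|f|_r = max {‖f - id‖_r, ‖f⁻¹ - id‖_r, 1}`. -/
def liftNorm (r : ℕ) (f : ℝ → ℝ) : ℝ :=
  max (max (CrNorm r (fun x => f x - x)) (CrNorm r (fun x => Function.invFun f x - x))) 1

/-- The lift `x ↦ x + a` of the rotation by `a`. -/
def RotLift (a : ℝ) : ℝ → ℝ := fun x => x + a

/-- The rotation number of the circle diffeomorphism induced by the lift `f` equals `a`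
(mod 1): the translation number `lim (fⁿ(0) - 0)/n` equals `a + k` for some integer `k`. -/
def HasRotationNumber (f : ℝ → ℝ) (a : ℝ) : Prop :=
  ∃ k : ℤ, Tendsto (fun n : ℕ => f^[n] 0 / (n : ℝ)) atTop (nhds (a + k))

/-- The lift of the `i`-th iterate (`i ∈ ℤ`) of the circle diffeomorphism induced by `f`. -/
def zpowLift (f : ℝ → ℝ) : ℤ → ℝ → ℝ := fun i =>
  if 0 ≤ i then f^[i.toNat] else (Function.invFun f)^[(-i).toNat]

/-- The ratio set of a circle diffeomorphism, described through the family `Fz i` of its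
iterates (`i ∈ ℤ`) and the family `D i` of the derivatives of its iterates: `t ≥ 0` lies in
the ratio set iff for every Borel `A` of positive Haar measure and every `ε > 0` there are a
Borel `B ⊆ A` of positive measure and `i ∈ ℤ` with `Fz i '' B ⊆ A` and `|D i x - t| < ε`
on `B`. -/
def ratioSet (Fz : ℤ → UnitAddCircle → UnitAddCircle) (D : ℤ → UnitAddCircle → ℝ) : Set ℝ :=
  {t : ℝ | 0 ≤ t ∧ ∀ A : Set UnitAddCircle, MeasurableSet A → 0 < volume A →
    ∀ ε : ℝ, 0 < ε → ∃ B : Set UnitAddCircle, MeasurableSet B ∧ B ⊆ A ∧ 0 < volume B ∧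
      ∃ i : ℤ, Fz i '' B ⊆ A ∧ ∀ x ∈ B, |D i x - t| < ε}

/-- A lift of an orientation-preserving `C¹` circle diffeomorphism. -/
def IsC1CircleLift (f : ℝ → ℝ) : Prop :=
  ContDiff ℝ 1 f ∧ (∀ x : ℝ, f (x + 1) = f x + 1) ∧ ∀ x : ℝ, 0 < deriv f x

/-- Smooth real functions. -/
notation "Sm" => ContDiff ℝ ((⊤ : ℕ∞) : WithTop ℕ∞)

theorem Sm.deriv {f : ℝ → ℝ} (hf : Sm f) : Sm (deriv f) :=
  (contDiff_infty_iff_deriv.mp hf).2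

theorem Sm.iter {f : ℝ → ℝ} (hf : Sm f) (n : ℕ) : Sm (iteratedDeriv n f) := by
  induction n with
  | zero => simpa using hf
  | succ n ih => rw [iteratedDeriv_succ]; exact Sm.deriv ih

theorem Sm.diff {f : ℝ → ℝ} (hf : Sm f) : Differentiable ℝ f :=
  hf.differentiable (by simp)

theorem Sm.of (n : ℕ) {f : ℝ → ℝ} (hf : Sm f) : ContDiff ℝ n f :=
  hf.of_le (by exact_mod_cast le_top)

theorem Sm.at (n : ℕ) {f : ℝ → ℝ} (hf : Sm f) (x : ℝ) : ContDiffAt ℝ n f x :=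
  (Sm.of n hf).contDiffAt

/-- Derivatives up to order `s` at `x` are at most `a * l ^ j`. -/
def Bd (s : ℕ) (a l : ℝ) (φ : ℝ → ℝ) (x : ℝ) : Prop :=
  ∀ j ≤ s, |iteratedDeriv j φ x| ≤ a * l ^ j

theorem Bd.mono_order {s t : ℕ} {a l : ℝ} {φ : ℝ → ℝ} {x : ℝ} (h : Bd s a l φ x) (hts : t ≤ s) :
    Bd t a l φ x := fun j hj => h j (hj.trans hts)

theorem Bd.mono {s : ℕ} {a b l m : ℝ} {φ : ℝ → ℝ} {x : ℝ} (h : Bd s a l φ x) (hab : a ≤ b)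
    (hb : 0 ≤ b) (hl : 0 ≤ l) (hlm : l ≤ m) : Bd s b m φ x := fun j hj =>
  (h j hj).trans (mul_le_mul hab (pow_le_pow_left₀ hl hlm j) (pow_nonneg hl j) hb)

theorem Bd.mul {s : ℕ} {a b l : ℝ} {φ ψ : ℝ → ℝ} {x : ℝ} (hφ : Sm φ) (hψ : Sm ψ)
    (h1 : Bd s a l φ x) (h2 : Bd s b l ψ x) (ha : 0 ≤ a) (hb : 0 ≤ b) (hl : 0 ≤ l) :
    Bd s (2 ^ s * a * b) l (fun y => φ y * ψ y) x := by
  intro j hj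
  have e : (fun y => φ y * ψ y) = φ * ψ := rfl
  rw [e, iteratedDeriv_mul (Sm.at j hφ x) (Sm.at j hψ x)]
  calc |∑ i ∈ Finset.range (j + 1), (j.choose i : ℝ) * iteratedDeriv i φ x *
          iteratedDeriv (j - i) ψ x|
      ≤ ∑ i ∈ Finset.range (j + 1), |(j.choose i : ℝ) * iteratedDeriv i φ x *
          iteratedDeriv (j - i) ψ x| := Finset.abs_sum_le_sum_abs _ _
    _ ≤ ∑ i ∈ Finset.range (j + 1), (j.choose i : ℝ) * (a * b * l ^ j) := by
        apply Finset.sum_le_sum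
        intro i hi
        have hi' : i ≤ j := by simpa [Nat.lt_succ_iff] using hi
        rw [abs_mul, abs_mul, Nat.abs_cast, mul_assoc]
        apply mul_le_mul_of_nonneg_left _ (Nat.cast_nonneg _)
        calc _ ≤ (a * l ^ i) * (b * l ^ (j - i)) :=
              mul_le_mul (h1 i (hi'.trans hj)) (h2 _ ((Nat.sub_le _ _).trans hj)) (abs_nonneg _)
                (by positivity)
          _ = a * b * l ^ j := by
              rw [← Nat.add_sub_of_le hi', pow_add, Nat.add_sub_cancel_left]; ring
    _ = 2 ^ j * (a * b * l ^ j) := by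
        rw [← Finset.sum_mul]
        congr 1
        exact_mod_cast Nat.sum_range_choose j
    _ ≤ 2 ^ s * (a * b * l ^ j) := by
        gcongr
        norm_num
    _ = _ := by ring

theorem Bd.sum {ι : Type*} {s : ℕ} {l : ℝ} {I : Finset ι} {a : ι → ℝ} {φ : ι → ℝ → ℝ} {x : ℝ}
    (hφ : ∀ i ∈ I, Sm (φ i)) (h : ∀ i ∈ I, Bd s (a i) l (φ i) x) :
    Bd s (∑ i ∈ I, a i) l (fun y => ∑ i ∈ I, φ i y) x := by
  intro j hj
  rw [iteratedDeriv_fun_sum (fun i hi => Sm.at j (hφ i hi) x), Finset.sum_mul]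
  exact (Finset.abs_sum_le_sum_abs _ _).trans (Finset.sum_le_sum fun i hi => h i hi j hj)

theorem Bd.add {s : ℕ} {a b l : ℝ} {φ ψ : ℝ → ℝ} {x : ℝ} (hφ : Sm φ) (hψ : Sm ψ)
    (h1 : Bd s a l φ x) (h2 : Bd s b l ψ x) :
    Bd s (a + b) l (fun y => φ y + ψ y) x := by
  intro j hj
  have e : (fun y => φ y + ψ y) = φ + ψ := rfl
  rw [e, iteratedDeriv_add (Sm.at j hφ x) (Sm.at j hψ x), add_mul]
  exact (abs_add_le _ _).trans (add_le_add (h1 j hj) (h2 j hj))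

theorem Bd.const_mul {s : ℕ} {a l : ℝ} {φ : ℝ → ℝ} {x : ℝ} (c : ℝ) (h1 : Bd s a l φ x) :
    Bd s (|c| * a) l (fun y => c * φ y) x := by
  intro j hj
  rw [iteratedDeriv_const_mul_field, abs_mul, mul_assoc]
  exact mul_le_mul_of_nonneg_left (h1 j hj) (abs_nonneg _)

theorem Bd.const {s : ℕ} {a l : ℝ} (x c : ℝ) (h : |c| ≤ a) (hl : 0 ≤ l) :
    Bd s a l (fun _ => c) x := by
  intro j hj
  rw [iteratedDeriv_const]
  have : 0 ≤ a := (abs_nonneg c).trans h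
  rcases Nat.eq_zero_or_pos j with rfl | hj'
  · simpa using h
  · rw [if_neg hj'.ne']; simp; positivity

/-- Faà di Bruno estimate, linear in the outer bound. -/
theorem comp_iter_le {s : ℕ} {C l : ℝ} {f u : ℝ → ℝ} {x : ℝ} (hf : Sm f) (hu : Sm u)
    (h1 : ∀ i ≤ s, |iteratedDeriv i f (u x)| ≤ C)
    (h2 : ∀ i, 1 ≤ i → i ≤ s → |iteratedDeriv i u x| ≤ l ^ i) :
    |iteratedDeriv s (fun y => f (u y)) x| ≤ s.factorial * C * l ^ s := by
  have := norm_iteratedFDeriv_comp_le (𝕜 := ℝ) (n := s) (N := (⊤ : ℕ∞)) hf hu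
    (by exact_mod_cast le_top) x (C := C) (D := l)
    (fun i hi => by
      rw [norm_iteratedFDeriv_eq_norm_iteratedDeriv]; exact h1 i hi)
    (fun i hi hi' => by
      rw [norm_iteratedFDeriv_eq_norm_iteratedDeriv]; exact h2 i hi hi')
  rwa [norm_iteratedFDeriv_eq_norm_iteratedDeriv] at this

theorem Bd.comp {s : ℕ} {C l : ℝ} {f u : ℝ → ℝ} {x : ℝ} (hf : Sm f) (hu : Sm u) (hl : 0 ≤ l)
    (h1 : ∀ i ≤ s, |iteratedDeriv i f (u x)| ≤ C)
    (h2 : ∀ i, 1 ≤ i → i ≤ s → |iteratedDeriv i u x| ≤ l ^ i) :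
    Bd s (s.factorial * C) l (fun y => f (u y)) x := by
  intro j hj
  have hC : 0 ≤ C := (abs_nonneg _).trans (h1 0 (Nat.zero_le _))
  refine (comp_iter_le hf hu (fun i hi => h1 i (hi.trans hj))
    (fun i hi hi' => h2 i hi (hi'.trans hj))).trans ?_
  gcongr

theorem Bd.of_deriv {s : ℕ} {a : ℝ} {φ : ℝ → ℝ} {x : ℝ} (h0 : |φ x| ≤ a)
    (h : Bd s a 1 (deriv φ) x) : Bd (s + 1) a 1 φ x := by
  intro j hj
  rcases j with _ | j
  · simpa using h0
  · rw [iteratedDeriv_succ']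
    simpa using h j (by omega)

theorem bd_one_iff {s : ℕ} {a : ℝ} {φ : ℝ → ℝ} {x : ℝ} :
    Bd s a 1 φ x ↔ ∀ j ≤ s, |iteratedDeriv j φ x| ≤ a := by
  simp [Bd]

theorem Bd.neg {s : ℕ} {a l : ℝ} {φ : ℝ → ℝ} {x : ℝ} (h : Bd s a l φ x) :
    Bd s a l (fun y => - φ y) x := by
  intro j hj
  have := iteratedDeriv_const_mul_field (𝕜 := ℝ) (n := j) (x := x) (-1 : ℝ) φ
  simp only [neg_mul, one_mul] at this
  rw [this, abs_neg]; exact h j hj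

theorem two_pow_le_pow {B : ℝ} (hB : 2 ≤ B) (s : ℕ) : (2 : ℝ) ^ s ≤ B ^ s :=
  pow_le_pow_left₀ (by norm_num) hB s

theorem factorial_le_pow_sq {B : ℝ} (hB : 2 ≤ B) (s : ℕ) : (s.factorial : ℝ) ≤ B ^ (s * s) := by
  have h1 : (s.factorial : ℝ) ≤ (s : ℝ) ^ s := by exact_mod_cast Nat.factorial_le_pow s
  have h2 : (s : ℝ) ≤ 2 ^ s := by exact_mod_cast Nat.lt_two_pow_self.le
  calc _ ≤ (s : ℝ) ^ s := h1
    _ ≤ (2 ^ s) ^ s := by gcongr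
    _ = 2 ^ (s * s) := by rw [pow_mul]
    _ ≤ _ := two_pow_le_pow hB _

/-- Bounds for a composition, all constants being powers of a common bound. -/
theorem Bd.comp_pow (s : ℕ) {B : ℝ} (hB : 2 ≤ B) {f u : ℝ → ℝ} {x : ℝ} (a b : ℕ)
    (hf : Sm f) (hu : Sm u) (h1 : ∀ i ≤ s, |iteratedDeriv i f (u x)| ≤ B ^ a)
    (h2 : ∀ i, 1 ≤ i → i ≤ s → |iteratedDeriv i u x| ≤ B ^ b) :
    Bd s (B ^ (s * s + a + b * s)) 1 (fun y => f (u y)) x := by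
  have hB1 : 1 ≤ B := by linarith
  intro j hj
  have := comp_iter_le (s := j) (C := B ^ a) (l := B ^ b) hf hu (fun i hi => h1 i (hi.trans hj))
    (fun i hi hi' => (h2 i hi (hi'.trans hj)).trans (le_self_pow₀ (one_le_pow₀ hB1) (by omega)))
  refine this.trans ?_
  rw [one_pow, mul_one, pow_add, pow_add, pow_mul B b s]
  have h3 : (j.factorial : ℝ) ≤ B ^ (s * s) :=
    (factorial_le_pow_sq hB j).trans (pow_le_pow_right₀ hB1 (Nat.mul_le_mul hj hj))
  have h4 : (B ^ b) ^ j ≤ (B ^ b) ^ s := pow_le_pow_right₀ (one_le_pow₀ hB1) hj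
  gcongr

theorem deriv_comp_sm {f u : ℝ → ℝ} (hf : Sm f) (hu : Sm u) :
    deriv (fun y => f (u y)) = fun y => deriv f (u y) * deriv u y := by
  ext y
  exact ((Sm.diff hf _).hasDerivAt.comp y (Sm.diff hu y).hasDerivAt).deriv

theorem comp_sm {f u : ℝ → ℝ} (hf : Sm f) (hu : Sm u) : Sm (fun y => f (u y)) := hf.comp hu

/-- Compositions with nearby inner functions are close, with polynomial control. -/
theorem comp_diff (s : ℕ) : ∃ A : ℕ, ∀ B : ℝ, 2 ≤ B → ∀ η : ℝ, 0 ≤ η → ∀ k y z : ℝ → ℝ, ∀ x : ℝ,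
    Sm k → Sm y → Sm z →
    (∀ j, 1 ≤ j → j ≤ s + 1 → ∀ w ∈ Set.uIcc (y x) (z x), |iteratedDeriv j k w| ≤ B) →
    (∀ j, 1 ≤ j → j ≤ s → |iteratedDeriv j y x| ≤ B ∧ |iteratedDeriv j z x| ≤ B) →
    Bd s η 1 (fun x => y x - z x) x →
    Bd s (B ^ A * η) 1 (fun x => k (y x) - k (z x)) x := by
  induction s with
  | zero =>
    refine ⟨1, ?_⟩
    intro B hB η hη k y z x hk hy hz h1 h2 h3 j hj
    obtain rfl : j = 0 := by omega
    have h4 : |y x - z x| ≤ η := by simpa using h3 0 le_rfl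
    simp only [iteratedDeriv_zero, pow_one, pow_zero, mul_one]
    have := (convex_uIcc (y x) (z x)).norm_image_sub_le_of_norm_deriv_le (f := k) (C := B)
      (fun w _ => Sm.diff hk w) (fun w hw => by simpa using h1 1 le_rfl le_rfl w hw)
      (Set.right_mem_uIcc) (Set.left_mem_uIcc)
    refine this.trans ?_
    gcongr
    exact h4
  | succ s ih =>
    obtain ⟨A, hA⟩ := ih
    refine ⟨s + A + 1 + (s + (s * s + 1 + 1 * s)) + 1, ?_⟩
    intro B hB η hη k y z x hk hy hz h1 h2 h3
    have hB1 : 1 ≤ B := by linarith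
    have hyz : Sm (fun x => y x - z x) := hy.sub hz
    have e0 : deriv (fun x => y x - z x) = fun x => deriv y x - deriv z x := by
      ext w; exact deriv_fun_sub (Sm.diff hy w) (Sm.diff hz w)
    have h3' : Bd s η 1 (deriv (fun x => y x - z x)) x := by
      intro j hj
      have := h3 (j + 1) (by omega)
      rwa [iteratedDeriv_succ', one_pow, ← one_pow j] at this
    have a1 := hA B hB η hη (deriv k) y z x (Sm.deriv hk) hy hz
      (fun j hj hj' w hw => by
        have := h1 (j + 1) (by omega) (by omega) w hw
        rwa [iteratedDeriv_succ'] at this)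
      (fun j hj hj' => h2 j hj (by omega)) (h3.mono_order (by omega))
    have a2 : Bd s B 1 (deriv y) x := by
      rw [bd_one_iff]
      intro j hj
      have := (h2 (j + 1) (by omega) (by omega)).1
      rwa [iteratedDeriv_succ'] at this
    have a3 : Bd s (B ^ (s * s + 1 + 1 * s)) 1 (fun x => deriv k (z x)) x :=
      Bd.comp_pow s hB 1 1 (Sm.deriv hk) hz (fun i hi => by
        have := h1 (i + 1) (by omega) (by omega) (z x) Set.right_mem_uIcc
        rwa [iteratedDeriv_succ', ← pow_one B] at this) (fun i hi hi' => by
        have := (h2 i hi (by omega)).2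
        rwa [← pow_one B] at this)
    have b1 := Bd.mul ((comp_sm (Sm.deriv hk) hy).sub (comp_sm (Sm.deriv hk) hz)) (Sm.deriv hy)
      a1 a2 (by positivity) (by positivity) zero_le_one
    have b2 := Bd.mul (comp_sm (Sm.deriv hk) hz) (Sm.deriv hyz) a3 h3' (by positivity) hη
      zero_le_one
    have b := Bd.add (by
      exact ((comp_sm (Sm.deriv hk) hy).sub (comp_sm (Sm.deriv hk) hz)).mul (Sm.deriv hy)) (by
      exact (comp_sm (Sm.deriv hk) hz).mul (Sm.deriv hyz)) b1 b2
    have e1 : deriv (fun x => k (y x) - k (z x)) = fun x =>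
        (deriv k (y x) - deriv k (z x)) * deriv y x +
        deriv k (z x) * deriv (fun x => y x - z x) x := by
      ext w
      rw [deriv_fun_sub (Sm.diff (comp_sm hk hy) w) (Sm.diff (comp_sm hk hz) w),
        deriv_comp_sm hk hy, deriv_comp_sm hk hz, e0]
      ring
    have key : 2 ^ s * (B ^ A * η) * B + 2 ^ s * B ^ (s * s + 1 + 1 * s) * η ≤
        B ^ (s + A + 1 + (s + (s * s + 1 + 1 * s)) + 1) * η := by
      set c := s * s + 1 + 1 * s
      have t1 : (2 : ℝ) ^ s * B ^ A * B ≤ B ^ (s + A + 1 + (s + c)) := by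
        calc (2 : ℝ) ^ s * B ^ A * B ≤ B ^ s * B ^ A * B := by gcongr
          _ = B ^ (s + A + 1) := by ring
          _ ≤ _ := pow_le_pow_right₀ hB1 (by omega)
      have t2 : (2 : ℝ) ^ s * B ^ c ≤ B ^ (s + A + 1 + (s + c)) := by
        calc (2 : ℝ) ^ s * B ^ c ≤ B ^ s * B ^ c := by gcongr
          _ = B ^ (s + c) := by ring
          _ ≤ _ := pow_le_pow_right₀ hB1 (by omega)
      calc _ = ((2 : ℝ) ^ s * B ^ A * B + 2 ^ s * B ^ c) * η := by ring
        _ ≤ (2 * B ^ (s + A + 1 + (s + c))) * η := by gcongr; linarith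
        _ ≤ (B * B ^ (s + A + 1 + (s + c))) * η := by gcongr
        _ = _ := by ring
    apply Bd.of_deriv
    · have := hA B hB η hη k y z x hk hy hz (fun j hj hj' => h1 j hj (by omega))
        (fun j hj hj' => h2 j hj (by omega)) (h3.mono_order (by omega)) 0 (Nat.zero_le _)
      simp only [iteratedDeriv_zero, pow_zero, mul_one] at this
      refine this.trans ?_
      exact mul_le_mul_of_nonneg_right (pow_le_pow_right₀ hB1 (by omega)) hη
    · rw [e1]
      exact b.mono key (by positivity) zero_le_one le_rfl

theorem deriv_inv_sm {u : ℝ → ℝ} (hu : Sm u) (h : ∀ x, 0 < u x) :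
    deriv (fun x => (u x)⁻¹) = fun x => -(deriv u x * ((u x)⁻¹ * (u x)⁻¹)) := by
  ext y
  rw [((Sm.diff hu y).hasDerivAt.fun_inv (h y).ne').deriv]
  have := (h y).ne'
  field_simp

theorem inv_sm {u : ℝ → ℝ} (hu : Sm u) (h : ∀ x, 0 < u x) : Sm (fun x => (u x)⁻¹) :=
  hu.inv fun x => (h x).ne'

theorem Bd.recip (s : ℕ) : ∃ A : ℕ, 1 ≤ A ∧ ∀ B : ℝ, 2 ≤ B → ∀ u : ℝ → ℝ, ∀ x : ℝ, Sm u →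
    (∀ x, 0 < u x) → (u x)⁻¹ ≤ B → Bd s B 1 u x → Bd s (B ^ A) 1 (fun x => (u x)⁻¹) x := by
  induction s with
  | zero =>
    refine ⟨1, le_rfl, ?_⟩
    intro B hB u x hu hp h _ j hj
    obtain rfl : j = 0 := by omega
    simpa [abs_of_pos (hp x)] using h
  | succ s ih =>
    obtain ⟨A, hA1, hA⟩ := ih
    refine ⟨s + 1 + (s + A + A), by omega, ?_⟩
    intro B hB u x hu hp h h2
    have hB1 : 1 ≤ B := by linarith
    have a1 := hA B hB u x hu hp h (h2.mono_order (by omega))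
    have hi := inv_sm hu hp
    have a2 : Bd s B 1 (deriv u) x := by
      intro j hj
      have := h2 (j + 1) (by omega)
      rwa [iteratedDeriv_succ', one_pow, ← one_pow j] at this
    have a3 := Bd.mul hi hi a1 a1 (by positivity) (by positivity) zero_le_one
    have a4 := (Bd.mul (Sm.deriv hu) (hi.mul hi) a2 a3 (by positivity) (by positivity)
      zero_le_one).neg
    apply Bd.of_deriv
    · rw [abs_of_pos (inv_pos.2 (hp x))]
      exact h.trans (le_self_pow₀ hB1 (by omega))
    · rw [deriv_inv_sm hu hp]
      refine a4.mono ?_ (by positivity) zero_le_one le_rfl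
      have := two_pow_le_pow hB s
      calc _ ≤ B ^ s * B * (B ^ s * B ^ A * B ^ A) := by gcongr
        _ = _ := by ring

/-- Derivative bounds for the inverse of a diffeomorphism. -/
theorem inverse_bound (s : ℕ) : ∃ A : ℕ, 1 ≤ A ∧ ∀ B : ℝ, 2 ≤ B → ∀ H k : ℝ → ℝ, ∀ z : ℝ,
    Sm H → Sm k → (∀ x, 0 < deriv H x) → (∀ x, H (k x) = x) → k (H z) = z →
    (deriv H z)⁻¹ ≤ B →
    (∀ j, 1 ≤ j → j ≤ s → |iteratedDeriv j H z| ≤ B) →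
    ∀ j, 1 ≤ j → j ≤ s → |iteratedDeriv j k (H z)| ≤ B ^ A := by
  induction s with
  | zero => exact ⟨1, le_rfl, fun _ _ _ _ _ _ _ _ _ _ _ _ j h1 h2 => by omega⟩
  | succ s ih =>
    obtain ⟨A, hA1, hA⟩ := ih
    obtain ⟨R, hR1, hR⟩ := Bd.recip s
    refine ⟨A + (s * s + R + A * s), by omega, ?_⟩
    intro B hB H k z hH hk hp hHk hkz hz hb
    have hB1 : 1 ≤ B := by linarith
    have hk' : deriv k = fun x => (deriv H (k x))⁻¹ := by
      ext x
      have h1 : deriv (fun y => H (k y)) x = 1 := by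
        have : (fun y => H (k y)) = id := funext hHk
        rw [this]; simp
      rw [deriv_comp_sm hH hk] at h1
      exact eq_inv_of_mul_eq_one_right h1
    have c1 := hA B hB H k z hH hk hp hHk hkz hz (fun j hj hj' => hb j hj (by omega))
    have c2 := hR B hB (deriv H) z (Sm.deriv hH) hp hz (by
      rw [bd_one_iff]
      intro j hj
      have := hb (j + 1) (by omega) (by omega)
      rwa [iteratedDeriv_succ'] at this)
    have c3 := Bd.comp_pow s hB (f := fun x => (deriv H x)⁻¹) (u := k) (x := H z) R A
      (inv_sm (Sm.deriv hH) hp) hk (by rw [hkz]; exact bd_one_iff.1 c2) c1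
    intro j hj hj'
    obtain ⟨j, rfl⟩ : ∃ i, j = i + 1 := ⟨j - 1, by omega⟩
    rw [iteratedDeriv_succ', hk']
    exact (bd_one_iff.1 c3 j (by omega)).trans (pow_le_pow_right₀ hB1 (by omega))

namespace IsCircleDiffeoLift
variable {f h : ℝ → ℝ}

theorem sm (hf : IsCircleDiffeoLift f) : Sm f := hf.1
theorem pos (hf : IsCircleDiffeoLift f) (x : ℝ) : 0 < deriv f x := hf.2.2 x
theorem strictMono (hf : IsCircleDiffeoLift f) : StrictMono f := strictMono_of_deriv_pos hf.2.2
theorem cont (hf : IsCircleDiffeoLift f) : Continuous f := hf.1.continuous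

/-- The underlying element of Mathlib's monoid of degree one monotone lifts. -/
def toLift (hf : IsCircleDiffeoLift f) : CircleDeg1Lift :=
  ⟨⟨f, hf.strictMono.monotone⟩, hf.2.1⟩

theorem coe_toLift (hf : IsCircleDiffeoLift f) : (hf.toLift : ℝ → ℝ) = f := rfl

theorem add_int (hf : IsCircleDiffeoLift f) (x : ℝ) (n : ℤ) : f (x + n) = f x + n :=
  hf.toLift.map_add_int x n

theorem surj (hf : IsCircleDiffeoLift f) : Function.Surjective f := by
  have h1 : ∀ n : ℕ, f n = f 0 + n := fun n => by simpa using hf.add_int 0 n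
  have h2 : ∀ n : ℕ, f (-n) = f 0 - n := fun n => by
    have := hf.add_int 0 (-n); simpa [sub_eq_add_neg] using this
  intro y
  obtain ⟨n, hn⟩ := exists_nat_ge (|y - f 0|)
  have h3 := abs_le.1 hn
  obtain ⟨x, -, hx⟩ := intermediate_value_Icc (a := -(n : ℝ)) (b := n)
    (by linarith [n.cast_nonneg (α := ℝ)]) hf.cont.continuousOn
    (show y ∈ Set.Icc (f (-n)) (f n) from ⟨by rw [h2]; linarith, by rw [h1]; linarith⟩)
  exact ⟨x, hx⟩

theorem inv_apply (hf : IsCircleDiffeoLift f) (x : ℝ) : Function.invFun f (f x) = x :=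
  Function.leftInverse_invFun hf.strictMono.injective x

theorem apply_inv (hf : IsCircleDiffeoLift f) (x : ℝ) : f (Function.invFun f x) = x :=
  Function.rightInverse_invFun hf.surj x

theorem inv_sm (hf : IsCircleDiffeoLift f) : Sm (Function.invFun f) := by
  let e : ℝ ≃o ℝ := hf.strictMono.orderIsoOfSurjective f hf.surj
  have he : ∀ x, e.toHomeomorph.symm x = Function.invFun f x := fun x => by
    apply hf.strictMono.injective
    rw [hf.apply_inv]
    exact e.apply_symm_apply x
  have := e.toHomeomorph.contDiff_symm_deriv (n := ((⊤ : ℕ∞) : WithTop ℕ∞)) (f' := deriv f)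
    (fun x => (hf.pos x).ne') (fun x => (Sm.diff hf.sm x).hasDerivAt) hf.sm
  have e2 : (e.toHomeomorph.symm : ℝ → ℝ) = Function.invFun f := funext he
  rwa [e2] at this

theorem deriv_inv (hf : IsCircleDiffeoLift f) (x : ℝ) :
    deriv (Function.invFun f) x = (deriv f (Function.invFun f x))⁻¹ := by
  have h1 : deriv (fun y => f (Function.invFun f y)) x = 1 := by
    have : (fun y => f (Function.invFun f y)) = id := funext hf.apply_inv
    rw [this]; simp
  rw [deriv_comp_sm hf.sm hf.inv_sm] at h1
  exact eq_inv_of_mul_eq_one_right h1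

theorem inv (hf : IsCircleDiffeoLift f) : IsCircleDiffeoLift (Function.invFun f) := by
  refine ⟨hf.inv_sm, fun x => ?_, fun x => ?_⟩
  · apply hf.strictMono.injective
    rw [hf.2.1, hf.apply_inv, hf.apply_inv]
  · rw [hf.deriv_inv]; exact inv_pos.2 (hf.pos _)

theorem comp (hf : IsCircleDiffeoLift f) (hh : IsCircleDiffeoLift h) :
    IsCircleDiffeoLift (fun x => f (h x)) := by
  refine ⟨comp_sm hf.sm hh.sm, fun x => ?_, fun x => ?_⟩
  · simp only [hh.2.1, hf.2.1]
  · rw [deriv_comp_sm hf.sm hh.sm]; exact mul_pos (hf.pos _) (hh.pos _)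

theorem add_const (hf : IsCircleDiffeoLift f) (c : ℝ) : IsCircleDiffeoLift (fun x => f x + c) := by
  refine ⟨hf.sm.add contDiff_const, fun x => ?_, fun x => ?_⟩
  · simp only [hf.2.1]; ring
  · rw [deriv_add_const]; exact hf.pos x

theorem id : IsCircleDiffeoLift (fun x => x) :=
  ⟨contDiff_id, fun _ => rfl, fun x => by simp⟩

theorem iter (hf : IsCircleDiffeoLift f) (n : ℕ) : IsCircleDiffeoLift (f^[n]) := by
  induction n with
  | zero => exact IsCircleDiffeoLift.id
  | succ n ih => rw [Function.iterate_succ']; exact hf.comp ih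

/-- The conjugate of the rotation by `τ`. -/
theorem conj (hf : IsCircleDiffeoLift f) (τ : ℝ) :
    IsCircleDiffeoLift (fun x => Function.invFun f (f x + τ)) :=
  hf.inv.comp (hf.add_const τ)

theorem conj_iter (hf : IsCircleDiffeoLift f) (τ : ℝ) (n : ℕ) (x : ℝ) :
    (fun x => Function.invFun f (f x + τ))^[n] x = Function.invFun f (f x + n * τ) := by
  induction n generalizing x with
  | zero => simp [hf.inv_apply]
  | succ n ih =>
    rw [Function.iterate_succ_apply, ih, hf.apply_inv]
    congr 1; push_cast; ring

end IsCircleDiffeoLift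

/-- The derivatives of `f - id` are bounded by periodicity; this covers every periodic function. -/
theorem periodic_bdd {φ : ℝ → ℝ} (hc : Continuous φ) (hp : ∀ x, φ (x + 1) = φ x) :
    ∃ C, ∀ x, |φ x| ≤ C := by
  obtain ⟨C, hC⟩ := isCompact_Icc.exists_bound_of_continuousOn (s := Set.Icc (0 : ℝ) 1)
    hc.continuousOn
  refine ⟨C, fun x => ?_⟩
  have hper : Function.Periodic φ 1 := hp
  obtain ⟨y, hy, hxy⟩ := hper.exists_mem_Ico₀ one_pos x
  rw [hxy]; exact hC y ⟨hy.1, hy.2.le⟩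

theorem iteratedDeriv_periodic {φ : ℝ → ℝ} {c : ℝ} (hp : ∀ x, φ (x + c) = φ x) (n : ℕ) (x : ℝ) :
    iteratedDeriv n φ (x + c) = iteratedDeriv n φ x := by
  have := iteratedDeriv_comp_add_const n φ c
  have e : (fun z => φ (z + c)) = φ := funext hp
  rw [e] at this
  exact (congrFun this x).symm

theorem periodic_iter_bdd {φ : ℝ → ℝ} (hs : Sm φ) (hp : ∀ x, φ (x + 1) = φ x) (n : ℕ) :
    ∃ C, ∀ j ≤ n, ∀ x, |iteratedDeriv j φ x| ≤ C := by
  have h : ∀ j : ℕ, ∃ C, ∀ x, |iteratedDeriv j φ x| ≤ C := fun j =>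
    periodic_bdd (Sm.iter hs j).continuous (iteratedDeriv_periodic hp j)
  choose C hC using h
  refine ⟨∑ i ∈ Finset.range (n + 1), C i, fun j hj x => (hC j x).trans ?_⟩
  exact Finset.single_le_sum (f := C) (fun i _ => (abs_nonneg _).trans (hC i 0))
    (Finset.mem_range.2 (by omega))

theorem lift_deriv_periodic {f : ℝ → ℝ} (hp : ∀ x, f (x + 1) = f x + 1) (x : ℝ) :
    deriv f (x + 1) = deriv f x := by
  have h1 : (fun y => f (y + 1)) = fun y => f y + 1 := funext hp
  have h2 := deriv_comp_add_const f 1 x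
  rw [h1, deriv_add_const] at h2
  exact h2.symm

/-- The derivatives of positive order of a lift are bounded. -/
theorem lift_iter_bdd {f : ℝ → ℝ} (hf : IsCircleDiffeoLift f) (n : ℕ) :
    ∃ B, 2 ≤ B ∧ (∀ x, (deriv f x)⁻¹ ≤ B) ∧
      ∀ j, 1 ≤ j → j ≤ n → ∀ x, |iteratedDeriv j f x| ≤ B := by
  obtain ⟨C, hC⟩ := periodic_iter_bdd (Sm.deriv hf.sm) (lift_deriv_periodic hf.2.1) n
  obtain ⟨D, hD⟩ := periodic_bdd (inv_sm (Sm.deriv hf.sm) hf.pos).continuous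
    (fun x => by rw [lift_deriv_periodic hf.2.1])
  refine ⟨max 2 (max C D), le_max_left _ _, fun x => ?_, fun j h1 h2 x => ?_⟩
  · exact (le_abs_self _).trans ((hD x).trans ((le_max_right _ _).trans (le_max_right _ _)))
  · obtain ⟨j, rfl⟩ : ∃ i, j = i + 1 := ⟨j - 1, by omega⟩
    rw [iteratedDeriv_succ']
    exact (hC j (by omega) x).trans ((le_max_left _ _).trans (le_max_right _ _))

/-- `C^r`-closeness of lifts, pointwise. -/
def CrClose (r : ℕ) (ε : ℝ) (f g : ℝ → ℝ) : Prop :=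
  ∀ i ≤ r, ∀ x, |iteratedDeriv i (fun x => f x - g x) x| ≤ ε

theorem CrClose.trans {r : ℕ} {ε δ : ℝ} {f g h : ℝ → ℝ} (hf : Sm f) (hg : Sm g) (hh : Sm h)
    (h1 : CrClose r ε f g) (h2 : CrClose r δ g h) : CrClose r (ε + δ) f h := by
  intro i hi x
  have := Bd.add (s := r) (a := ε) (b := δ) (l := 1) (x := x) (hf.sub hg) (hg.sub hh)
    (bd_one_iff.2 fun j hj => h1 j hj x) (bd_one_iff.2 fun j hj => h2 j hj x)
  have e : (fun x => (f x - g x) + (g x - h x)) = fun x => f x - h x := by ext; ring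
  have t := bd_one_iff.1 this i hi
  rwa [e] at t

theorem CrClose.symm {r : ℕ} {ε : ℝ} {f g : ℝ → ℝ} (h1 : CrClose r ε f g) : CrClose r ε g f := by
  intro i hi x
  have := (Bd.neg (s := r) (a := ε) (l := 1) (x := x) (bd_one_iff.2 fun j hj => h1 j hj x))
  have e : (fun x => -(f x - g x)) = fun x => g x - f x := by ext; ring
  rw [e] at this
  exact bd_one_iff.1 this i hi

theorem CrClose.mono {r s : ℕ} {ε δ : ℝ} {f g : ℝ → ℝ} (h : CrClose r ε f g) (hsr : s ≤ r)
    (hε : ε ≤ δ) : CrClose s δ f g := fun i hi x => (h i (hi.trans hsr) x).trans hε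

theorem CrNorm_lt {r : ℕ} {ε δ : ℝ} {φ : ℝ → ℝ} (hδ : δ < ε)
    (h : ∀ i ≤ r, ∀ x, |iteratedDeriv i φ x| ≤ δ) : CrNorm r φ < ε := by
  unfold CrNorm
  rw [Finset.sup'_lt_iff]
  intro i hi
  refine lt_of_le_of_lt (ciSup_le (h i ?_)) hδ
  simpa [Nat.lt_succ_iff] using hi

/-- A positive function of period one is bounded below. -/
theorem lift_deriv_lower {f : ℝ → ℝ} (hf : IsCircleDiffeoLift f) :
    ∃ c, 0 < c ∧ ∀ x, c ≤ deriv f x := by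
  obtain ⟨B, hB, h1, -⟩ := lift_iter_bdd hf 0
  refine ⟨B⁻¹, by positivity, fun x => ?_⟩
  exact (inv_le_comm₀ (hf.pos x) (by linarith)).1 (h1 x)

theorem comp_iter_le_pos {s : ℕ} (hs : 1 ≤ s) {C l : ℝ} {f u : ℝ → ℝ} {x : ℝ} (hC : 0 ≤ C)
    (hf : Sm f) (hu : Sm u) (h1 : ∀ i, 1 ≤ i → i ≤ s → |iteratedDeriv i f (u x)| ≤ C)
    (h2 : ∀ i, 1 ≤ i → i ≤ s → |iteratedDeriv i u x| ≤ l ^ i) :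
    |iteratedDeriv s (fun y => f (u y)) x| ≤ s.factorial * C * l ^ s := by
  have hf' : Sm (fun z => f z - f (u x)) := hf.sub contDiff_const
  have key : ∀ (i : ℕ) (φ : ℝ → ℝ) (c z : ℝ), Sm φ → 1 ≤ i →
      iteratedDeriv i (fun z => φ z - c) z = iteratedDeriv i φ z := by
    intro i φ c z hφ hi
    have e := iteratedDeriv_sub (n := i) (x := z) (Sm.at i hφ z)
      (contDiff_const (c := c)).contDiffAt
    change iteratedDeriv i (fun z => φ z - c) z = _ at e
    rw [e, iteratedDeriv_const, if_neg (by omega), sub_zero]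
  have := comp_iter_le (s := s) (C := C) (l := l) (x := x) hf' hu (fun i hi => by
    rcases Nat.eq_zero_or_pos i with rfl | hi'
    · simpa using hC
    · rw [key i f _ _ hf hi']; exact h1 i hi' hi) h2
  rwa [key s (fun y => f (u y)) _ _ (comp_sm hf hu) hs] at this

theorem comp_pow_pos (s : ℕ) {B : ℝ} (hB : 2 ≤ B) {f u : ℝ → ℝ} {x : ℝ} (a b : ℕ)
    (hf : Sm f) (hu : Sm u) (h1 : ∀ i, 1 ≤ i → i ≤ s → |iteratedDeriv i f (u x)| ≤ B ^ a)
    (h2 : ∀ i, 1 ≤ i → i ≤ s → |iteratedDeriv i u x| ≤ B ^ b) :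
    ∀ j, 1 ≤ j → j ≤ s → |iteratedDeriv j (fun y => f (u y)) x| ≤ B ^ (s * s + a + b * s) := by
  have hB1 : 1 ≤ B := by linarith
  intro j hj1 hj
  have := comp_iter_le_pos hj1 (C := B ^ a) (l := B ^ b) (by positivity) hf hu
    (fun i hi0 hi => h1 i hi0 (hi.trans hj))
    (fun i hi hi' => (h2 i hi (hi'.trans hj)).trans (le_self_pow₀ (one_le_pow₀ hB1) (by omega)))
  refine this.trans ?_
  rw [pow_add, pow_add, pow_mul B b s]
  have h3 : (j.factorial : ℝ) ≤ B ^ (s * s) :=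
    (factorial_le_pow_sq hB j).trans (pow_le_pow_right₀ hB1 (Nat.mul_le_mul hj hj))
  have h4 : (B ^ b) ^ j ≤ (B ^ b) ^ s := pow_le_pow_right₀ (one_le_pow₀ hB1) hj
  gcongr

theorem iteratedDeriv_id_le (j : ℕ) (hj : 1 ≤ j) (x : ℝ) :
    |iteratedDeriv j (fun x : ℝ => x) x| ≤ 1 := by
  obtain ⟨j, rfl⟩ : ∃ i, j = i + 1 := ⟨j - 1, by omega⟩
  rw [iteratedDeriv_succ']
  have : deriv (fun x : ℝ => x) = fun _ => 1 := by ext; simp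
  rw [this, iteratedDeriv_const]
  split_ifs <;> simp

/-- Closeness of lifts implies closeness of their inverses. -/
theorem inverse_close {g : ℝ → ℝ} (hg : IsCircleDiffeoLift g) (r : ℕ) {ε : ℝ} (hε : 0 < ε) :
    ∃ δ, 0 < δ ∧ ∀ f, IsCircleDiffeoLift f → CrClose (r + 1) δ f g →
      CrClose r ε (Function.invFun f) (Function.invFun g) := by
  obtain ⟨B0, hB0, hB1, hB2⟩ := lift_iter_bdd hg (r + 1)
  obtain ⟨K, hK, -, hK2⟩ := lift_iter_bdd hg.inv (r + 1)
  obtain ⟨A, hA1, hA⟩ := inverse_bound (r + 1)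
  obtain ⟨E, hE⟩ := comp_diff r
  set B := 2 * B0 + K with hBdef
  have hB : 2 ≤ B := by rw [hBdef]; linarith
  have hBp : 1 ≤ B := by linarith
  set W := B ^ (r * r + 1 + A * r + A + 1) with hW
  have hBW : B ≤ W := le_self_pow₀ hBp (by omega)
  have hBAW : B ^ A ≤ W := pow_le_pow_right₀ hBp (by omega)
  have hW2 : 2 ≤ W := hB.trans hBW
  have hKB : K ≤ B := by rw [hBdef]; linarith
  have hfB : ∀ δ, δ ≤ 1 → δ ≤ (2 * B0)⁻¹ → ∀ f, IsCircleDiffeoLift f → CrClose (r + 1) δ f g →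
      (∀ z, (deriv f z)⁻¹ ≤ B) ∧ ∀ j, 1 ≤ j → j ≤ r + 1 → ∀ z, |iteratedDeriv j f z| ≤ B := by
    intro δ hδ1 hδ2 f hf hfg
    have hsub : ∀ j z, iteratedDeriv j (fun x => f x - g x) z =
        iteratedDeriv j f z - iteratedDeriv j g z := fun j z =>
      iteratedDeriv_sub (Sm.at j hf.sm z) (Sm.at j hg.sm z)
    constructor
    · intro z
      have h1 := hfg 1 (by omega) z
      rw [hsub, iteratedDeriv_one, iteratedDeriv_one] at h1
      have h2 := (inv_le_comm₀ (hg.pos z) (by linarith)).1 (hB1 z)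
      have h3 : (2 * B0)⁻¹ = B0⁻¹ / 2 := by rw [mul_inv]; ring
      have h4 : (2 * B0)⁻¹ ≤ deriv f z := by
        have := (abs_le.1 h1).1; linarith
      calc _ ≤ 2 * B0 := (inv_le_comm₀ (hf.pos z) (by linarith)).2 h4
        _ ≤ B := by rw [hBdef]; linarith
    · intro j h1 h2 z
      have h3 := hfg j h2 z
      rw [hsub] at h3
      have h4 := hB2 j h1 h2 z
      have h5 : |iteratedDeriv j f z| ≤ |iteratedDeriv j f z - iteratedDeriv j g z| +
        |iteratedDeriv j g z| := by
          simpa using abs_add_le (iteratedDeriv j f z - iteratedDeriv j g z) (iteratedDeriv j g z)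
      rw [hBdef]; linarith
  set P := W ^ E * (r.factorial * W ^ r) with hP
  have hP' : 0 < P := by
    rw [hP]
    have : (0 : ℝ) < r.factorial := by exact_mod_cast r.factorial_pos
    positivity
  set δ := min (min 1 (2 * B0)⁻¹) (ε / P) with hδ
  have hδ0 : 0 < δ := by rw [hδ]; positivity
  refine ⟨δ, hδ0, fun f hf hfg => ?_⟩
  obtain ⟨b1, b2⟩ := hfB δ ((min_le_left _ _).trans (min_le_left _ _))
    ((min_le_left _ _).trans (min_le_right _ _)) f hf hfg
  have b3 : ∀ j, 1 ≤ j → j ≤ r + 1 → ∀ w, |iteratedDeriv j (Function.invFun f) w| ≤ B ^ A := by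
    intro j h1 h2 w
    have := hA B hB f (Function.invFun f) (Function.invFun f w) hf.sm hf.inv_sm hf.pos
      hf.apply_inv (hf.inv_apply _) (b1 _) (fun j h1 h2 => b2 j h1 h2 _) j h1 h2
    rwa [hf.apply_inv] at this
  intro i hi x
  have hsmfg : Sm (fun x => g x - f x) := hg.sm.sub hf.sm
  have c1 : Bd r (r.factorial * δ * W ^ r) 1 (fun x => g (Function.invFun f x) - x) x := by
    have e : (fun x => g (Function.invFun f x) - x) =
        fun x => (fun z => g z - f z) (Function.invFun f x) := by
      ext x; simp only [hf.apply_inv]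
    rw [e, bd_one_iff]
    intro j hj
    have := comp_iter_le (s := j) (C := δ) (l := W) (x := x) hsmfg hf.inv_sm
      (fun i hi => hfg.symm i (by omega) _) (fun i h1 h2 =>
        (b3 i h1 (by omega) x).trans (hBAW.trans (le_self_pow₀ (by linarith) (by omega))))
    refine this.trans ?_
    have t1 : (j.factorial : ℝ) ≤ r.factorial := by exact_mod_cast Nat.factorial_le hj
    have t2 : W ^ j ≤ W ^ r := pow_le_pow_right₀ (by linarith) hj
    gcongr
  have c2 := hE W hW2 (r.factorial * δ * W ^ r) (by positivity) (Function.invFun g)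
    (fun x => g (Function.invFun f x)) (fun x => x) x hg.inv_sm (comp_sm hg.sm hf.inv_sm)
    contDiff_id (fun j h1 h2 w _ => (hK2 j h1 (by omega) w).trans (hKB.trans hBW))
    (fun j h1 h2 => by
      constructor
      · refine (comp_pow_pos r hB 1 A hg.sm hf.inv_sm (fun i h1 h2 => ?_)
          (fun i h1 h2 => b3 i h1 (by omega) x) j h1 h2).trans
            (pow_le_pow_right₀ hBp (by omega))
        rw [pow_one]
        refine (hB2 i h1 (by omega) _).trans ?_
        rw [hBdef]; linarith
      · exact (iteratedDeriv_id_le j h1 x).trans (by linarith)) c1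
  have c3 := bd_one_iff.1 c2 i hi
  simp only [hg.inv_apply] at c3
  refine c3.trans ?_
  have : δ * P ≤ ε := by
    have := min_le_right (min 1 (2 * B0)⁻¹) (ε / P)
    rw [← hδ] at this
    exact (le_div_iff₀ hP').1 this
  calc _ = δ * P := by rw [hP]; ring
    _ ≤ ε := this

/-- A periodic orbit of type `p / q` of a lift, listed in increasing order. -/
structure Orb (g : ℝ → ℝ) (p : ℤ) (q : ℕ) (y : ℤ → ℝ) : Prop where
  lift : IsCircleDiffeoLift g
  hq : 0 < q
  cop : IsCoprime p (q : ℤ)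
  mono : StrictMono y
  per : ∀ k, y (k + q) = y k + 1
  map : ∀ k, g (y k) = y (k + p)

theorem exists_orb {g : ℝ → ℝ} (hg : IsCircleDiffeoLift g) {p : ℤ} {q : ℕ} (hq : 0 < q)
    (hc : IsCoprime p (q : ℤ)) {x : ℝ} (hx : g^[q] x = x + p) : ∃ y, Orb g p q y ∧ y 0 = x := by
  obtain ⟨a, b, hab⟩ := hc
  let e : ℝ ≃o ℝ := hg.strictMono.orderIsoOfSurjective g hg.surj
  have he : ∀ z, e z = g z := fun z => rfl
  let T : ℝ ≃o ℝ := OrderIso.addRight 1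
  have hT1 : ∀ z, T z = z + 1 := fun z => rfl
  have hT : ∀ (n : ℤ) (z : ℝ), (T ^ n) z = z + n := by
    intro n
    induction n using Int.induction_on with
    | zero => intro z; simp
    | succ n ih => intro z; rw [zpow_add_one, RelIso.mul_apply, ih, hT1]; push_cast; ring
    | pred n ih =>
      intro z
      have h1 : (T⁻¹) z = z - 1 := by
        apply T.injective
        rw [RelIso.apply_inv_self, hT1]; ring
      rw [zpow_sub_one, RelIso.mul_apply, ih, h1]; push_cast; ring
  have hcomm : Commute e T := by
    ext z
    simp only [RelIso.mul_apply, hT1, he]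
    exact hg.2.1 z
  have hepow : ∀ (n : ℕ) (z : ℝ), (e ^ n) z = g^[n] z := by
    intro n
    induction n with
    | zero => intro z; simp
    | succ n ih => intro z; rw [pow_succ, RelIso.mul_apply, ih, he, Function.iterate_succ_apply]
  have hE : ∀ m n m' n' : ℤ, (e ^ m * T ^ n) * (e ^ m' * T ^ n') = e ^ (m + m') * T ^ (n + n') := by
    intro m n m' n'
    have := (hcomm.zpow_zpow m' n).eq
    rw [zpow_add, zpow_add, mul_assoc, ← mul_assoc (T ^ n), ← this]
    simp only [mul_assoc]
  have hEz : ∀ m n k : ℤ, (e ^ m * T ^ n) ^ k = e ^ (m * k) * T ^ (n * k) := by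
    intro m n k
    rw [(hcomm.zpow_zpow m n).mul_zpow, zpow_mul, zpow_mul]
  set G := e ^ a * T ^ b with hG
  set F := e ^ (q : ℤ) * T ^ (-p) with hF
  have hFx : F x = x := by
    have h1 : F * T ^ p = e ^ (q : ℤ) := by
      rw [hF, mul_assoc, ← zpow_add]; simp
    have h2 : (F * T ^ p) x = x + p := by
      rw [h1, zpow_natCast, hepow, hx]
    have h3 : F * T ^ p = T ^ p * F := by
      have := hE q (-p) 0 p
      have h4 := hE 0 p q (-p)
      simp only [zpow_zero, one_mul, zero_add, add_zero] at this h4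
      rw [hF, this, h4, add_comm]
    rw [h3, RelIso.mul_apply, hT] at h2
    linarith
  have hFk : ∀ k : ℤ, (F ^ k) x = x := by
    intro k
    induction k using Int.induction_on with
    | zero => simp
    | succ n ih => rw [zpow_add_one, RelIso.mul_apply, hFx, ih]
    | pred n ih =>
      have h1 : (F⁻¹) x = x := by
        apply F.injective
        rw [RelIso.apply_inv_self, hFx]
      rw [zpow_sub_one, RelIso.mul_apply, h1, ih]
  have hGq : G ^ (q : ℤ) = T * F ^ a := by
    have h1 := hE 0 1 (q * a) (-p * a)
    simp only [zpow_zero, one_mul, zpow_one, zero_add] at h1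
    rw [hG, hF, hEz, hEz, h1]
    congr 2
    · ring
    · linarith
  have hGp : G ^ p = e * F ^ (-b) := by
    have h1 := hE 1 0 (q * -b) (-p * -b)
    simp only [zpow_zero, zpow_one, mul_one, zero_add] at h1
    rw [hG, hF, hEz, hEz, h1]
    congr 2
    · linarith
    · ring
  have hGT : ∀ k : ℤ, Commute (G ^ k) T := fun k =>
    (((hcomm.zpow_left a).mul_left ((Commute.refl T).zpow_left b)).zpow_left k)
  have hGe : ∀ k : ℤ, Commute (G ^ k) e := fun k =>
    ((((Commute.refl e).zpow_left a).mul_left ((hcomm.symm).zpow_left b)).zpow_left k)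
  have hGqx : (G ^ (q : ℤ)) x = x + 1 := by
    rw [hGq, RelIso.mul_apply, hFk, hT1]
  have hlt : x < G x := by
    by_contra hcon
    push Not at hcon
    have : ∀ n : ℕ, (G ^ n) x ≤ x := by
      intro n
      induction n with
      | zero => simp
      | succ n ih =>
        rw [pow_succ, RelIso.mul_apply]
        exact ((G ^ n).monotone hcon).trans ih
    have h2 := this q
    rw [← zpow_natCast, hGqx] at h2
    linarith
  refine ⟨fun k => (G ^ k) x, ⟨hg, hq, ⟨a, b, hab⟩, strictMono_int_of_lt_succ fun k => ?_,
    fun k => ?_, fun k => ?_⟩, by simp⟩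
  · change (G ^ k) x < (G ^ (k + 1)) x
    rw [zpow_add_one, RelIso.mul_apply]
    exact (G ^ k).strictMono hlt
  · rw [zpow_add, RelIso.mul_apply, hGqx, ← hT1, ← RelIso.mul_apply, (hGT k).eq,
      RelIso.mul_apply, hT1]
  · rw [zpow_add, RelIso.mul_apply, hGp, RelIso.mul_apply, hFk, ← RelIso.mul_apply, (hGe k).eq,
      RelIso.mul_apply, he]

namespace Orb
variable {g : ℝ → ℝ} {p : ℤ} {q : ℕ} {y : ℤ → ℝ}

theorem iter (h : Orb g p q y) (n : ℕ) (k : ℤ) : g^[n] (y k) = y (k + n * p) := by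
  induction n with
  | zero => simp
  | succ n ih =>
    rw [Function.iterate_succ_apply', ih, h.map]
    congr 1; push_cast; ring

theorem per_int (h : Orb g p q y) (k m : ℤ) : y (k + q * m) = y k + m := by
  induction m using Int.induction_on with
  | zero => simp
  | succ n ih =>
    rw [mul_add, mul_one, ← add_assoc, h.per, ih]; push_cast; ring
  | pred n ih =>
    have := h.per (k + q * (-(n : ℤ) - 1))
    rw [show k + (q : ℤ) * (-(n : ℤ) - 1) + q = k + q * (-n) by ring, ih] at this
    push_cast at this ⊢
    linarith

end Orb

/-- A sum over one period along an arithmetic progression of coprime step. -/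
theorem sum_period {p : ℤ} {q : ℕ} (hq : 0 < q) (hc : IsCoprime p (q : ℤ)) {φ : ℤ → ℝ}
    (hφ : ∀ k, φ (k + q) = φ k) (k : ℤ) :
    ∑ i ∈ Finset.range q, φ (k + i * p) = ∑ j ∈ Finset.range q, φ j := by
  have hper : ∀ k m : ℤ, φ (k + q * m) = φ k := by
    intro k m
    induction m using Int.induction_on with
    | zero => simp
    | succ n ih => rw [mul_add, mul_one, ← add_assoc, hφ, ih]
    | pred n ih =>
      have := hφ (k + q * (-(n : ℤ) - 1))
      rw [show k + (q : ℤ) * (-(n : ℤ) - 1) + q = k + q * (-n) by ring, ih] at this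
      exact this.symm
  have hmod : ∀ k : ℤ, φ (k % q) = φ k := fun k => by
    conv_rhs => rw [← Int.emod_add_mul_ediv k q]
    rw [hper]
  have hq' : (0 : ℤ) < q := by exact_mod_cast hq
  set σ : ℕ → ℕ := fun i => ((k + i * p) % q).toNat with hσ
  have hσ1 : ∀ i, (σ i : ℤ) = (k + i * p) % q := fun i =>
    Int.toNat_of_nonneg (Int.emod_nonneg _ hq'.ne')
  have hmaps : ∀ i ∈ Finset.range q, σ i ∈ Finset.range q := fun i _ => by
    have := Int.emod_lt_of_pos (k + i * p) hq'
    rw [← hσ1] at this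
    simpa using (by exact_mod_cast this : σ i < q)
  have hinj : Set.InjOn σ (Finset.range q) := by
    intro i hi j hj hij
    have h1 : (k + i * p) % q = (k + j * p) % q := by rw [← hσ1, ← hσ1, hij]
    have h2 : (q : ℤ) ∣ (k + i * p) - (k + j * p) := 
      Int.ModEq.dvd (h1.symm : Int.ModEq q _ _)
    have h3 : (q : ℤ) ∣ ((i : ℤ) - j) * p := by
      convert h2 using 1; ring
    have h4 : (q : ℤ) ∣ (i : ℤ) - j := hc.symm.dvd_of_dvd_mul_right h3
    have hi' : i < q := by simpa using hi
    have hj' : j < q := by simpa using hj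
    have := Int.eq_zero_of_abs_lt_dvd h4 (by rw [abs_lt]; constructor <;> omega)
    omega
  have himg : (Finset.range q).image σ = Finset.range q :=
    Finset.eq_of_subset_of_card_le (Finset.image_subset_iff.2 hmaps)
      (by rw [Finset.card_image_of_injOn hinj])
  calc ∑ i ∈ Finset.range q, φ (k + i * p) = ∑ i ∈ Finset.range q, φ (σ i) :=
        Finset.sum_congr rfl fun i _ => by rw [hσ1, hmod]
    _ = ∑ j ∈ (Finset.range q).image σ, φ j := (Finset.sum_image (f := fun j : ℕ => φ j) hinj).symm
    _ = _ := by rw [himg]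

/-- Every residue is reached by the progression. -/
theorem exists_step {p : ℤ} {q : ℕ} (hq : 0 < q) (hc : IsCoprime p (q : ℤ)) (k l : ℤ) :
    ∃ i < q, ∃ m : ℤ, k + i * p = l + q * m := by
  obtain ⟨a, b, hab⟩ := hc
  have hq' : (0 : ℤ) < q := by exact_mod_cast hq
  have h1 := Int.toNat_of_nonneg (Int.emod_nonneg (a * (l - k)) hq'.ne')
  refine ⟨((a * (l - k)) % q).toNat, ?_, ?_⟩
  · have := Int.emod_lt_of_pos (a * (l - k)) hq'
    omega
  · rw [h1]
    refine ⟨-(b * (l - k)) - ((a * (l - k)) / q) * p, ?_⟩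
    have h2 := Int.emod_add_mul_ediv (a * (l - k)) q
    have h3 : (a * (l - k)) % q = a * (l - k) - q * ((a * (l - k)) / q) := by linarith
    rw [h3]
    linear_combination (l - k) * hab

/-- The logarithm of the derivative is `V`-Lipschitz. -/
def LogLip (V : ℝ) (g : ℝ → ℝ) : Prop :=
  ∀ u v, |Real.log (deriv g u) - Real.log (deriv g v)| ≤ V * |u - v|

theorem deriv_iter_succ {g : ℝ → ℝ} (hg : IsCircleDiffeoLift g) (n : ℕ) :
    deriv (g^[n + 1]) = fun x => deriv g (g^[n] x) * deriv (g^[n]) x := by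
  rw [Function.iterate_succ']
  exact deriv_comp_sm hg.sm (hg.iter n).sm

theorem log_deriv_iter {g : ℝ → ℝ} (hg : IsCircleDiffeoLift g) (n : ℕ) (x : ℝ) :
    Real.log (deriv (g^[n]) x) = ∑ i ∈ Finset.range n, Real.log (deriv g (g^[i] x)) := by
  induction n with
  | zero => simp
  | succ n ih =>
    rw [deriv_iter_succ hg, Finset.sum_range_succ, ← ih,
      Real.log_mul (hg.pos _).ne' ((hg.iter n).pos _).ne', add_comm]

theorem log_deriv_iter_sub {g : ℝ → ℝ} (hg : IsCircleDiffeoLift g) {V : ℝ} (hV : LogLip V g) (n : ℕ)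
    (u v : ℝ) : |Real.log (deriv (g^[n]) u) - Real.log (deriv (g^[n]) v)| ≤
      V * ∑ i ∈ Finset.range n, |g^[i] u - g^[i] v| := by
  rw [log_deriv_iter hg, log_deriv_iter hg, ← Finset.sum_sub_distrib, Finset.mul_sum]
  exact (Finset.abs_sum_le_sum_abs _ _).trans (Finset.sum_le_sum fun i _ => hV _ _)

theorem le_exp_mul {a b c : ℝ} (ha : 0 < a) (hb : 0 < b) (h : |Real.log a - Real.log b| ≤ c) :
    a ≤ Real.exp c * b := by
  rw [← Real.log_le_log_iff ha (by positivity), Real.log_mul (Real.exp_pos _).ne' hb.ne',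
    Real.log_exp]
  linarith [(abs_le.1 h).2]

/-- The length of the `k`-th gap. -/
def gap (y : ℤ → ℝ) (k : ℤ) : ℝ := y (k + 1) - y k

namespace Orb
variable {g : ℝ → ℝ} {p : ℤ} {q : ℕ} {y : ℤ → ℝ}

theorem gap_pos (h : Orb g p q y) (k : ℤ) : 0 < gap y k := sub_pos.2 (h.mono (lt_add_one k))

theorem gap_per (h : Orb g p q y) (k : ℤ) : gap y (k + q) = gap y k := by
  unfold gap
  rw [h.per, show k + (q : ℤ) + 1 = k + 1 + q by ring, h.per]; ring

theorem gap_per_int (h : Orb g p q y) (k m : ℤ) : gap y (k + q * m) = gap y k := by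
  unfold gap
  rw [h.per_int, show k + (q : ℤ) * m + 1 = k + 1 + q * m by ring, h.per_int]; ring

theorem sum_shift (h : Orb g p q y) (a : ℤ) (n : ℕ) :
    ∑ j ∈ Finset.range q, (y (a + n + j) - y (a + j)) = n := by
  induction n with
  | zero => simp
  | succ n ih =>
    have h1 : ∑ j ∈ Finset.range q, (y (a + n + 1 + j) - y (a + n + j)) = 1 := by
      have := Finset.sum_range_sub (fun j : ℕ => y (a + n + j)) q
      rw [h.per] at this
      simp only [Nat.cast_zero, add_zero, Nat.cast_add, Nat.cast_one] at this
      rw [add_sub_cancel_left] at this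
      rw [← this]
      refine Finset.sum_congr rfl fun j _ => ?_
      congr 2; ring
    have h2 : ∑ j ∈ Finset.range q, (y (a + ((n + 1 : ℕ) : ℤ) + j) - y (a + j)) =
        ∑ j ∈ Finset.range q, (y (a + n + 1 + j) - y (a + n + j)) +
          ∑ j ∈ Finset.range q, (y (a + n + j) - y (a + j)) := by
      rw [← Finset.sum_add_distrib]
      refine Finset.sum_congr rfl fun j _ => ?_
      push_cast
      rw [← add_assoc a]; ring
    rw [h2, h1, ih]; push_cast; ring

theorem sum_hull (h : Orb g p q y) (a : ℤ) (n N : ℕ) (hN : N ≤ 2 * q) :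
    ∑ i ∈ Finset.range N, (y (a + n + i * p) - y (a + i * p)) ≤ 2 * n := by
  set φ : ℤ → ℝ := fun k => y (k + n) - y k with hφ
  have hper : ∀ k, φ (k + q) = φ k := fun k => by
    simp only [hφ]
    rw [h.per, show k + (q : ℤ) + n = k + n + q by ring, h.per]; ring
  have h0 : ∀ k, 0 ≤ φ k := fun k => sub_nonneg.2 (h.mono.monotone (by omega))
  have e : ∀ i : ℕ, y (a + n + i * p) - y (a + i * p) = φ (a + i * p) := fun i => by
    simp only [hφ]; congr 2; ring
  have hs : ∑ j ∈ Finset.range q, φ j = n := by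
    rw [← h.sum_shift 0 n]
    refine Finset.sum_congr rfl fun j _ => ?_
    simp only [hφ]; congr 2 <;> ring
  calc ∑ i ∈ Finset.range N, (y (a + n + i * p) - y (a + i * p))
      = ∑ i ∈ Finset.range N, φ (a + i * p) := Finset.sum_congr rfl fun i _ => e i
    _ ≤ ∑ i ∈ Finset.range (q + q), φ (a + i * p) :=
        Finset.sum_le_sum_of_subset_of_nonneg (Finset.range_mono (by omega)) fun i _ _ => h0 _
    _ = ∑ j ∈ Finset.range q, φ j + ∑ j ∈ Finset.range q, φ j := by
        rw [Finset.sum_range_add, sum_period h.hq h.cop hper]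
        congr 1
        rw [← sum_period h.hq h.cop hper (a + q * p)]
        refine Finset.sum_congr rfl fun i _ => ?_
        congr 1; push_cast; ring
    _ = 2 * n := by rw [hs]; ring

theorem mem_iter (h : Orb g p q y) {a b : ℤ} {x : ℝ} (hx : x ∈ Set.Icc (y a) (y b)) (i : ℕ) :
    g^[i] x ∈ Set.Icc (y (a + i * p)) (y (b + i * p)) := by
  rw [← h.iter, ← h.iter]
  exact ⟨(h.lift.iter i).strictMono.monotone hx.1, (h.lift.iter i).strictMono.monotone hx.2⟩

/-- Bounded distortion on unions of `n` consecutive gaps. -/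
theorem distortion (h : Orb g p q y) {V : ℝ} (hV0 : 0 ≤ V) (hV : LogLip V g) {N : ℕ}
    (hN : N ≤ 2 * q) {a : ℤ} {n : ℕ} {u v : ℝ} (hu : u ∈ Set.Icc (y a) (y (a + n)))
    (hv : v ∈ Set.Icc (y a) (y (a + n))) :
    deriv (g^[N]) u ≤ Real.exp (2 * V) ^ n * deriv (g^[N]) v := by
  rw [← Real.exp_nat_mul]
  refine le_exp_mul ((h.lift.iter N).pos _) ((h.lift.iter N).pos _) ?_
  refine (log_deriv_iter_sub h.lift hV N u v).trans ?_
  have : ∑ i ∈ Finset.range N, |g^[i] u - g^[i] v| ≤ 2 * n := by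
    refine le_trans (Finset.sum_le_sum fun i _ => ?_) (h.sum_hull a n N hN)
    have h1 := h.mem_iter hu i
    have h2 := h.mem_iter hv i
    rw [abs_le]; constructor <;> linarith [h1.1, h1.2, h2.1, h2.2]
  calc _ ≤ V * (2 * n) := mul_le_mul_of_nonneg_left this hV0
    _ = _ := by ring

theorem exists_deriv_eq (h : Orb g p q y) (N : ℕ) {a b : ℤ} (hab : a < b) :
    ∃ u ∈ Set.Icc (y a) (y b), deriv (g^[N]) u * (y b - y a) = y (b + N * p) - y (a + N * p) := by
  obtain ⟨u, hu, he⟩ := exists_deriv_eq_slope (g^[N]) (h.mono hab)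
    (h.lift.iter N).cont.continuousOn (Sm.diff (h.lift.iter N).sm).differentiableOn
  refine ⟨u, Set.Ioo_subset_Icc_self hu, ?_⟩
  have : y b - y a ≠ 0 := (sub_pos.2 (h.mono hab)).ne'
  rw [he, h.iter, h.iter]; field_simp

theorem deriv_iter_le (h : Orb g p q y) {V : ℝ} (hV0 : 0 ≤ V) (hV : LogLip V g) {N : ℕ}
    (hN : N ≤ 2 * q) {k : ℤ} {x : ℝ} (hx : x ∈ Set.Icc (y k) (y (k + 1))) :
    deriv (g^[N]) x * gap y k ≤ Real.exp (2 * V) * gap y (k + N * p) := by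
  obtain ⟨u, hu, he⟩ := h.exists_deriv_eq N (lt_add_one k)
  have := h.distortion hV0 hV hN (a := k) (n := 1) (by simpa using hx) (by simpa using hu)
  have e : y (k + 1 + N * p) - y (k + N * p) = gap y (k + N * p) := by
    unfold gap; congr 2; ring
  rw [e] at he
  rw [← he]
  calc _ ≤ (Real.exp (2 * V) ^ 1 * deriv (g^[N]) u) * gap y k :=
        mul_le_mul_of_nonneg_right this (h.gap_pos k).le
    _ = _ := by unfold gap; ring

theorem le_deriv_iter (h : Orb g p q y) {V : ℝ} (hV0 : 0 ≤ V) (hV : LogLip V g) {N : ℕ}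
    (hN : N ≤ 2 * q) {k : ℤ} {x : ℝ} (hx : x ∈ Set.Icc (y k) (y (k + 1))) :
    gap y (k + N * p) ≤ Real.exp (2 * V) * (deriv (g^[N]) x * gap y k) := by
  obtain ⟨u, hu, he⟩ := h.exists_deriv_eq N (lt_add_one k)
  have := h.distortion hV0 hV hN (a := k) (n := 1) (by simpa using hu) (by simpa using hx)
  have e : y (k + 1 + N * p) - y (k + N * p) = gap y (k + N * p) := by
    unfold gap; congr 2; ring
  rw [e] at he
  rw [← he]
  calc _ ≤ (Real.exp (2 * V) ^ 1 * deriv (g^[N]) x) * gap y k :=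
        mul_le_mul_of_nonneg_right this (h.gap_pos k).le
    _ = _ := by ring

/-- The residue class at which a `q`-periodic function is extremal. -/
theorem exists_max_gap (h : Orb g p q y) : ∃ k, ∀ j, gap y j ≤ gap y k := by
  obtain ⟨k, -, hk⟩ := Finset.exists_max_image (Finset.range q) (fun j : ℕ => gap y j)
    ⟨0, Finset.mem_range.2 h.hq⟩
  refine ⟨k, fun j => ?_⟩
  have hq' : (0 : ℤ) < q := by exact_mod_cast h.hq
  have h1 := Int.toNat_of_nonneg (Int.emod_nonneg j hq'.ne')
  have h2 := Int.emod_lt_of_pos j hq'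
  have h3 := hk (j % q).toNat (Finset.mem_range.2 (by omega))
  rw [h1] at h3
  rw [← Int.emod_add_mul_ediv j q, h.gap_per_int]
  exact h3

theorem exists_min_gap (h : Orb g p q y) : ∃ k, ∀ j, gap y k ≤ gap y j := by
  obtain ⟨k, -, hk⟩ := Finset.exists_min_image (Finset.range q) (fun j : ℕ => gap y j)
    ⟨0, Finset.mem_range.2 h.hq⟩
  refine ⟨k, fun j => ?_⟩
  have hq' : (0 : ℤ) < q := by exact_mod_cast h.hq
  have h1 := Int.toNat_of_nonneg (Int.emod_nonneg j hq'.ne')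
  have h2 := Int.emod_lt_of_pos j hq'
  have h3 := hk (j % q).toNat (Finset.mem_range.2 (by omega))
  rw [h1] at h3
  rw [← Int.emod_add_mul_ediv j q, h.gap_per_int]
  exact h3

theorem sum_gap (h : Orb g p q y) : ∑ j ∈ Finset.range q, gap y j = 1 := by
  have := h.sum_shift 0 1
  simp only [Nat.cast_one, zero_add] at this
  rw [← this]
  refine Finset.sum_congr rfl fun j _ => ?_
  unfold gap; rw [add_comm]

theorem sum_gap_le (h : Orb g p q y) (k : ℤ) {N : ℕ} (hN : N ≤ 2 * q) :
    ∑ i ∈ Finset.range N, gap y (k + i * p) ≤ 2 := by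
  have := h.sum_hull k 1 N hN
  simp only [Nat.cast_one, mul_one] at this
  refine le_trans (le_of_eq (Finset.sum_congr rfl fun i _ => ?_)) this
  unfold gap; congr 2; ring

/-- Adjacent gaps are comparable. -/
theorem gap_adj (h : Orb g p q y) {V : ℝ} (hV0 : 0 ≤ V) (hV : LogLip V g) (k : ℤ) :
    gap y k ≤ Real.exp (2 * V) ^ 2 * gap y (k + 1) ∧
      gap y (k + 1) ≤ Real.exp (2 * V) ^ 2 * gap y k := by
  obtain ⟨k0, hk0⟩ := h.exists_min_gap
  have key : ∀ a b k : ℤ, (a = k ∨ a = k + 1) → (b = k ∨ b = k + 1) →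
      gap y a ≤ Real.exp (2 * V) ^ 2 * gap y b := by
    intro a b k ha hb
    obtain ⟨i, hi, m, hm⟩ := exists_step h.hq h.cop a k0
    obtain ⟨u, hu, hue⟩ := h.exists_deriv_eq i (lt_add_one a)
    obtain ⟨v, hv, hve⟩ := h.exists_deriv_eq i (lt_add_one b)
    have e : ∀ c : ℤ, y (c + 1 + i * p) - y (c + i * p) = gap y (c + i * p) := fun c => by
      unfold gap; congr 2; ring
    rw [e] at hue hve
    have hmem : ∀ c w, (c = k ∨ c = k + 1) → w ∈ Set.Icc (y c) (y (c + 1)) →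
        w ∈ Set.Icc (y k) (y (k + (2 : ℕ))) := by
      intro c w hc hw
      refine ⟨(h.mono.monotone ?_).trans hw.1, hw.2.trans (h.mono.monotone ?_)⟩ <;>
        rcases hc with rfl | rfl <;> push_cast <;> linarith
    have hd := h.distortion hV0 hV (N := i) (by omega) (hmem b v hb hv) (hmem a u ha hu)
    have h1 : gap y (a + i * p) ≤ gap y (b + i * p) := by
      rw [hm, h.gap_per_int]; exact hk0 _
    have hDu := (h.lift.iter i).pos u
    have h2 : deriv g^[i] u * gap y a ≤ deriv g^[i] u * (Real.exp (2 * V) ^ 2 * gap y b) := by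
      calc _ = gap y (a + i * p) := hue
        _ ≤ gap y (b + i * p) := h1
        _ = deriv g^[i] v * gap y b := hve.symm
        _ ≤ (Real.exp (2 * V) ^ 2 * deriv g^[i] u) * gap y b :=
            mul_le_mul_of_nonneg_right hd (h.gap_pos b).le
        _ = _ := by ring
    exact le_of_mul_le_mul_left h2 hDu
  exact ⟨key k (k + 1) k (Or.inl rfl) (Or.inr rfl), key (k + 1) k k (Or.inr rfl) (Or.inl rfl)⟩

theorem gap_near (h : Orb g p q y) {V : ℝ} (hV0 : 0 ≤ V) (hV : LogLip V g) (k : ℤ) (n : ℕ) :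
    ∀ j : ℤ, |j| ≤ n → gap y k ≤ Real.exp (2 * V) ^ (2 * n) * gap y (k + j) := by
  have hE : 1 ≤ Real.exp (2 * V) := Real.one_le_exp (by linarith)
  induction n with
  | zero =>
    intro j hj
    have : j = 0 := abs_eq_zero.1 (le_antisymm (by exact_mod_cast hj) (abs_nonneg _))
    simp [this]
  | succ n ih =>
    intro j hj
    rcases le_or_gt |j| n with hj' | hj'
    · refine (ih j hj').trans (mul_le_mul_of_nonneg_right (pow_le_pow_right₀ hE (by omega))
        (h.gap_pos _).le)
    · rcases le_or_gt 0 j with h0 | h0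
      · rw [abs_of_nonneg h0] at hj hj'
        have h1 := ih (j - 1) (by rw [abs_of_nonneg (by omega)]; push_cast at hj; omega)
        have h2 := (h.gap_adj hV0 hV (k + (j - 1))).1
        rw [show k + (j - 1) + 1 = k + j by ring] at h2
        calc _ ≤ _ := h1
          _ ≤ Real.exp (2 * V) ^ (2 * n) * (Real.exp (2 * V) ^ 2 * gap y (k + j)) := by gcongr
          _ = _ := by ring
      · rw [abs_of_neg h0] at hj hj'
        have h1 := ih (j + 1) (by rw [abs_of_nonpos (by omega)]; push_cast at hj; omega)
        have h2 := (h.gap_adj hV0 hV (k + j)).2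
        rw [show k + j + 1 = k + (j + 1) by ring] at h2
        calc _ ≤ _ := h1
          _ ≤ Real.exp (2 * V) ^ (2 * n) * (Real.exp (2 * V) ^ 2 * gap y (k + j)) := by gcongr
          _ = _ := by ring

end Orb

/-- The nonlinearity `f'' / f'`. -/
def nonlin (f : ℝ → ℝ) : ℝ → ℝ := fun x => deriv (deriv f) x * (deriv f x)⁻¹

/-- The Schwarzian derivative. -/
def schw (f : ℝ → ℝ) : ℝ → ℝ := fun x => deriv (nonlin f) x - nonlin f x * nonlin f x / 2

theorem nonlin_sm {f : ℝ → ℝ} (hf : IsCircleDiffeoLift f) : Sm (nonlin f) :=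
  (Sm.deriv (Sm.deriv hf.sm)).mul (inv_sm (Sm.deriv hf.sm) hf.pos)

theorem schw_sm {f : ℝ → ℝ} (hf : IsCircleDiffeoLift f) : Sm (schw f) :=
  (Sm.deriv (nonlin_sm hf)).sub (((nonlin_sm hf).mul (nonlin_sm hf)).div_const 2)

theorem nonlin_comp {f h : ℝ → ℝ} (hf : IsCircleDiffeoLift f) (hh : IsCircleDiffeoLift h) :
    nonlin (fun x => f (h x)) = fun x => nonlin f (h x) * deriv h x + nonlin h x := by
  ext x
  have h1 := (hf.pos (h x)).ne'
  have h2 := (hh.pos x).ne'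
  have e : deriv (deriv (fun x => f (h x))) x =
      deriv (deriv f) (h x) * deriv h x * deriv h x + deriv f (h x) * deriv (deriv h) x := by
    rw [deriv_comp_sm hf.sm hh.sm]
    have := ((Sm.diff (comp_sm (Sm.deriv hf.sm) hh.sm) x).hasDerivAt.mul
      (Sm.diff (Sm.deriv hh.sm) x).hasDerivAt).deriv
    rw [deriv_comp_sm (Sm.deriv hf.sm) hh.sm] at this
    exact this
  have e1 : deriv (fun x => f (h x)) x = deriv f (h x) * deriv h x := by
    rw [deriv_comp_sm hf.sm hh.sm]
  unfold nonlin
  rw [e, e1]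
  field_simp

theorem schw_comp {f h : ℝ → ℝ} (hf : IsCircleDiffeoLift f) (hh : IsCircleDiffeoLift h) :
    schw (fun x => f (h x)) = fun x => schw f (h x) * (deriv h x * deriv h x) + schw h x := by
  ext x
  have h2 := (hh.pos x).ne'
  have e : deriv (fun x => nonlin f (h x) * deriv h x + nonlin h x) x =
      (deriv (nonlin f) (h x) * deriv h x * deriv h x + nonlin f (h x) * deriv (deriv h) x) +
        deriv (nonlin h) x := by
    have := (((Sm.diff (comp_sm (nonlin_sm hf) hh.sm) x).hasDerivAt.mul
      (Sm.diff (Sm.deriv hh.sm) x).hasDerivAt).add (Sm.diff (nonlin_sm hh) x).hasDerivAt).deriv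
    rw [deriv_comp_sm (nonlin_sm hf) hh.sm] at this
    exact this
  have e2 : deriv (deriv h) x = nonlin h x * deriv h x := by
    unfold nonlin; field_simp
  have e3 : ∀ φ, schw φ x = deriv (nonlin φ) x - nonlin φ x * nonlin φ x / 2 := fun _ => rfl
  rw [e3 (fun x => f (h x)), e3 h, nonlin_comp hf hh, e, e2]
  unfold schw
  ring

theorem nonlin_periodic {f : ℝ → ℝ} (hf : IsCircleDiffeoLift f) (x : ℝ) :
    nonlin f (x + 1) = nonlin f x := by
  have h1 := lift_deriv_periodic hf.2.1
  have h2 : deriv (deriv f) (x + 1) = deriv (deriv f) x := by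
    have := iteratedDeriv_periodic h1 1 x
    simpa using this
  unfold nonlin; rw [h1, h2]

theorem schw_iter {g : ℝ → ℝ} (hg : IsCircleDiffeoLift g) (n : ℕ) :
    schw (g^[n]) = fun x => ∑ i ∈ Finset.range n,
      schw g (g^[i] x) * (deriv (g^[i]) x * deriv (g^[i]) x) := by
  induction n with
  | zero =>
    ext x
    have : nonlin (g^[0]) = fun _ => 0 := by
      ext x
      have : deriv (g^[0]) = fun _ => 1 := by ext x; simp
      unfold nonlin; rw [this]; simp
    unfold schw
    rw [this]
    simp
  | succ n ih =>
    rw [Function.iterate_succ']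
    have := schw_comp hg (hg.iter n)
    change schw (fun x => g (g^[n] x)) = _
    rw [this, ih]
    ext x
    rw [Finset.sum_range_succ, add_comm]

/-- Uniform bounds on the derivatives of the Schwarzian. -/
def SchwBd (σ : ℕ → ℝ) (g : ℝ → ℝ) : Prop := ∀ j x, |iteratedDeriv j (schw g) x| ≤ σ j

namespace Orb
variable {g : ℝ → ℝ} {p : ℤ} {q : ℕ} {y : ℤ → ℝ}

theorem exists_gap (h : Orb g p q y) (x : ℝ) : ∃ k, x ∈ Set.Icc (y k) (y (k + 1)) := by
  have hb : ∃ b : ℤ, ∀ z : ℤ, y z ≤ x → z ≤ b := by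
    obtain ⟨n, hn⟩ := exists_int_gt (x - y 0)
    refine ⟨q * n, fun z hz => ?_⟩
    by_contra hc
    push Not at hc
    have h1 := h.mono hc
    have h2 := h.per_int 0 n
    rw [zero_add] at h2
    linarith
  have hi : ∃ z : ℤ, y z ≤ x := by
    obtain ⟨n, hn⟩ := exists_int_lt (x - y 0)
    refine ⟨q * n, ?_⟩
    have h2 := h.per_int 0 n
    rw [zero_add] at h2
    linarith
  obtain ⟨k, hk, hk'⟩ := Int.exists_greatest_of_bdd hb hi
  refine ⟨k, hk, ?_⟩
  by_contra hc
  push Not at hc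
  have := hk' _ hc.le
  omega

theorem sum_sq_le (h : Orb g p q y) {V : ℝ} (hV0 : 0 ≤ V) (hV : LogLip V g) {N : ℕ}
    (hN : N ≤ 2 * q) {μ : ℝ} (hμ : ∀ j, gap y j ≤ μ ^ 2)
    {k : ℤ} {x : ℝ} (hx : x ∈ Set.Icc (y k) (y (k + 1))) :
    ∑ i ∈ Finset.range N, deriv (g^[i]) x * deriv (g^[i]) x ≤
      2 * Real.exp (2 * V) ^ 2 * μ ^ 2 / gap y k ^ 2 := by
  have hk := h.gap_pos k
  rw [le_div_iff₀ (by positivity), Finset.sum_mul]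
  calc _ ≤ ∑ i ∈ Finset.range N, Real.exp (2 * V) ^ 2 * μ ^ 2 * gap y (k + i * p) := by
        refine Finset.sum_le_sum fun i hi => ?_
        have hi' : i < N := by simpa using hi
        have h1 := h.deriv_iter_le hV0 hV (N := i) (by omega) hx
        have h2 := (h.lift.iter i).pos x
        have h3 := h.gap_pos (k + i * p)
        calc _ = (deriv (g^[i]) x * gap y k) * (deriv (g^[i]) x * gap y k) := by ring
          _ ≤ (Real.exp (2 * V) * gap y (k + i * p)) * (Real.exp (2 * V) * gap y (k + i * p)) := by
            gcongr
          _ = Real.exp (2 * V) ^ 2 * gap y (k + i * p) * gap y (k + i * p) := by ring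
          _ ≤ Real.exp (2 * V) ^ 2 * μ ^ 2 * gap y (k + i * p) := by
            gcongr; exact hμ _
    _ = Real.exp (2 * V) ^ 2 * μ ^ 2 * ∑ i ∈ Finset.range N, gap y (k + i * p) := by
        rw [Finset.mul_sum]
    _ ≤ Real.exp (2 * V) ^ 2 * μ ^ 2 * 2 := by
        gcongr; exact h.sum_gap_le k hN
    _ = _ := by ring

theorem nonlin_max (h : Orb g p q y) {V : ℝ} (hV0 : 0 ≤ V) (hV : LogLip V g) {σ : ℕ → ℝ}
    (hσ : SchwBd σ g) {N : ℕ} (hN : N ≤ 2 * q) {μ m : ℝ} (hμ0 : 0 < μ) (hm : 0 < m)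
    (hμ : ∀ j, gap y j ≤ μ ^ 2) (hmin : ∀ j, m ≤ gap y j) (x : ℝ) :
    |nonlin (g^[N]) x| ≤ 2 * Real.exp (2 * V) * (1 + σ 0) * μ / m := by
  set w := nonlin (g^[N]) with hw
  have hws : Sm w := nonlin_sm (h.lift.iter N)
  have hσ0 : 0 ≤ σ 0 := (abs_nonneg _).trans (hσ 0 0)
  -- the maximum of `w ^ 2`
  obtain ⟨x0, -, hx0⟩ := isCompact_Icc.exists_isMaxOn (s := Set.Icc (0 : ℝ) 1)
    ⟨0, by simp⟩ (hws.continuous.pow 2).continuousOn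
  have hper : Function.Periodic w 1 := nonlin_periodic (h.lift.iter N)
  have hmax : ∀ z, w z ^ 2 ≤ w x0 ^ 2 := fun z => by
    obtain ⟨z', hz', e⟩ := hper.exists_mem_Ico₀ one_pos z
    rw [e]; exact hx0 ⟨hz'.1, hz'.2.le⟩
  have hd : deriv (fun z => w z ^ 2) x0 = 0 :=
    IsLocalMax.deriv_eq_zero (Filter.Eventually.of_forall hmax)
  have hd2 : 2 * w x0 * deriv w x0 = 0 := by
    have := ((Sm.diff hws x0).hasDerivAt.fun_pow 2).deriv
    rw [this] at hd
    simpa using hd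
  have h1 : w x0 ^ 2 ≤ 2 * |schw (g^[N]) x0| := by
    have e : schw (g^[N]) x0 = deriv w x0 - w x0 * w x0 / 2 := rfl
    rcases mul_eq_zero.1 hd2 with h0 | h0
    · have : w x0 = 0 := by linarith
      rw [this]; simp
    · rw [e, h0, zero_sub, abs_neg, abs_of_nonneg (by nlinarith [sq_nonneg (w x0)])]
      linarith [sq (w x0)]
  obtain ⟨k, hk⟩ := h.exists_gap x0
  have h2 : |schw (g^[N]) x0| ≤ σ 0 * (2 * Real.exp (2 * V) ^ 2 * μ ^ 2 / gap y k ^ 2) := by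
    rw [schw_iter h.lift]
    refine (Finset.abs_sum_le_sum_abs _ _).trans ?_
    calc _ ≤ ∑ i ∈ Finset.range N, σ 0 * (deriv (g^[i]) x0 * deriv (g^[i]) x0) := by
          refine Finset.sum_le_sum fun i _ => ?_
          rw [abs_mul, abs_mul_self]
          have := hσ 0 (g^[i] x0)
          rw [iteratedDeriv_zero] at this
          exact mul_le_mul_of_nonneg_right this (mul_self_nonneg _)
      _ ≤ _ := by
          rw [← Finset.mul_sum]
          exact mul_le_mul_of_nonneg_left (h.sum_sq_le hV0 hV hN hμ hk) hσ0
  have h3 : w x ^ 2 ≤ (2 * Real.exp (2 * V) * (1 + σ 0) * μ / m) ^ 2 := by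
    calc w x ^ 2 ≤ w x0 ^ 2 := hmax x
      _ ≤ 2 * (σ 0 * (2 * Real.exp (2 * V) ^ 2 * μ ^ 2 / gap y k ^ 2)) := by linarith
      _ ≤ 2 * (σ 0 * (2 * Real.exp (2 * V) ^ 2 * μ ^ 2 / m ^ 2)) := by
          have := hmin k
          gcongr
      _ = σ 0 * (4 * Real.exp (2 * V) ^ 2 * μ ^ 2 / m ^ 2) := by ring
      _ ≤ (1 + σ 0) ^ 2 * (4 * Real.exp (2 * V) ^ 2 * μ ^ 2 / m ^ 2) := by
          gcongr; nlinarith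
      _ = _ := by ring
  exact abs_le_of_sq_le_sq h3 (by positivity)

theorem nonlin_le (h : Orb g p q y) {V : ℝ} (hV0 : 0 ≤ V) (hV : LogLip V g) {σ : ℕ → ℝ}
    (hσ : SchwBd σ g) {N : ℕ} (hN : N ≤ q) {μ : ℝ} (hμ0 : 0 < μ)
    (hμ : ∀ j, gap y j ≤ μ ^ 2) {k : ℤ} {x : ℝ} (hx : x ∈ Set.Icc (y k) (y (k + 1))) :
    |nonlin (g^[N]) x| ≤ 4 * Real.exp (2 * V) ^ 2 * (1 + σ 0) * μ / gap y k := by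
  obtain ⟨k0, hk0⟩ := h.exists_min_gap
  have hm := h.gap_pos k0
  have hk := h.gap_pos k
  obtain ⟨j, hj, t, ht⟩ := exists_step h.hq h.cop k0 k
  obtain ⟨z, hz⟩ := (h.lift.iter j).surj (x + t)
  have hzm : z ∈ Set.Icc (y k0) (y (k0 + 1)) := by
    constructor
    · rw [← (h.lift.iter j).strictMono.le_iff_le, h.iter, hz, ht, h.per_int]
      linarith [hx.1]
    · rw [← (h.lift.iter j).strictMono.le_iff_le, h.iter, hz,
        show k0 + 1 + (j : ℤ) * p = (k0 + j * p) + 1 by ring, ht,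
        show k + (q : ℤ) * t + 1 = k + 1 + q * t by ring, h.per_int]
      linarith [hx.2]
  have hxt : nonlin (g^[N]) (x + t) = nonlin (g^[N]) x := by
    have hper : Function.Periodic (nonlin (g^[N])) 1 := nonlin_periodic (h.lift.iter N)
    have := hper.int_mul t x
    simpa using this
  have hchain : nonlin (g^[N + j]) z = nonlin (g^[N]) x * deriv (g^[j]) z + nonlin (g^[j]) z := by
    rw [Function.iterate_add]
    have := congrFun (nonlin_comp (h.lift.iter N) (h.lift.iter j)) z
    rw [hz, hxt] at this
    exact this
  have a1 := h.nonlin_max hV0 hV hσ (N := N + j) (by omega) hμ0 hm hμ hk0 z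
  have a2 := h.nonlin_max hV0 hV hσ (N := j) (by omega) hμ0 hm hμ hk0 z
  have a3 := h.le_deriv_iter hV0 hV (N := j) (by omega) hzm
  rw [ht, h.gap_per_int] at a3
  set K := 2 * Real.exp (2 * V) * (1 + σ 0) * μ with hK
  have hD := (h.lift.iter j).pos z
  set E := Real.exp (2 * V) with hE
  have hE0 : 0 < E := Real.exp_pos _
  have a4 : |nonlin (g^[N]) x| * deriv (g^[j]) z ≤ 2 * (K / gap y k0) := by
    have : nonlin (g^[N]) x * deriv (g^[j]) z = nonlin (g^[N + j]) z - nonlin (g^[j]) z := by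
      rw [hchain]; ring
    rw [← abs_of_pos hD, ← abs_mul, this]
    refine (abs_sub _ _).trans ?_
    linarith
  rw [le_div_iff₀ hk]
  calc |nonlin (g^[N]) x| * gap y k ≤ |nonlin (g^[N]) x| * (E * (deriv (g^[j]) z * gap y k0)) := by
        gcongr
    _ = E * (|nonlin (g^[N]) x| * deriv (g^[j]) z) * gap y k0 := by ring
    _ ≤ E * (2 * (K / gap y k0)) * gap y k0 := by gcongr
    _ = 4 * E ^ 2 * (1 + σ 0) * μ := by rw [hK]; field_simp; ring

theorem deriv_le_of_big (h : Orb g p q y) {V : ℝ} (hV0 : 0 ≤ V) (hV : LogLip V g) {N : ℕ}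
    (hN : N ≤ 2 * q) {μ κ : ℝ} (hμ0 : 0 < μ) (hκ : 0 < κ) (hμ : ∀ j, gap y j ≤ μ ^ 2) {k : ℤ}
    (hk : κ * μ ^ 2 ≤ gap y k) {x : ℝ} (hx : x ∈ Set.Icc (y k) (y (k + 1))) :
    deriv (g^[N]) x ≤ Real.exp (2 * V) / κ := by
  have h1 := h.deriv_iter_le hV0 hV hN hx
  have h2 := hμ (k + N * p)
  have hD := (h.lift.iter N).pos x
  rw [le_div_iff₀ hκ]
  have : deriv (g^[N]) x * κ * μ ^ 2 ≤ Real.exp (2 * V) * μ ^ 2 := by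
    calc _ = deriv (g^[N]) x * (κ * μ ^ 2) := by ring
      _ ≤ deriv (g^[N]) x * gap y k := by gcongr
      _ ≤ _ := h1
      _ ≤ _ := by gcongr
  exact le_of_mul_le_mul_right this (by positivity)

end Orb

/-- If `u' = w u` then scaled bounds on `w` give scaled bounds on `u`. -/
theorem Bd.of_log_deriv {s : ℕ} {l : ℝ} {u w : ℝ → ℝ} {x : ℝ} (hu : Sm u) (hw : Sm w)
    (he : ∀ z, deriv u z = w z * u z) (hu0 : 0 ≤ u x) (hl : 0 ≤ l) (h : Bd s l l w x) :
    Bd (s + 1) (u x) (2 ^ s * l) u x := by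
  have hl2 : l ≤ 2 ^ s * l := le_mul_of_one_le_left hl (one_le_pow₀ (by norm_num))
  have key : ∀ t ≤ s + 1, Bd t (u x) (2 ^ s * l) u x := by
    intro t
    induction t with
    | zero =>
      intro _ j hj
      obtain rfl : j = 0 := by omega
      simp [abs_of_nonneg hu0]
    | succ t ih =>
      intro ht j hj
      rcases Nat.lt_or_ge j (t + 1) with hj' | hj'
      · exact ih (by omega) j (by omega)
      obtain rfl : j = t + 1 := by omega
      have h1 := Bd.mul hw hu ((h.mono_order (t := t) (by omega)).mono (b := l) (m := 2 ^ s * l)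
        le_rfl hl hl hl2) (ih (by omega)) hl hu0 (by positivity) t le_rfl
      have e : deriv u = fun z => w z * u z := funext he
      rw [iteratedDeriv_succ', e]
      refine h1.trans ?_
      have h2 : (2 : ℝ) ^ t ≤ 2 ^ s := pow_le_pow_right₀ (by norm_num) (by omega)
      calc 2 ^ t * l * u x * (2 ^ s * l) ^ t ≤ 2 ^ s * l * u x * (2 ^ s * l) ^ t := by gcongr
        _ = _ := by ring
  exact key _ le_rfl

theorem deriv_deriv_eq_nonlin {f : ℝ → ℝ} (hf : IsCircleDiffeoLift f) (x : ℝ) :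
    deriv (deriv f) x = nonlin f x * deriv f x := by
  have := (hf.pos x).ne'
  unfold nonlin; field_simp

theorem Bd.iter_deriv {s : ℕ} {l : ℝ} {f : ℝ → ℝ} {x : ℝ} (hf : IsCircleDiffeoLift f) (hl : 0 ≤ l)
    (h : Bd s l l (nonlin f) x) : Bd (s + 1) (deriv f x) (2 ^ s * l) (deriv f) x :=
  Bd.of_log_deriv (Sm.deriv hf.sm) (nonlin_sm hf) (deriv_deriv_eq_nonlin hf) (hf.pos x).le hl h

/-- Positive order derivatives from bounds on the first derivative. -/
theorem iter_of_deriv_bd {s : ℕ} {D l m : ℝ} {f : ℝ → ℝ} {x : ℝ} (h : Bd s D l (deriv f) x)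
    (hl : 0 ≤ l) (hDm : D ≤ m) (hlm : l ≤ m) :
    ∀ i, 1 ≤ i → i ≤ s + 1 → |iteratedDeriv i f x| ≤ m ^ i := by
  intro i h1 h2
  obtain ⟨i, rfl⟩ : ∃ j, i = j + 1 := ⟨i - 1, by omega⟩
  rw [iteratedDeriv_succ', pow_succ']
  refine (h i (by omega)).trans ?_
  have : 0 ≤ m := hl.trans hlm
  gcongr

namespace Orb

/-- Higher derivatives of the iterates on long gaps (in the spirit of Yoccoz's estimates). -/
theorem nonlin_bd (V κ : ℝ) (σ : ℕ → ℝ) (hV0 : 0 ≤ V) (hκ : 0 < κ) (s : ℕ) :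
    ∃ Λ, 1 ≤ Λ ∧ ∀ (g : ℝ → ℝ) (p : ℤ) (q : ℕ) (y : ℤ → ℝ), Orb g p q y → LogLip V g →
      SchwBd σ g → ∀ μ : ℝ, 0 < μ → μ ≤ 1 → (∀ j, gap y j ≤ μ ^ 2) → ∀ k : ℤ, κ * μ ^ 2 ≤ gap y k →
      ∀ x ∈ Set.Icc (y k) (y (k + 1)), ∀ N ≤ q, Bd s (Λ / μ) (Λ / μ) (nonlin (g^[N])) x := by
  set E := Real.exp (2 * V) with hE
  have hE0 : 0 < E := Real.exp_pos _
  induction s with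
  | zero =>
    refine ⟨max 1 (4 * E ^ 2 * (1 + σ 0) / κ), le_max_left _ _, ?_⟩
    intro g p q y h hV hσ μ hμ0 hμ1 hμ k hk x hx N hN j hj
    obtain rfl : j = 0 := by omega
    have hσ0 : 0 ≤ σ 0 := (abs_nonneg _).trans (hσ 0 0)
    rw [iteratedDeriv_zero, pow_zero, mul_one]
    refine (h.nonlin_le hV0 hV hσ hN hμ0 hμ hx).trans ?_
    calc _ ≤ 4 * E ^ 2 * (1 + σ 0) * μ / (κ * μ ^ 2) := by gcongr
      _ = (4 * E ^ 2 * (1 + σ 0) / κ) / μ := by field_simp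
      _ ≤ _ := by gcongr; exact le_max_right _ _
  | succ s ih =>
    obtain ⟨Λ, hΛ1, hΛ⟩ := ih
    set σm := ∑ i ∈ Finset.range (s + 1), |σ i| with hσm
    have hσm0 : 0 ≤ σm := Finset.sum_nonneg fun _ _ => abs_nonneg _
    set R := max 1 (E / κ) with hR
    have hR1 : 1 ≤ R := le_max_left _ _
    -- the scale after one step
    set L := R * (2 ^ s * Λ) with hL
    have h2s : (1 : ℝ) ≤ 2 ^ s := one_le_pow₀ (by norm_num)
    have hL1 : 1 ≤ L := one_le_mul_of_one_le_of_one_le hR1 (one_le_mul_of_one_le_of_one_le h2s hΛ1)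
    have hLΛ : Λ ≤ L := by
      calc Λ = 1 * (1 * Λ) := by ring
        _ ≤ R * (2 ^ s * Λ) := by gcongr
    set C := 2 ^ s * (s.factorial * σm) * 2 ^ s * (2 * E ^ 2 / κ ^ 2) + 2 ^ s * Λ * Λ with hC
    have hC0 : 0 ≤ C := by positivity
    refine ⟨max L C, hL1.trans (le_max_left _ _), ?_⟩
    intro g p q y h hV hσ μ hμ0 hμ1 hμ k hk x hx N hN
    have hΛ' := hΛ g p q y h hV hσ μ hμ0 hμ1 hμ k hk x hx
    set l := L / μ with hl
    have hl0 : 0 ≤ l := by positivity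
    have hΛl : Λ / μ ≤ l := by rw [hl]; gcongr
    have hl2 : 2 ^ s * (Λ / μ) ≤ l := by
      rw [hl, hL]
      calc 2 ^ s * (Λ / μ) = 1 * (2 ^ s * Λ) / μ := by ring
        _ ≤ _ := by gcongr
    have hD : ∀ i < N, Bd (s + 1) (deriv (g^[i]) x) l (deriv (g^[i])) x := fun i hi =>
      (Bd.iter_deriv (h.lift.iter i) (by positivity) (hΛ' i (by omega))).mono le_rfl
        ((h.lift.iter i).pos x).le (by positivity) hl2
    have hDR : ∀ i < N, deriv (g^[i]) x ≤ R := fun i hi =>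
      (h.deriv_le_of_big hV0 hV (by omega) hμ0 hκ hμ hk hx).trans (le_max_right _ _)
    have hcomp : ∀ i < N, Bd s (s.factorial * σm) l (fun z => schw g (g^[i] z)) x := by
      intro i hi
      refine Bd.comp (schw_sm h.lift) (h.lift.iter i).sm hl0 (fun j hj => ?_) (fun j h1 h2 => ?_)
      · refine (hσ j _).trans ((le_abs_self _).trans ?_)
        exact Finset.single_le_sum (f := fun i => |σ i|) (fun _ _ => abs_nonneg _)
          (Finset.mem_range.2 (by omega))
      · refine iter_of_deriv_bd (l := 2 ^ s * (Λ / μ)) (Bd.iter_deriv (h.lift.iter i)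
          (by positivity) (hΛ' i (by omega))) (by positivity) ?_ hl2 j h1 (by omega)
        refine (hDR i hi).trans ?_
        rw [hl, le_div_iff₀ hμ0, hL]
        have : 1 ≤ 2 ^ s * Λ := one_le_mul_of_one_le_of_one_le h2s hΛ1
        calc R * μ ≤ R * 1 := by gcongr
          _ ≤ _ := by gcongr
    have hterm : ∀ i ∈ Finset.range N, Bd s (2 ^ s * (s.factorial * σm) *
        (2 ^ s * deriv (g^[i]) x * deriv (g^[i]) x)) l
        (fun z => schw g (g^[i] z) * (deriv (g^[i]) z * deriv (g^[i]) z)) x := by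
      intro i hi
      have hi' : i < N := by simpa using hi
      have hpos := ((h.lift.iter i).pos x).le
      have hs := Sm.deriv (h.lift.iter i).sm
      have hd := (hD i hi').mono_order (t := s) (by omega)
      exact Bd.mul (comp_sm (schw_sm h.lift) (h.lift.iter i).sm) (hs.mul hs) (hcomp i hi')
        (Bd.mul hs hs hd hd hpos hpos hl0) (by positivity) (by positivity) hl0
    have hsum := Bd.sum (fun i _ => by
      have hs := Sm.deriv (h.lift.iter i).sm
      exact (comp_sm (schw_sm h.lift) (h.lift.iter i).sm).mul (hs.mul hs)) hterm
    rw [← schw_iter h.lift] at hsum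
    have hw2 := Bd.const_mul (1 / 2) (Bd.mul (nonlin_sm (h.lift.iter N))
      (nonlin_sm (h.lift.iter N)) ((hΛ' N hN).mono le_rfl (by positivity) (by positivity) hΛl)
      ((hΛ' N hN).mono le_rfl (by positivity) (by positivity) hΛl)
      (by positivity) (by positivity) hl0)
    have hws := nonlin_sm (h.lift.iter N)
    have hadd := Bd.add (schw_sm (h.lift.iter N)) (contDiff_const.mul (hws.mul hws)) hsum hw2
    have e : (fun z => schw (g^[N]) z + 1 / 2 * (nonlin (g^[N]) z * nonlin (g^[N]) z)) =
        deriv (nonlin (g^[N])) := by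
      ext z; unfold schw; ring
    rw [e] at hadd
    have hsq := h.sum_sq_le hV0 hV (N := N) (by omega) hμ hx
    have hgk := h.gap_pos k
    have hsq2 : ∑ i ∈ Finset.range N, deriv (g^[i]) x * deriv (g^[i]) x ≤
        2 * E ^ 2 / κ ^ 2 / μ ^ 2 := by
      refine hsq.trans ?_
      calc _ ≤ 2 * E ^ 2 * μ ^ 2 / (κ * μ ^ 2) ^ 2 := by gcongr
        _ = _ := by field_simp
    have hCb : ∑ i ∈ Finset.range N, 2 ^ s * (s.factorial * σm) *
        (2 ^ s * deriv (g^[i]) x * deriv (g^[i]) x) + |(1 / 2 : ℝ)| *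
          (2 ^ s * (Λ / μ) * (Λ / μ)) ≤ C / μ ^ 2 := by
      have e1 : ∑ i ∈ Finset.range N, 2 ^ s * (s.factorial * σm) *
        (2 ^ s * deriv (g^[i]) x * deriv (g^[i]) x) = 2 ^ s * (s.factorial * σm) * 2 ^ s *
          ∑ i ∈ Finset.range N, deriv (g^[i]) x * deriv (g^[i]) x := by
        rw [Finset.mul_sum (Finset.range N)]; exact Finset.sum_congr rfl fun i _ => by ring
      rw [e1, abs_of_pos (by norm_num)]
      calc _ ≤ 2 ^ s * (s.factorial * σm) * 2 ^ s * (2 * E ^ 2 / κ ^ 2 / μ ^ 2) +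
            1 * (2 ^ s * (Λ / μ) * (Λ / μ)) := by gcongr; norm_num
        _ = C / μ ^ 2 := by rw [hC]; field_simp
    have hfin := hadd.mono hCb (by positivity) hl0 le_rfl
    intro j hj
    have hm : max L C / μ = max L C * μ⁻¹ := div_eq_mul_inv _ _
    rcases j with _ | j
    · have := (hΛ' N hN) 0 (by omega)
      rw [pow_zero] at this ⊢
      refine this.trans ?_
      have : Λ ≤ max L C := hLΛ.trans (le_max_left _ _)
      gcongr
    · rw [iteratedDeriv_succ']
      refine (hfin j (by omega)).trans ?_
      have h1 : C ≤ max L C * max L C := by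
        have : 1 ≤ max L C := hL1.trans (le_max_left _ _)
        exact (le_max_right L C).trans (le_mul_of_one_le_left (by linarith) this)
      calc C / μ ^ 2 * l ^ j ≤ (max L C * max L C) / μ ^ 2 * (max L C / μ) ^ j := by
            rw [hl]; gcongr; exact le_max_left _ _
        _ = _ := by ring

end Orb

/-- Iterated Rolle. -/
theorem exists_zero_iteratedDeriv (n : ℕ) : ∀ (φ : ℝ → ℝ), Sm φ → ∀ (a b : ℝ) (z : ℕ → ℝ),
    (∀ i < n, z i < z (i + 1)) → (∀ i ≤ n, z i ∈ Set.Icc a b) → (∀ i ≤ n, φ (z i) = 0) →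
    ∀ j ≤ n, ∃ c ∈ Set.Icc a b, iteratedDeriv j φ c = 0 := by
  induction n with
  | zero =>
    intro φ _ a b z _ h2 h3 j hj
    obtain rfl : j = 0 := by omega
    exact ⟨z 0, h2 0 le_rfl, by simpa using h3 0 le_rfl⟩
  | succ n ih =>
    intro φ hφ a b z h1 h2 h3 j hj
    rcases j with _ | j
    · exact ⟨z 0, h2 0 (by omega), by simpa using h3 0 (by omega)⟩
    have hex : ∀ i, ∃ c, i ≤ n → c ∈ Set.Ioo (z i) (z (i + 1)) ∧ deriv φ c = 0 := by
      intro i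
      by_cases hi : i ≤ n
      · obtain ⟨c, hc, hc0⟩ := exists_deriv_eq_zero (h1 i (by omega))
          (hφ.continuous.continuousOn) ((h3 i (by omega)).trans (h3 (i + 1) (by omega)).symm)
        exact ⟨c, fun _ => ⟨hc, hc0⟩⟩
      · exact ⟨0, fun h => absurd h hi⟩
    choose c hc using hex
    rw [iteratedDeriv_succ']
    refine ih (deriv φ) (Sm.deriv hφ) a b c (fun i hi => ?_) (fun i hi => ?_)
      (fun i hi => (hc i hi).2) j (by omega)
    · exact (hc i hi.le).1.2.trans (hc (i + 1) hi).1.1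
    · exact ⟨(h2 i (by omega)).1.trans (hc i hi).1.1.le,
        (hc i hi).1.2.le.trans (h2 (i + 1) (by omega)).2⟩

theorem flat_of_zeros {n : ℕ} {φ : ℝ → ℝ} (hφ : Sm φ) {a b B : ℝ}
    (hz : ∀ j ≤ n, ∃ c ∈ Set.Icc a b, iteratedDeriv j φ c = 0)
    (hB : ∀ x ∈ Set.Icc a b, |iteratedDeriv (n + 1) φ x| ≤ B) :
    ∀ m ≤ n + 1, ∀ x ∈ Set.Icc a b, |iteratedDeriv (n + 1 - m) φ x| ≤ B * (b - a) ^ m := by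
  intro m
  induction m with
  | zero => intro _ x hx; simpa using hB x hx
  | succ m ih =>
    intro hm x hx
    obtain ⟨c, hc, hc0⟩ := hz (n + 1 - (m + 1)) (by omega)
    have h1 := (convex_Icc a b).norm_image_sub_le_of_norm_deriv_le
      (f := iteratedDeriv (n + 1 - (m + 1)) φ) (C := B * (b - a) ^ m)
      (fun z _ => (Sm.diff (Sm.iter hφ _)) z) (fun z hz => by
        rw [← iteratedDeriv_succ, Real.norm_eq_abs, show n + 1 - (m + 1) + 1 = n + 1 - m by omega]
        exact ih (by omega) z hz) hc hx
    rw [hc0, sub_zero, Real.norm_eq_abs, Real.norm_eq_abs] at h1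
    refine h1.trans ?_
    have h0 : 0 ≤ B * (b - a) ^ m := (abs_nonneg _).trans (ih (by omega) x hx)
    have h2 : |x - c| ≤ b - a := abs_sub_le_iff.2
      ⟨by linarith [hx.2, hc.1], by linarith [hx.1, hc.2]⟩
    calc _ ≤ B * (b - a) ^ m * (b - a) := by gcongr
      _ = _ := by ring

namespace Orb

theorem map_pow_q {g : ℝ → ℝ} {p : ℤ} {q : ℕ} {y : ℤ → ℝ} (h : Orb g p q y) (k : ℤ) :
    g^[q] (y k) = y k + p := by
  rw [h.iter, h.per_int]

theorem _root_.hull_le {y : ℤ → ℝ} (a : ℤ) {M : ℝ}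
    (hM : ∀ j, gap y j ≤ M) (n : ℕ) : y (a + n) - y a ≤ n * M := by
  induction n with
  | zero => simp
  | succ n ih =>
    have := hM (a + n)
    unfold gap at this
    push_cast
    rw [show a + ((n : ℤ) + 1) = a + n + 1 by ring]
    linarith

/-- The derivatives of iterates on a hull of big gaps. -/
theorem iter_bd (V κ : ℝ) (σ : ℕ → ℝ) (hV0 : 0 ≤ V) (hκ : 0 < κ) (s : ℕ) :
    ∃ Λ, 1 ≤ Λ ∧ ∀ (g : ℝ → ℝ) (p : ℤ) (q : ℕ) (y : ℤ → ℝ), Orb g p q y → LogLip V g →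
      SchwBd σ g → ∀ μ : ℝ, 0 < μ → μ ≤ 1 → (∀ j, gap y j ≤ μ ^ 2) → ∀ k : ℤ, κ * μ ^ 2 ≤ gap y k →
      ∀ x ∈ Set.Icc (y k) (y (k + 1)), ∀ N ≤ q, ∀ i, 1 ≤ i → i ≤ s + 1 →
        |iteratedDeriv i (g^[N]) x| ≤ deriv (g^[N]) x * (Λ / μ) ^ (i - 1) := by
  obtain ⟨Λ, hΛ, h⟩ := nonlin_bd V κ σ hV0 hκ s
  have h2s : (1 : ℝ) ≤ 2 ^ s := one_le_pow₀ (by norm_num)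
  refine ⟨2 ^ s * Λ, one_le_mul_of_one_le_of_one_le h2s hΛ, ?_⟩
  intro g p q y ho hV hσ μ hμ0 hμ1 hμ k hk x hx N hN i hi1 hi2
  have := Bd.iter_deriv (ho.lift.iter N) (by positivity)
    (h g p q y ho hV hσ μ hμ0 hμ1 hμ k hk x hx N hN)
  obtain ⟨i, rfl⟩ : ∃ j, i = j + 1 := ⟨i - 1, by omega⟩
  rw [iteratedDeriv_succ', mul_div_assoc]
  exact this i (by omega)

/-- The return map is very flat on hulls of long gaps. -/
theorem flat (V κ : ℝ) (σ : ℕ → ℝ) (hV0 : 0 ≤ V) (hκ : 0 < κ) (K : ℕ) (hK : 2 ≤ K) :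
    ∃ Λ, 1 ≤ Λ ∧ ∀ (g : ℝ → ℝ) (p : ℤ) (q : ℕ) (y : ℤ → ℝ), Orb g p q y → LogLip V g →
      SchwBd σ g → ∀ μ : ℝ, 0 < μ → μ ≤ 1 → (∀ j, gap y j ≤ μ ^ 2) → ∀ a : ℤ,
      (∀ i : ℕ, i < K → κ * μ ^ 2 ≤ gap y (a + i)) →
      ∀ x ∈ Set.Icc (y a) (y (a + K)), ∀ j m : ℕ, 2 * j + m ≤ K + 2 →
        |iteratedDeriv j (fun x => g^[q] x - p - x) x| ≤ Λ * μ ^ m := by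
  obtain ⟨Λ, hΛ, h⟩ := iter_bd V κ σ hV0 hκ K
  set E := Real.exp (2 * V) with hE
  have hE0 : 0 < E := Real.exp_pos _
  set T := max 1 (E / κ) with hT
  have hT1 : 1 ≤ T := le_max_left _ _
  have hK1 : (1 : ℝ) ≤ K := by exact_mod_cast (by omega : 1 ≤ K)
  refine ⟨T * Λ ^ K * K ^ (K + 1), ?_, ?_⟩
  · exact one_le_mul_of_one_le_of_one_le (one_le_mul_of_one_le_of_one_le hT1 (one_le_pow₀ hΛ))
      (one_le_pow₀ hK1)
  intro g p q y ho hV hσ μ hμ0 hμ1 hμ a ha x hx j m hjm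
  have hFs : Sm (fun x => g^[q] x - p - x) := ((ho.lift.iter q).sm.sub contDiff_const).sub
      contDiff_id
  have hz := exists_zero_iteratedDeriv K _ hFs (y a) (y (a + K)) (fun i => y (a + i))
    (fun i _ => ho.mono (show a + (i : ℤ) < a + ((i + 1 : ℕ) : ℤ) by push_cast; omega))
    (fun i hi => ⟨ho.mono.monotone (show a ≤ a + (i : ℤ) by omega),
      ho.mono.monotone (show a + (i : ℤ) ≤ a + (K : ℤ) by omega)⟩)
    (fun i _ => by simp only [ho.map_pow_q]; ring)
  have hB : ∀ x ∈ Set.Icc (y a) (y (a + K)),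
      |iteratedDeriv (K + 1) (fun x => g^[q] x - p - x) x| ≤ T * (Λ / μ) ^ K := by
    intro x hx
    have hx' : ∃ i : ℕ, i < K ∧ x ∈ Set.Icc (y (a + i)) (y (a + i + 1)) := by
      have hex : ∃ i : ℕ, x ≤ y (a + i + 1) := ⟨K, hx.2.trans (ho.mono.monotone (by omega))⟩
      classical
      have hf := Nat.find_spec hex
      refine ⟨Nat.find hex, ?_, ?_, hf⟩
      · have : x ≤ y (a + (K - 1 : ℕ) + 1) := by
          rw [show a + ((K - 1 : ℕ) : ℤ) + 1 = a + K by omega]; exact hx.2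
        have := Nat.find_min' hex this
        omega
      · rcases Nat.eq_zero_or_pos (Nat.find hex) with h0 | h0
        · rw [h0]; simpa using hx.1
        · have := Nat.find_min hex (m := Nat.find hex - 1) (by omega)
          push Not at this
          refine this.le.trans' (le_of_eq ?_)
          congr 1; omega
    obtain ⟨i, hi, hxi⟩ := hx'
    have h1 := h g p q y ho hV hσ μ hμ0 hμ1 hμ (a + i) (ha i hi) x hxi q le_rfl (K + 1)
      (by omega) le_rfl
    have h2 := ho.deriv_le_of_big hV0 hV (N := q) (by omega) hμ0 hκ hμ (ha i hi) hxi
    have e : iteratedDeriv (K + 1) (fun x => g^[q] x - p - x) x = iteratedDeriv (K + 1)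
        (g^[q]) x := by
      obtain ⟨K, rfl⟩ : ∃ t, K = t + 1 := ⟨K - 1, by omega⟩
      rw [iteratedDeriv_succ', iteratedDeriv_succ', iteratedDeriv_succ', iteratedDeriv_succ']
      congr 1
      have : deriv (fun x => g^[q] x - p - x) = fun x => deriv (g^[q]) x - 1 := by
        ext z
        have := (((Sm.diff (ho.lift.iter q).sm z).hasDerivAt.sub_const (p : ℝ)).sub
          (hasDerivAt_id z)).deriv
        exact this
      rw [this]
      ext z; simp
    rw [e]
    refine h1.trans ?_
    rw [Nat.add_sub_cancel]
    gcongr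
    exact h2.trans (le_max_right _ _)
  have := flat_of_zeros hFs hz hB (K + 1 - j) (by omega) x hx
  rw [show K + 1 - (K + 1 - j) = j by omega] at this
  refine this.trans ?_
  have hhull := hull_le a hμ K
  have h0 : 0 ≤ y (a + K) - y a := sub_nonneg.2 (ho.mono.monotone (by omega))
  calc _ ≤ T * (Λ / μ) ^ K * (K * μ ^ 2) ^ (K + 1 - j) := by gcongr
    _ = T * Λ ^ K * (K : ℝ) ^ (K + 1 - j) * (μ ^ (2 * (K + 1 - j)) / μ ^ K) := by
      rw [div_pow, mul_pow, ← pow_mul]; ring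
    _ = T * Λ ^ K * (K : ℝ) ^ (K + 1 - j) * μ ^ (2 * (K + 1 - j) - K) := by
      congr 1
      rw [div_eq_iff (by positivity), ← pow_add]; congr 1; omega
    _ ≤ T * Λ ^ K * (K : ℝ) ^ (K + 1) * μ ^ m := by
      have h3 : (K : ℝ) ^ (K + 1 - j) ≤ K ^ (K + 1) := pow_le_pow_right₀ hK1 (by omega)
      have h4 : μ ^ (2 * (K + 1 - j) - K) ≤ μ ^ m := pow_le_pow_of_le_one hμ0.le hμ1 (by omega)
      exact mul_le_mul (mul_le_mul_of_nonneg_left h3 (by positivity)) h4 (by positivity)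
        (by positivity)

end Orb

theorem record_infinite {τ : ℝ} (hτ : Irrational τ) :
    {l : ℕ | 0 < l ∧ ∀ i : ℕ, 0 < i → i < l →
      |l * τ - round (l * τ)| < |i * τ - round (i * τ)|}.Infinite := by
  have hpos : ∀ i : ℕ, 0 < i → 0 < |i * τ - round (i * τ)| := by
    intro i hi
    have := (hτ.natCast_mul (m := i) (by omega)).ne_int (round (i * τ))
    exact abs_pos.2 (sub_ne_zero.2 this)
  rw [Set.infinite_iff_exists_gt]
  intro n
  have hm : ∃ m : ℝ, 0 < m ∧ ∀ i : ℕ, 0 < i → i ≤ n → m ≤ |i * τ - round (i * τ)| := by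
    induction n with
    | zero => exact ⟨1, one_pos, fun i h1 h2 => by omega⟩
    | succ n ih =>
      obtain ⟨m, hm0, hm⟩ := ih
      refine ⟨min m |(n + 1 : ℕ) * τ - round ((n + 1 : ℕ) * τ)|,
        lt_min hm0 (hpos _ (by omega)), fun i h1 h2 => ?_⟩
      rcases Nat.lt_or_ge n i with h | h
      · obtain rfl : i = n + 1 := by omega
        exact min_le_right _ _
      · exact (min_le_left _ _).trans (hm i h1 h)
  obtain ⟨m, hm0, hm⟩ := hm
  have hex : ∃ l : ℕ, 0 < l ∧ |l * τ - round (l * τ)| < m := by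
    obtain ⟨N, hN⟩ := exists_nat_gt (1 / m)
    have hN0 : 0 < N := by
      have : (0 : ℝ) < N := lt_trans (by positivity) hN
      exact_mod_cast this
    obtain ⟨k, hk0, -, hk⟩ := Real.exists_nat_abs_mul_sub_round_le τ hN0
    refine ⟨k, hk0, hk.trans_lt ?_⟩
    rw [div_lt_iff₀ (by positivity)]
    rw [div_lt_iff₀ hm0] at hN
    linarith
  classical
  have hf := Nat.find_spec hex
  have hmin : ∀ i : ℕ, 0 < i → i < Nat.find hex → m ≤ |i * τ - round (i * τ)| := by
    intro i h0 hi
    have := Nat.find_min hex hi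
    push Not at this
    exact this h0
  refine ⟨Nat.find hex, ⟨hf.1, fun i h0 hi => hf.2.trans_le (hmin i h0 hi)⟩, ?_⟩
  by_contra hc
  push Not at hc
  have := hm _ hf.1 hc
  linarith [hf.2]

namespace Orb
variable {g : ℝ → ℝ} {p : ℤ} {q : ℕ} {y : ℤ → ℝ}

/-- Up to a closest return time the translates of a hull are disjoint. -/
theorem sum_hull_return (h : Orb g p q y) (a : ℤ) {l e : ℕ}
    (he : ∀ i : ℕ, 0 < i → i < l → ∀ c : ℤ, (e : ℤ) < |i * p - q * c|)
    (heq : e < q) :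
    ∑ i ∈ Finset.range l, (y (a + e + 1 + i * p) - y (a + i * p)) ≤ 1 := by
  have hq0 : (0 : ℤ) < q := by exact_mod_cast h.hq
  have hgap : ∀ k : ℤ, gap y (k % q) = gap y k := by
    intro k
    have := h.gap_per_int (k % q) (k / q)
    rw [← this, Int.emod_add_mul_ediv]
  have e1 : ∀ i : ℕ, y (a + e + 1 + i * p) - y (a + i * p) =
      ∑ j ∈ Finset.range (e + 1), gap y (a + i * p + j) := by
    intro i
    have := Finset.sum_range_sub (fun j : ℕ => y (a + i * p + j)) (e + 1)
    simp only [Nat.cast_add, Nat.cast_one, Nat.cast_zero, add_zero] at this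
    rw [show a + e + 1 + i * p = a + i * p + (e + 1) by ring, ← this]
    refine Finset.sum_congr rfl fun j _ => ?_
    unfold gap; rw [add_assoc (a + i * p)]
  simp_rw [e1]
  rw [← Finset.sum_product', ← h.sum_gap]
  have hinj : Set.InjOn (fun x : ℕ × ℕ => ((a + x.1 * p + x.2) % (q : ℤ)).toNat)
      (Finset.range l ×ˢ Finset.range (e + 1) : Finset (ℕ × ℕ)) := by
    have key : ∀ i j i' j' : ℕ, i < l → i' < l → j ≤ e → j' ≤ e → i ≤ i' →
        (a + i * p + j) % (q : ℤ) = (a + i' * p + j') % (q : ℤ) → i = i' ∧ j = j' := by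
      intro i j i' j' hi hi' hj hj' hii heq'
      obtain ⟨c, hc⟩ := Int.ModEq.dvd (show a + i * p + j ≡ a + i' * p + j' [ZMOD q] from heq')
      obtain ⟨d, rfl⟩ : ∃ d, i' = i + d := ⟨i' - i, by omega⟩
      push_cast at hc
      have hc2 : (d : ℤ) * p - q * c = j - j' := by linarith [hc]
      rcases Nat.eq_zero_or_pos d with hd | hd
      · subst hd
        refine ⟨by omega, ?_⟩
        have hc3 : (q : ℤ) * c = j' - j := by push_cast at hc2; linarith
        have : c = 0 := by
          by_contra hne
          rcases lt_or_gt_of_ne hne with hc0 | hc0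
          · nlinarith
          · nlinarith
        rw [this] at hc3; omega
      · have := he d hd (by omega) c
        rw [hc2] at this
        have : |(j : ℤ) - j'| ≤ e := abs_sub_le_iff.2 ⟨by omega, by omega⟩
        omega
    rintro ⟨i, j⟩ h1 ⟨i', j'⟩ h2 heq'
    simp only [Finset.coe_product, Set.mem_prod, Finset.coe_range, Set.mem_Iio] at h1 h2
    simp only at heq'
    have n1 := Int.emod_nonneg (a + i * p + j) hq0.ne'
    have n2 := Int.emod_nonneg (a + i' * p + j') hq0.ne'
    have heq2 : (a + i * p + j) % (q : ℤ) = (a + i' * p + j') % (q : ℤ) := by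
      rw [← Int.toNat_of_nonneg n1, ← Int.toNat_of_nonneg n2, heq']
    rcases le_total i i' with hii | hii
    · obtain ⟨r1, r2⟩ := key i j i' j' h1.1 h2.1 (by omega) (by omega) hii heq2
      rw [r1, r2]
    · obtain ⟨r1, r2⟩ := key i' j' i j h2.1 h1.1 (by omega) (by omega) hii heq2.symm
      rw [r1, r2]
  calc _ = ∑ x ∈ Finset.range l ×ˢ Finset.range (e + 1),
        gap y ((((a + x.1 * p + x.2) % (q : ℤ)).toNat : ℕ) : ℤ) := by
        refine Finset.sum_congr rfl fun x _ => ?_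
        rw [Int.toNat_of_nonneg (Int.emod_nonneg _ hq0.ne'), hgap]
    _ = ∑ n ∈ (Finset.range l ×ˢ Finset.range (e + 1)).image
        (fun x : ℕ × ℕ => ((a + x.1 * p + x.2) % (q : ℤ)).toNat), gap y (n : ℤ) :=
        (Finset.sum_image (f := fun n : ℕ => gap y (n : ℤ)) hinj).symm
    _ ≤ _ := by
        refine Finset.sum_le_sum_of_subset_of_nonneg ?_ fun _ _ _ => (h.gap_pos _).le
        intro n hn
        obtain ⟨x, -, rfl⟩ := Finset.mem_image.1 hn
        have := Int.emod_lt_of_pos (a + x.1 * p + x.2) hq0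
        have := Int.emod_nonneg (a + x.1 * p + x.2) hq0.ne'
        rw [Finset.mem_range]; omega

/-- Closest returns of the longest gap have comparable length. -/
theorem return_gap (h : Orb g p q y) {V : ℝ} (hV0 : 0 ≤ V) (hV : LogLip V g) {k : ℤ}
    (hk : ∀ j, gap y j ≤ gap y k) {l e : ℕ} {c : ℤ} (hle : |l * p - q * c| = e)
    (he : ∀ i : ℕ, 0 < i → i < l → ∀ c : ℤ, (e : ℤ) < |i * p - q * c|) (heq : e < q) :
    gap y k ≤ Real.exp V * gap y (k + e) := by
  have main : ∀ a A B : ℤ, (A = a ∨ A = a + e) → (B = a ∨ B = a + e) →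
      gap y (A + l * p) * gap y B ≤ Real.exp V * (gap y (B + l * p) * gap y A) := by
    intro a A B hA hB
    obtain ⟨u, hu, hue⟩ := h.exists_deriv_eq l (lt_add_one A)
    obtain ⟨v, hv, hve⟩ := h.exists_deriv_eq l (lt_add_one B)
    have hmem : ∀ (C : ℤ) (w : ℝ), (C = a ∨ C = a + e) → w ∈ Set.Icc (y C) (y (C + 1)) →
        w ∈ Set.Icc (y a) (y (a + e + 1)) := by
      intro C w hC hw
      exact ⟨(h.mono.monotone (by omega)).trans hw.1, hw.2.trans (h.mono.monotone (by omega))⟩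
    have hD : deriv (g^[l]) u ≤ Real.exp V * deriv (g^[l]) v := by
      refine le_exp_mul ((h.lift.iter l).pos _) ((h.lift.iter l).pos _) ?_
      refine (log_deriv_iter_sub h.lift hV l u v).trans ?_
      refine (mul_le_mul_of_nonneg_left ?_ hV0).trans (mul_one V).le
      refine (Finset.sum_le_sum fun i _ => ?_).trans (h.sum_hull_return a he heq)
      have h1 := h.mem_iter (hmem A u hA hu) i
      have h2 := h.mem_iter (hmem B v hB hv) i
      exact abs_sub_le_iff.2 ⟨by linarith [h1.2, h2.1], by linarith [h1.1, h2.2]⟩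
    have eA : deriv (g^[l]) u * gap y A = gap y (A + l * p) := by
      unfold gap; rw [hue]; congr 2; ring
    have eB : deriv (g^[l]) v * gap y B = gap y (B + l * p) := by
      unfold gap; rw [hve]; congr 2; ring
    have := h.gap_pos A
    have := h.gap_pos B
    calc _ = deriv (g^[l]) u * (gap y A * gap y B) := by rw [← eA]; ring
      _ ≤ Real.exp V * deriv (g^[l]) v * (gap y A * gap y B) := by gcongr
      _ = _ := by rw [← eB]; ring
  have gpos := h.gap_pos k
  have hfin : gap y k * gap y k ≤ Real.exp V * (gap y (k + e) * gap y (k - e)) := by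
    rcases abs_eq (by positivity : (0 : ℤ) ≤ e) |>.1 hle with h1 | h1
    · have := main (k - e) (k - e) k (Or.inl rfl) (Or.inr (by ring))
      rw [show k - e + l * p = k + q * c by linarith, h.gap_per_int,
        show k + l * p = k + e + q * c by linarith, h.gap_per_int] at this
      exact this
    · have := main k (k + e) k (Or.inr rfl) (Or.inl rfl)
      rw [show k + e + l * p = k + q * c by linarith, h.gap_per_int,
        show k + l * p = k - e + q * c by linarith, h.gap_per_int] at this
      linarith
  have h1 := hk (k - e)
  have h2 := h.gap_pos (k + e)
  have h3 : Real.exp V * (gap y (k + e) * gap y (k - e)) ≤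
      Real.exp V * gap y (k + e) * gap y k := by
    rw [← mul_assoc]; gcongr
  exact le_of_mul_le_mul_right (hfin.trans h3) gpos

end Orb

/-- The gaps are uniformly small for rotation numbers close to an irrational number. -/
theorem gap_small {V τ η : ℝ} (hV0 : 0 ≤ V) (hτ : Irrational τ) (hη : 0 < η) :
    ∀ᶠ x : ℝ in 𝓝 τ, ∀ (g : ℝ → ℝ) (p : ℤ) (q : ℕ) (y : ℤ → ℝ), Orb g p q y → LogLip V g →
      x = p / q → ∀ k, gap y k ≤ η := by
  obtain ⟨S, hS⟩ := exists_nat_gt (Real.exp V / η)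
  obtain ⟨Λ, hΛ, hcard⟩ := (record_infinite hτ).exists_subset_card_eq S
  have hpos : ∀ i : ℕ, 0 < i → 0 < |i * τ - round (i * τ)| := by
    intro i hi
    have := (hτ.natCast_mul (m := i) (by omega)).ne_int (round (i * τ))
    exact abs_pos.2 (sub_ne_zero.2 this)
  have E1 : ∀ᶠ x : ℝ in 𝓝 τ, ∀ l ∈ Λ, ∀ i ∈ Finset.range l, 0 < i →
      |l * x - round (l * τ)| < |i * τ - round (i * τ)| - i * |x - τ| := by
    rw [Filter.eventually_all_finset]; intro l hl
    rw [Filter.eventually_all_finset]; intro i hi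
    by_cases h0 : 0 < i
    · have hc1 : ContinuousAt (fun x : ℝ => |l * x - round (l * τ)|) τ := by fun_prop
      have hc2 : ContinuousAt (fun x : ℝ => |i * τ - round (i * τ)| - i * |x - τ|) τ := by fun_prop
      have := (hΛ hl).2 i h0 (Finset.mem_range.1 hi)
      filter_upwards [hc1.eventually_lt hc2 (by simpa using this)] with x hx _ using hx
    · exact Eventually.of_forall fun x h => absurd h h0
  have E2 : ∀ᶠ x : ℝ in 𝓝 τ, ∀ l ∈ Λ, 0 < |l * x - round (l * τ)| ∧
      |l * x - round (l * τ)| < 1 := by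
    rw [Filter.eventually_all_finset]; intro l hl
    have hc1 : ContinuousAt (fun x : ℝ => |l * x - round (l * τ)|) τ := by fun_prop
    have h0 := hpos l (hΛ hl).1
    have h1 : |l * τ - round (l * τ)| < 1 := (abs_sub_round _).trans_lt (by norm_num)
    filter_upwards [hc1.eventually (lt_mem_nhds h0), hc1.eventually (gt_mem_nhds h1)] with x h2 h3
      using ⟨h2, h3⟩
  filter_upwards [E1, E2] with x hx1 hx2 g p q y ho hV hxp
  obtain ⟨k, hk⟩ := ho.exists_max_gap
  suffices gap y k ≤ η from fun j => (hk j).trans this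
  have hq0 : (0 : ℝ) < q := by exact_mod_cast ho.hq
  set e : ℕ → ℕ := fun l => (l * p - q * round (l * τ)).natAbs with he
  have hecast : ∀ l : ℕ, ((e l : ℕ) : ℝ) = q * |l * x - round (l * τ)| := by
    intro l
    rw [he, Nat.cast_natAbs]
    push_cast
    have e5 : (l : ℝ) * p - q * round (l * τ) = q * (l * x - round (l * τ)) := by
      rw [hxp]; field_simp
    rw [e5, abs_mul, abs_of_pos hq0]
  have hret : ∀ l ∈ Λ, ∀ i : ℕ, 0 < i → i < l → ∀ c : ℤ, ((e l : ℕ) : ℤ) < |i * p - q * c| := by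
    intro l hl i h0 hi c
    have h1 := hx1 l hl i (Finset.mem_range.2 hi) h0
    have h2 : |i * τ - round (i * τ)| ≤ |i * τ - c| := round_le _ _
    have h3 : |i * τ - c| ≤ |i * x - c| + i * |x - τ| := by
      calc |i * τ - c| = |(i * x - c) - i * (x - τ)| := by congr 1; ring
        _ ≤ |i * x - c| + |i * (x - τ)| := abs_sub _ _
        _ = _ := by rw [abs_mul, Nat.abs_cast]
    have h4 : ((e l : ℕ) : ℝ) < |(i : ℝ) * p - q * c| := by
      rw [hecast]
      have e5 : (i : ℝ) * p - q * c = q * (i * x - c) := by rw [hxp]; field_simp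
      rw [e5, abs_mul, abs_of_pos hq0]
      exact mul_lt_mul_of_pos_left (by linarith) hq0
    exact_mod_cast h4
  have heq : ∀ l ∈ Λ, e l < q := by
    intro l hl
    have h1 : ((e l : ℕ) : ℝ) < q := by
      rw [hecast]
      calc _ < (q : ℝ) * 1 := mul_lt_mul_of_pos_left (hx2 l hl).2 hq0
        _ = q := mul_one _
    exact_mod_cast h1
  have hinj : Set.InjOn e Λ := by
    have : ∀ l ∈ Λ, ∀ l' ∈ Λ, l < l' → e l' < e l := by
      intro l hl l' hl' hll
      have := hret l' hl' l (hΛ hl).1 hll (round (l * τ))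
      rw [Int.abs_eq_natAbs] at this
      exact_mod_cast this
    intro l hl l' hl' hll
    by_contra hne
    rcases lt_or_gt_of_ne hne with h1 | h1
    · have := this l hl l' hl' h1; omega
    · have := this l' hl' l hl h1; omega
  have hle : ∀ l ∈ Λ, gap y k ≤ Real.exp V * gap y (k + (e l : ℕ)) := by
    intro l hl
    refine ho.return_gap hV0 hV hk (l := l) (c := round (l * τ)) ?_ (hret l hl) (heq l hl)
    simp [he]
  have hsum : ∑ l ∈ Λ, gap y (k + (e l : ℕ)) ≤ 1 := by
    rw [← Finset.sum_image (f := fun n : ℕ => gap y (k + n)) hinj]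
    have h1 := sum_period (p := 1) ho.hq isCoprime_one_left ho.gap_per k
    simp only [mul_one] at h1
    rw [← ho.sum_gap, ← h1]
    refine Finset.sum_le_sum_of_subset_of_nonneg ?_ fun _ _ _ => (ho.gap_pos _).le
    intro n hn
    obtain ⟨l, hl, rfl⟩ := Finset.mem_image.1 hn
    exact Finset.mem_range.2 (heq l hl)
  have h5 : S * gap y k ≤ Real.exp V := by
    calc (S : ℝ) * gap y k = ∑ l ∈ Λ, gap y k := by rw [Finset.sum_const, hcard, nsmul_eq_mul]
      _ ≤ ∑ l ∈ Λ, Real.exp V * gap y (k + (e l : ℕ)) := Finset.sum_le_sum hle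
      _ = Real.exp V * ∑ l ∈ Λ, gap y (k + (e l : ℕ)) := by rw [Finset.mul_sum]
      _ ≤ Real.exp V * 1 := by gcongr
      _ = _ := mul_one _
  rw [div_lt_iff₀ hη] at hS
  by_contra hc
  push Not at hc
  have hS0 : (0 : ℝ) ≤ S := Nat.cast_nonneg _
  nlinarith [mul_le_mul_of_nonneg_left hc.le hS0]

/-- A smooth bump whose integer translates sum to one. -/
def bmp (u : ℝ) : ℝ := Real.smoothTransition (u + 1) - Real.smoothTransition u

theorem bmp_sm : Sm bmp :=
  (Real.smoothTransition.contDiff.comp (contDiff_id.add contDiff_const)).sub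
    Real.smoothTransition.contDiff

theorem bmp_nonneg (u : ℝ) : 0 ≤ bmp u :=
  sub_nonneg.2 (Real.smoothTransition.monotone (by linarith))

theorem bmp_le_one (u : ℝ) : bmp u ≤ 1 := by
  have := Real.smoothTransition.le_one (u + 1)
  have := Real.smoothTransition.nonneg u
  unfold bmp; linarith

theorem bmp_eq_zero {u : ℝ} (hu : 1 ≤ |u|) : bmp u = 0 := by
  unfold bmp
  rcases le_abs.1 hu with h | h
  · rw [Real.smoothTransition.one_of_one_le h, Real.smoothTransition.one_of_one_le (by linarith),
      sub_self]
  · rw [Real.smoothTransition.zero_of_nonpos (by linarith),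
      Real.smoothTransition.zero_of_nonpos (by linarith), sub_self]

theorem bmp_pos {u : ℝ} (hu : |u| < 1) : 0 < bmp u := by
  have h := abs_lt.1 hu
  unfold bmp
  rcases le_total u 0 with h0 | h0
  · rw [Real.smoothTransition.zero_of_nonpos h0, sub_zero]
    exact Real.smoothTransition.pos_of_pos (by linarith)
  · rw [Real.smoothTransition.one_of_one_le (by linarith : 1 ≤ u + 1)]
    linarith [Real.smoothTransition.lt_one_of_lt_one h.2]

theorem bmp_lower {ρ : ℝ} (hρ0 : 0 ≤ ρ) (hρ : ρ < 1) : ∃ θ, 0 < θ ∧ ∀ u, |u| ≤ ρ → θ ≤ bmp u := by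
  obtain ⟨u0, hu0, h⟩ := (isCompact_Icc (a := -ρ) (b := ρ)).exists_isMinOn ⟨0, by simp [hρ0]⟩
    bmp_sm.continuous.continuousOn
  exact ⟨bmp u0, bmp_pos ((abs_le.2 hu0).trans_lt hρ), fun u hu => h (abs_le.1 hu)⟩

theorem bmp_iter_bdd (n : ℕ) : ∃ C, 1 ≤ C ∧ ∀ j ≤ n, ∀ x, |iteratedDeriv j bmp x| ≤ C := by
  have h : ∀ j : ℕ, ∃ C, ∀ x, |iteratedDeriv j bmp x| ≤ C := by
    intro j
    obtain ⟨C, hC⟩ := isCompact_Icc.exists_bound_of_continuousOn (s := Set.Icc (-1 : ℝ) 1)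
      (Sm.iter bmp_sm j).continuous.continuousOn
    refine ⟨C, fun x => ?_⟩
    by_cases hx : x ∈ Set.Icc (-1 : ℝ) 1
    · exact hC x hx
    · have hx' : 1 < |x| := by
        by_contra hc; push Not at hc; exact hx (abs_le.1 hc)
      have e : bmp =ᶠ[𝓝 x] fun _ => (0 : ℝ) := by
        filter_upwards [continuous_abs.continuousAt.eventually (lt_mem_nhds hx')] with u hu
        exact bmp_eq_zero hu.le
      rw [e.iteratedDeriv_eq]
      have h0 : 0 ≤ C := (norm_nonneg _).trans (hC 0 (by simp))
      rw [iteratedDeriv_const]; split <;> simpa using h0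
  choose C hC using h
  refine ⟨1 + ∑ i ∈ Finset.range (n + 1), C i, ?_, fun j hj x => (hC j x).trans ?_⟩
  · have := Finset.sum_nonneg (s := Finset.range (n + 1)) (f := C)
      fun i _ => (abs_nonneg _).trans (hC i 0)
    linarith
  · have := Finset.single_le_sum (f := C) (fun i _ => (abs_nonneg _).trans (hC i 0))
      (Finset.mem_range.2 (by omega : j < n + 1))
    linarith

/-- The `L`-periodic sum of translates of the bump. -/
def pbmp (L u : ℝ) : ℝ := bmp (u - L * round (u / L))

theorem pbmp_nonneg (L u : ℝ) : 0 ≤ pbmp L u := bmp_nonneg _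
theorem pbmp_le_one (L u : ℝ) : pbmp L u ≤ 1 := bmp_le_one _

theorem pbmp_eq_zero {L u : ℝ} (h : ∀ m : ℤ, 1 ≤ |u - L * m|) : pbmp L u = 0 := bmp_eq_zero (h _)

theorem sub_round_le {L : ℝ} (hL : 0 < L) (u : ℝ) : |u - L * round (u / L)| ≤ L / 2 := by
  have h := abs_sub_round (u / L)
  have e : u - L * round (u / L) = L * (u / L - round (u / L)) := by field_simp
  rw [e, abs_mul, abs_of_pos hL]; nlinarith

theorem pbmp_eq {L u : ℝ} (hL : 2 ≤ L) {m : ℤ} (h : |u - L * m| < L - 1) :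
    pbmp L u = bmp (u - L * m) := by
  have hr := sub_round_le (L := L) (by linarith) u
  set n := round (u / L) with hn
  by_cases hnm : n = m
  · unfold pbmp; rw [← hn, hnm]
  have h1 : (1 : ℝ) ≤ |(n : ℝ) - m| := by
    exact_mod_cast Int.one_le_abs (sub_ne_zero.2 hnm)
  have h2 : L ≤ |u - L * m| + |u - L * n| := by
    calc L ≤ L * |(n : ℝ) - m| := le_mul_of_one_le_right (by linarith) h1
      _ = |L * (n - m)| := by rw [abs_mul, abs_of_pos (a := L) (by linarith)]
      _ = |(u - L * m) - (u - L * n)| := by congr 1; ring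
      _ ≤ _ := abs_sub _ _
  unfold pbmp
  rw [← hn, bmp_eq_zero (by linarith), bmp_eq_zero (by linarith)]

theorem pbmp_period {L : ℝ} (hL : 0 < L) (u : ℝ) : pbmp L (u + L) = pbmp L u := by
  unfold pbmp
  rw [show (u + L) / L = u / L + 1 by field_simp, round_add_one]
  congr 1; push_cast; ring

theorem pbmp_eventuallyEq {L : ℝ} (hL : 3 ≤ L) (u : ℝ) :
    pbmp L =ᶠ[𝓝 u] fun w => bmp (w - L * round (u / L)) := by
  have h1 : |u - L * round (u / L)| < L - 1 := (sub_round_le (by linarith) u).trans_lt (by linarith)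
  have hc : ContinuousAt (fun w : ℝ => |w - L * round (u / L)|) u := by fun_prop
  filter_upwards [hc.eventually (gt_mem_nhds h1)] with w hw
  exact pbmp_eq (by linarith) hw

theorem pbmp_sm {L : ℝ} (hL : 3 ≤ L) : Sm (pbmp L) := by
  rw [contDiff_iff_contDiffAt]
  intro u
  refine ContDiffAt.congr_of_eventuallyEq ?_ (pbmp_eventuallyEq hL u)
  exact (bmp_sm.comp (contDiff_id.sub contDiff_const)).contDiffAt

theorem pbmp_iter {L : ℝ} (hL : 3 ≤ L) (j : ℕ) (u : ℝ) :
    ∃ v, iteratedDeriv j (pbmp L) u = iteratedDeriv j bmp v := by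
  rw [(pbmp_eventuallyEq hL u).iteratedDeriv_eq, iteratedDeriv_comp_sub_const]
  exact ⟨_, rfl⟩

theorem pbmp_sum {q : ℕ} (hq : 3 ≤ q) (u : ℝ) :
    ∑ j ∈ Finset.range q, pbmp q (u + j) = 1 := by
  have hq' : (3 : ℝ) ≤ q := by exact_mod_cast hq
  set G : ℝ → ℝ := fun u => ∑ j ∈ Finset.range q, pbmp q (u + j) with hG
  have hper : Function.Periodic G 1 := by
    intro u
    have h1 := Finset.sum_range_succ' (fun j : ℕ => pbmp q (u + j)) q
    have h2 := Finset.sum_range_succ (fun j : ℕ => pbmp q (u + j)) q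
    rw [pbmp_period (by linarith)] at h2
    simp only [hG]
    have h3 : ∑ j ∈ Finset.range q, pbmp q (u + 1 + j) =
        ∑ j ∈ Finset.range q, pbmp q (u + (j + 1 : ℕ)) :=
      Finset.sum_congr rfl fun j _ => by congr 1; push_cast; ring
    rw [h3]
    simp only [Nat.cast_zero, add_zero] at h1
    linarith
  change G u = 1
  obtain ⟨w, hw, huw⟩ := hper.exists_mem_Ico₀ one_pos u
  rw [huw]
  obtain ⟨n, rfl⟩ : ∃ n, q = n + 2 := ⟨q - 2, by omega⟩
  have hn : (1 : ℝ) ≤ n := by push_cast at hq'; linarith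
  simp only [hG]
  rw [Finset.sum_range_succ, Finset.sum_range_succ']
  have hmid : ∑ k ∈ Finset.range n, pbmp ((n + 2 : ℕ) : ℝ) (w + (k + 1 : ℕ)) = 0 := by
    refine Finset.sum_eq_zero fun k hk => ?_
    have hk' : ((k + 1 : ℕ) : ℝ) ≤ n := by exact_mod_cast (Finset.mem_range.1 hk)
    push_cast at hk' ⊢
    have hk0 : (0 : ℝ) ≤ k := Nat.cast_nonneg k
    rw [show ((n : ℝ) + 2) = ((n + 2 : ℕ) : ℝ) by push_cast; ring]
    rw [pbmp_eq (m := 0) (by push_cast; linarith)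
      (by push_cast; rw [mul_zero, sub_zero, abs_of_nonneg (by linarith [hw.1])]; linarith [hw.2])]
    refine bmp_eq_zero ?_
    push_cast
    rw [mul_zero, sub_zero, abs_of_nonneg (by linarith [hw.1])]; linarith [hw.1]
  rw [hmid, pbmp_eq (m := 0) (by push_cast; linarith)
      (by push_cast; rw [mul_zero, sub_zero, abs_of_nonneg (by linarith [hw.1])]; linarith [hw.2]),
    pbmp_eq (m := 1) (by push_cast; linarith)
      (by push_cast; rw [abs_lt]; constructor <;> linarith [hw.1, hw.2])]
  push_cast
  unfold bmp
  rw [show w + ((n : ℝ) + 1) - (n + 2) * 1 + 1 = w by ring,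
    show w + ((n : ℝ) + 1) - (n + 2) * 1 = w - 1 by ring,
    show w + 0 - (n + 2) * 0 + 1 = w + 1 by ring, show w + 0 - ((n : ℝ) + 2) * 0 = w by ring,
    Real.smoothTransition.one_of_one_le (by linarith [hw.1] : 1 ≤ w + 1),
    Real.smoothTransition.zero_of_nonpos (by linarith [hw.2] : w - 1 ≤ 0)]
  ring

/-- A `1`-periodic bump of half-width `w` around `c`. -/
def chi (c w x : ℝ) : ℝ := pbmp (1 / w) (1 / w * x - c / w)

/-- The primitive of `chi`. -/
def Xi (c w x : ℝ) : ℝ := ∫ t in (0 : ℝ)..x, chi c w t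

section chi
variable {c w : ℝ}

theorem chi_sm (hw0 : 0 < w) (hw : w ≤ 1 / 3) : Sm (chi c w) := by
  have hL : 3 ≤ 1 / w := by rw [le_div_iff₀ hw0]; linarith
  exact (pbmp_sm hL).comp ((contDiff_const.mul contDiff_id).sub contDiff_const)

theorem chi_period (hw0 : 0 < w) (x : ℝ) : chi c w (x + 1) = chi c w x := by
  unfold chi
  rw [← pbmp_period (by positivity : 0 < 1 / w) (1 / w * x - c / w)]
  congr 1; ring

theorem chi_nonneg (x : ℝ) : 0 ≤ chi c w x := pbmp_nonneg _ _
theorem chi_le_one (x : ℝ) : chi c w x ≤ 1 := pbmp_le_one _ _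

theorem chi_iter (hw0 : 0 < w) (hw : w ≤ 1 / 3) (j : ℕ) (x : ℝ) :
    ∃ v, iteratedDeriv j (chi c w) x = (1 / w) ^ j * iteratedDeriv j bmp v := by
  have hL : 3 ≤ 1 / w := by rw [le_div_iff₀ hw0]; linarith
  have h1 : chi c w = fun x => (fun t => pbmp (1 / w) (t - c / w)) ((1 / w) * x) := rfl
  have hs : Sm (fun t => pbmp (1 / w) (t - c / w)) :=
    (pbmp_sm hL).comp (contDiff_id.sub contDiff_const)
  rw [h1, iteratedDeriv_comp_const_mul (Sm.of j hs), iteratedDeriv_comp_sub_const]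
  obtain ⟨v, hv⟩ := pbmp_iter hL j (1 / w * x - c / w)
  exact ⟨v, by beta_reduce; rw [hv]⟩

theorem chi_arg (hw0 : 0 < w) (x : ℝ) (m : ℤ) :
    |1 / w * x - c / w - 1 / w * m| = |x - c - m| / w := by
  rw [show 1 / w * x - c / w - 1 / w * m = (x - c - m) / w by ring, abs_div, abs_of_pos hw0]

theorem chi_eq_zero (hw0 : 0 < w) {x : ℝ} (h : ∀ m : ℤ, w ≤ |x - c - m|) : chi c w x = 0 := by
  refine pbmp_eq_zero fun m => ?_
  rw [chi_arg hw0, le_div_iff₀ hw0, one_mul]; exact h m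

theorem chi_ge (hw0 : 0 < w) (hw : w ≤ 1 / 3) {ρ θ : ℝ} (hρ : ρ < 1)
    (hθ : ∀ u, |u| ≤ ρ → θ ≤ bmp u) {x : ℝ} {m : ℤ} (h : |x - c - m| ≤ ρ * w) : θ ≤ chi c w x := by
  have hL : 3 ≤ 1 / w := by rw [le_div_iff₀ hw0]; linarith
  have h1 : |1 / w * x - c / w - 1 / w * m| ≤ ρ := by
    rw [chi_arg hw0, div_le_iff₀ hw0]; exact h
  unfold chi
  rw [pbmp_eq (by linarith) (h1.trans_lt (by linarith))]
  exact hθ _ h1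

theorem Xi_hasDerivAt (hw0 : 0 < w) (hw : w ≤ 1 / 3) (x : ℝ) : HasDerivAt (Xi c w) (chi c w x) x :=
  (chi_sm hw0 hw).continuous.integral_hasStrictDerivAt 0 x |>.hasDerivAt

theorem deriv_Xi (hw0 : 0 < w) (hw : w ≤ 1 / 3) : deriv (Xi c w) = chi c w :=
  funext fun x => (Xi_hasDerivAt hw0 hw x).deriv

theorem Xi_sm (hw0 : 0 < w) (hw : w ≤ 1 / 3) : Sm (Xi c w) := by
  rw [contDiff_infty_iff_deriv, deriv_Xi hw0 hw]
  exact ⟨fun x => (Xi_hasDerivAt hw0 hw x).differentiableAt, chi_sm hw0 hw⟩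

theorem Xi_add_one (hw0 : 0 < w) (hw : w ≤ 1 / 3) (x : ℝ) :
    Xi c w (x + 1) = Xi c w x + Xi c w 1 := by
  have hi : ∀ a b, IntervalIntegrable (chi c w) volume a b := fun a b =>
    (chi_sm hw0 hw).continuous.intervalIntegrable a b
  have hp : Function.Periodic (chi c w) 1 := chi_period hw0
  have := hp.intervalIntegral_add_eq x 0
  rw [zero_add] at this
  unfold Xi
  rw [← intervalIntegral.integral_add_adjacent_intervals (hi 0 x) (hi x (x + 1)), this]

theorem Xi_mono (hw0 : 0 < w) (hw : w ≤ 1 / 3) : Monotone (Xi c w) :=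
  monotone_of_deriv_nonneg (Sm.diff (Xi_sm hw0 hw)) fun x => by
    rw [deriv_Xi hw0 hw]; exact chi_nonneg x

theorem Xi_one_le (hw0 : 0 < w) (hw : w ≤ 1 / 3) : Xi c w 1 ≤ 1 := by
  unfold Xi
  calc _ ≤ ∫ t in (0 : ℝ)..1, (1 : ℝ) := intervalIntegral.integral_mono_on zero_le_one
        ((chi_sm hw0 hw).continuous.intervalIntegrable _ _) (by simp) fun x _ => chi_le_one x
    _ = 1 := by simp

theorem Xi_slope (hw0 : 0 < w) (hw : w ≤ 1 / 3) {a b θ : ℝ} (hab : a ≤ b)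
    (h : ∀ x ∈ Set.Icc a b, θ ≤ chi c w x) : θ * (b - a) ≤ Xi c w b - Xi c w a := by
  refine (convex_Icc a b).mul_sub_le_image_sub_of_le_deriv (Xi_sm hw0 hw).continuous.continuousOn
    (Sm.diff (Xi_sm hw0 hw)).differentiableOn (fun x hx => ?_) a ⟨le_rfl, hab⟩ b ⟨hab, le_rfl⟩ hab
  rw [deriv_Xi hw0 hw]; exact h x (interior_subset hx)

theorem Xi_const (hw0 : 0 < w) (hw : w ≤ 1 / 3) {a b u v : ℝ} (h : ∀ x ∈ Set.Icc a b, chi c w x = 0)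
    (hu : u ∈ Set.Icc a b) (hv : v ∈ Set.Icc a b) : Xi c w u = Xi c w v := by
  have := (convex_Icc a b).norm_image_sub_le_of_norm_deriv_le (f := Xi c w) (C := 0)
    (fun z _ => (Sm.diff (Xi_sm hw0 hw)) z) (fun z hz => by
      rw [deriv_Xi hw0 hw, h z hz, norm_zero]) hv hu
  rw [zero_mul, norm_le_zero_iff, sub_eq_zero] at this
  exact this

end chi

/-- The smooth coordinate in which an orbit becomes integral. -/
def zeta (g : ℝ → ℝ) (q : ℕ) (c w b x : ℝ) : ℝ :=
  (Xi c w 1)⁻¹ * ∑ i ∈ Finset.range q, Xi c w (g^[i] x) - b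

section zeta
variable {g : ℝ → ℝ} {p : ℤ} {q : ℕ} {y : ℤ → ℝ} {c w b : ℝ}

theorem zeta_sm (hg : IsCircleDiffeoLift g) (hw0 : 0 < w) (hw : w ≤ 1 / 3) : Sm (zeta g q c w b) :=
  (contDiff_const.mul (ContDiff.sum fun i _ => (Xi_sm hw0 hw).comp (hg.iter i).sm)).sub
    contDiff_const

theorem Xi_add_int (hw0 : 0 < w) (hw : w ≤ 1 / 3) (x : ℝ) (n : ℤ) :
    Xi c w (x + n) = Xi c w x + n * Xi c w 1 := by
  have hp : Function.Periodic (fun x => Xi c w x - x * Xi c w 1) 1 := fun x => by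
    simp only; rw [Xi_add_one hw0 hw]; ring
  have := (hp.int_mul n) x
  simp only [mul_one] at this
  linarith

theorem zeta_add_one (hg : IsCircleDiffeoLift g) (hw0 : 0 < w) (hw : w ≤ 1 / 3)
    (hω : 0 < Xi c w 1) (x : ℝ) : zeta g q c w b (x + 1) = zeta g q c w b x + q := by
  unfold zeta
  have : ∀ i, Xi c w (g^[i] (x + 1)) = Xi c w (g^[i] x) + Xi c w 1 := fun i => by
    rw [(hg.iter i).2.1, Xi_add_one hw0 hw]
  simp_rw [this]
  rw [Finset.sum_add_distrib, Finset.sum_const, Finset.card_range, nsmul_eq_mul]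
  field_simp; ring

theorem zeta_map (hw0 : 0 < w) (hw : w ≤ 1 / 3) (hω : 0 < Xi c w 1) (p : ℤ) (x : ℝ) :
    zeta g q c w b (g x) = zeta g q c w b x + p +
      (Xi c w 1)⁻¹ * (Xi c w (g^[q] x - p) - Xi c w x) := by
  unfold zeta
  have h1 := Finset.sum_range_succ' (fun i => Xi c w (g^[i] x)) q
  have h2 := Finset.sum_range_succ (fun i => Xi c w (g^[i] x)) q
  simp only [Function.iterate_succ_apply, Function.iterate_zero, id] at h1
  have h3 := Xi_add_int (c := c) hw0 hw (g^[q] x - p) p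
  rw [sub_add_cancel] at h3
  rw [h3] at h2
  have h4 : ∑ i ∈ Finset.range q, Xi c w (g^[i] (g x)) =
      ∑ i ∈ Finset.range q, Xi c w (g^[i] x) + (Xi c w (g^[q] x - p) + p * Xi c w 1) -
        Xi c w x := by
    linarith
  rw [h4]; field_simp; ring

theorem zeta_orbit (h : Orb g p q y) (hw0 : 0 < w) (hw : w ≤ 1 / 3) (hω : 0 < Xi c w 1) (k : ℤ) :
    zeta g q c w b (y (k + 1)) = zeta g q c w b (y k) + 1 := by
  have hper : ∀ k : ℤ, Xi c w (y (k + q + 1)) - Xi c w (y (k + q)) =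
      Xi c w (y (k + 1)) - Xi c w (y k) := by
    intro k
    rw [show k + (q : ℤ) + 1 = k + 1 + q by ring, h.per, h.per, Xi_add_one hw0 hw,
        Xi_add_one hw0 hw]
    ring
  have h1 := sum_period (φ := fun k : ℤ => Xi c w (y (k + 1)) - Xi c w (y k)) h.hq h.cop hper k
  have h2 := Finset.sum_range_sub (fun j : ℕ => Xi c w (y j)) q
  simp only [Nat.cast_add, Nat.cast_one, Nat.cast_zero] at h2
  rw [show ((q : ℕ) : ℤ) = 0 + q by ring, h.per, Xi_add_one hw0 hw] at h2
  rw [h2, Finset.sum_sub_distrib] at h1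
  unfold zeta
  have e1 : ∀ i : ℕ, g^[i] (y (k + 1)) = y (k + i * p + 1) := fun i => by
    rw [h.iter]; congr 1; ring
  have e2 : ∀ i : ℕ, g^[i] (y k) = y (k + i * p) := fun i => h.iter _ _
  simp_rw [e1, e2]
  have h3 : ∑ i ∈ Finset.range q, Xi c w (y (k + i * p + 1)) =
      ∑ i ∈ Finset.range q, Xi c w (y (k + i * p)) + Xi c w 1 := by linarith
  rw [h3]; field_simp; ring

theorem deriv_zeta (hg : IsCircleDiffeoLift g) (hw0 : 0 < w) (hw : w ≤ 1 / 3) :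
    deriv (zeta g q c w b) = fun x => (Xi c w 1)⁻¹ *
      ∑ i ∈ Finset.range q, chi c w (g^[i] x) * deriv (g^[i]) x := by
  ext x
  have := ((HasDerivAt.fun_sum (u := Finset.range q) (A := fun i z => Xi c w (g^[i] z)) fun i _ =>
    (Xi_hasDerivAt (c := c) hw0 hw (g^[i] x)).comp x
      (Sm.diff (hg.iter i).sm x).hasDerivAt).const_mul (Xi c w 1)⁻¹).sub_const b
  exact this.deriv

end zeta

/-- Correction of the integral coordinate turning a shift by `p` into a shift by `p + s`
outside a single period cell. -/
def kap (p : ℤ) (q : ℕ) (s z : ℝ) : ℝ :=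
  z - s * ∑ i ∈ Finset.range q, (i : ℝ) * pbmp q (z + i * p)

section kap
variable {p : ℤ} {q : ℕ} {s : ℝ}

theorem pbmp_add_mul (hq : 3 ≤ q) (u : ℝ) (m : ℤ) : pbmp q (u + q * m) = pbmp q u := by
  have hp : Function.Periodic (pbmp q) q := pbmp_period (by positivity)
  have := hp.int_mul m u
  rwa [mul_comm] at this

theorem kap_sm (hq : 3 ≤ q) : Sm (kap p q s) := by
  have hL : (3 : ℝ) ≤ q := by exact_mod_cast hq
  exact contDiff_id.sub (contDiff_const.mul (ContDiff.sum fun i _ => contDiff_const.mul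
    ((pbmp_sm hL).comp (contDiff_id.add contDiff_const))))

theorem kap_add_q (hq : 3 ≤ q) (z : ℝ) : kap p q s (z + q) = kap p q s z + q := by
  unfold kap
  have : ∀ i : ℕ, pbmp q (z + q + i * p) = pbmp q (z + i * p) := fun i => by
    rw [← pbmp_add_mul hq (z + i * p) 1]; congr 1; push_cast; ring
  simp_rw [this]; ring

theorem kap_add_p (hq : 3 ≤ q) (hc : IsCoprime p (q : ℤ)) (z : ℝ) :
    kap p q s (z + p) = kap p q s z + p + s - s * (q * pbmp q z) := by
  have hsum : ∑ i ∈ Finset.range q, pbmp q (z + i * p) = 1 := by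
    have h1 := sum_period (φ := fun k : ℤ => pbmp q (z + k)) (by omega) hc (fun k => by
      rw [← pbmp_add_mul hq (z + k) 1]; congr 1; push_cast; ring) 0
    rw [← pbmp_sum hq z]
    push_cast at h1
    simpa using h1
  have h1 := Finset.sum_range_succ' (fun i : ℕ => (i : ℝ) * pbmp q (z + i * p)) q
  have h2 := Finset.sum_range_succ (fun i : ℕ => (i : ℝ) * pbmp q (z + i * p)) q
  rw [pbmp_add_mul hq, h1] at h2
  have h3 : ∀ i : ℕ, ((i + 1 : ℕ) : ℝ) * pbmp q (z + (i + 1 : ℕ) * p) =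
      i * pbmp q (z + p + i * p) + pbmp q (z + p + i * p) := fun i => by
    push_cast
    rw [show z + ((i : ℝ) + 1) * p = z + p + i * p by ring]; ring
  have h4 : ∑ i ∈ Finset.range q, pbmp q (z + p + i * p) = 1 := by
    have h5 := Finset.sum_range_succ' (fun i : ℕ => pbmp q (z + i * p)) q
    have h6 := Finset.sum_range_succ (fun i : ℕ => pbmp q (z + i * p)) q
    rw [pbmp_add_mul hq, h5, hsum] at h6
    have h7 : ∀ i : ℕ, pbmp q (z + (i + 1 : ℕ) * p) = pbmp q (z + p + i * p) := fun i => by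
      congr 1; push_cast; ring
    simp_rw [h7] at h6
    simp at h6
    linarith
  simp_rw [h3] at h2
  rw [Finset.sum_add_distrib, h4] at h2
  simp only [Nat.cast_zero, zero_mul, add_zero] at h2
  unfold kap
  have h8 : ∑ i ∈ Finset.range q, (i : ℝ) * pbmp q (z + p + i * p) =
    ∑ i ∈ Finset.range q, (i : ℝ) * pbmp q (z + i * p) + q * pbmp q z - 1 := by linarith
  rw [h8]; ring

theorem kap_iter (hq : 3 ≤ q) {n : ℕ} {C : ℝ} (hC : ∀ j ≤ n, ∀ x, |iteratedDeriv j bmp x| ≤ C)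
    {j : ℕ} (hj : j ≤ n) (z : ℝ) :
    |iteratedDeriv j (fun z => kap p q s z - z) z| ≤ |s| * q ^ 2 * C := by
  have hL : (3 : ℝ) ≤ q := by exact_mod_cast hq
  have hs : ∀ i : ℕ, Sm (fun z : ℝ => pbmp q (z + i * p)) := fun i =>
    (pbmp_sm hL).comp (contDiff_id.add contDiff_const)
  have hs2 : Sm (fun z => ∑ i ∈ Finset.range q, (i : ℝ) * pbmp q (z + i * p)) :=
    ContDiff.sum fun i _ => contDiff_const.mul (hs i)
  have e : (fun z => kap p q s z - z) =
      fun z => (-s) * ∑ i ∈ Finset.range q, (i : ℝ) * pbmp q (z + i * p) := by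
    ext z; unfold kap; ring
  have hC0 : 0 ≤ C := (abs_nonneg _).trans (hC 0 (by omega) 0)
  rw [e, iteratedDeriv_const_mul_field, abs_mul, abs_neg, mul_assoc]
  refine mul_le_mul_of_nonneg_left ?_ (abs_nonneg s)
  rw [iteratedDeriv_fun_sum fun i _ => Sm.at _ (contDiff_const.mul (hs i)) z]
  refine (Finset.abs_sum_le_sum_abs _ _).trans ?_
  calc _ ≤ ∑ i ∈ Finset.range q, (q : ℝ) * C := Finset.sum_le_sum fun i hi => by
        rw [iteratedDeriv_const_mul_field, abs_mul, Nat.abs_cast]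
        refine mul_le_mul (by exact_mod_cast (Finset.mem_range.1 hi).le) ?_ (abs_nonneg _)
          (by positivity)
        rw [iteratedDeriv_comp_add_const]
        obtain ⟨v, hv⟩ := pbmp_iter hL j (z + i * p)
        beta_reduce
        rw [hv]; exact hC j hj v
    _ = q ^ 2 * C := by simp; ring

theorem kap_iter_le (hq : 3 ≤ q) {n : ℕ} {C : ℝ} (hC : ∀ j ≤ n, ∀ x, |iteratedDeriv j bmp x| ≤ C)
    (hs : |s| * q ^ 2 * C ≤ 1 / 2) {j : ℕ} (h1 : 1 ≤ j) (hj : j ≤ n) (z : ℝ) :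
    |iteratedDeriv j (kap p q s) z| ≤ 2 := by
  have h := kap_iter (p := p) hq hC hj z (s := s)
  rw [iteratedDeriv_fun_sub (f := kap p q s) (g := fun z => z) (Sm.at _ (kap_sm hq) z)
      (Sm.at _ contDiff_id z)] at h
  have h2 := iteratedDeriv_id_le j h1 z
  calc _ = |(iteratedDeriv j (kap p q s) z - iteratedDeriv j (fun x => x) z) +
        iteratedDeriv j (fun x => x) z| := by rw [sub_add_cancel]
    _ ≤ _ := abs_add_le _ _
    _ ≤ 2 := by linarith

theorem deriv_kap (hq : 3 ≤ q) {n : ℕ} {C : ℝ} (hC : ∀ j ≤ n, ∀ x, |iteratedDeriv j bmp x| ≤ C)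
    (hs : |s| * q ^ 2 * C ≤ 1 / 2) (hn : 1 ≤ n) (z : ℝ) : 1 / 2 ≤ deriv (kap p q s) z := by
  have h := kap_iter (p := p) hq hC hn z (s := s)
  rw [iteratedDeriv_one, deriv_fun_sub (f := kap p q s) (g := fun z => z) (Sm.diff (kap_sm hq) z)
    differentiableAt_id] at h
  rw [deriv_id''] at h
  have := (abs_le.1 h).1
  linarith

end kap

theorem iteratedDeriv_add_const_pos {f : ℝ → ℝ} {j : ℕ} (hj : 1 ≤ j) (c x : ℝ) :
    iteratedDeriv j (fun x => f x + c) x = iteratedDeriv j f x := by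
  obtain ⟨j, rfl⟩ : ∃ i, j = i + 1 := ⟨j - 1, by omega⟩
  rw [iteratedDeriv_succ', iteratedDeriv_succ']
  congr 1
  ext z; exact deriv_add_const c

/-- The local comparison of a diffeomorphism with a conjugate of a rotation. -/
theorem conj_local (s : ℕ) : ∃ A : ℕ, ∀ P : ℝ, 2 ≤ P → ∀ η : ℝ, 0 ≤ η → ∀ g ζ κ K Ψ : ℝ → ℝ,
    ∀ b c x : ℝ, Sm g → Sm ζ → Sm κ → Sm K → Sm Ψ →
    (∀ x, 0 < deriv (fun x => κ (ζ x)) x) → (∀ x, κ (ζ (K x)) = x) → (∀ x, K (κ (ζ x)) = x) →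
    (∀ x, κ (ζ x + b) = κ (ζ x) + c - Ψ x) →
    Bd s η 1 (fun x => ζ (g x) - (ζ x + b)) x → Bd s η 1 Ψ x →
    (∀ j, 1 ≤ j → j ≤ s + 1 → ∀ z, |iteratedDeriv j κ z| ≤ P) →
    (∀ j, 1 ≤ j → j ≤ s + 1 → |iteratedDeriv j g x| ≤ P) →
    (∀ j, 1 ≤ j → j ≤ s + 1 → |iteratedDeriv j ζ x| ≤ P) →
    (∀ w ∈ Set.uIcc (κ (ζ x) + c) (κ (ζ (g x))), ∃ z, w = κ (ζ z) ∧
      (deriv (fun x => κ (ζ x)) z)⁻¹ ≤ P ∧ ∀ j, 1 ≤ j → j ≤ s + 1 → |iteratedDeriv j ζ z| ≤ P) →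
    Bd s (P ^ A * η) 1 (fun x => K (κ (ζ x) + c) - g x) x := by
  obtain ⟨A1, -, h1⟩ := inverse_bound (s + 1)
  obtain ⟨A2, h2⟩ := comp_diff s
  set e1 := (s + 1) * (s + 1) + 1 + 1 * (s + 1) with he1
  set e2 := s * s + e1 + 1 * s with he2
  set e3 := s * s + 1 + 1 * s with he3
  set e4 := e1 * A1 + e1 + e2 with he4
  refine ⟨e4 * A2 + (e3 * A2 + 1), ?_⟩
  intro P hP η hη g ζ κ K Ψ b c x hg hζ hκ hK hΨ hpos hr hl hrel hE hΨb hκb hgb hζb hw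
  have hP1 : 1 ≤ P := by linarith
  have hP2 : ∀ e : ℕ, 1 ≤ e → 2 ≤ P ^ e := fun e he => hP.trans (le_self_pow₀ hP1 (by omega))
  have hPm : ∀ {a b : ℕ}, a ≤ b → P ^ a ≤ P ^ b := fun h => pow_le_pow_right₀ hP1 h
  have hHs : Sm (fun x => κ (ζ x)) := hκ.comp hζ
  have hHb : ∀ z, (∀ j, 1 ≤ j → j ≤ s + 1 → |iteratedDeriv j ζ z| ≤ P) →
      ∀ j, 1 ≤ j → j ≤ s + 1 → |iteratedDeriv j (fun x => κ (ζ x)) z| ≤ P ^ e1 := fun z hz =>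
    comp_pow_pos (s + 1) hP 1 1 hκ hζ (fun i hi1 hi2 => by rw [pow_one]; exact hκb i hi1 hi2 _)
      (fun i hi1 hi2 => by rw [pow_one]; exact hz i hi1 hi2)
  obtain ⟨z0, hz0, -, hζg⟩ := hw (κ (ζ (g x))) Set.right_mem_uIcc
  have hz0' : g x = z0 := by rw [← hl (g x), hz0, hl]
  rw [← hz0'] at hζg
  have hHg := comp_pow_pos s hP e1 1 hHs hg (x := x)
    (fun i hi1 hi2 => hHb _ hζg i hi1 (by omega))
    (fun i hi1 hi2 => by rw [pow_one]; exact hgb i hi1 (by omega))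
  have hζgb := comp_pow_pos s hP 1 1 hζ hg (x := x)
    (fun i hi1 hi2 => by rw [pow_one]; exact hζg i hi1 (by omega))
    (fun i hi1 hi2 => by rw [pow_one]; exact hgb i hi1 (by omega))
  have hdiff := h2 (P ^ e3) (hP2 _ (by omega)) η hη κ (fun x => ζ (g x)) (fun x => ζ x + b) x hκ
    (hζ.comp hg) (hζ.add contDiff_const)
    (fun j hj1 hj2 w _ => (hκb j hj1 hj2 w).trans (le_self_pow₀ hP1 (by omega)))
    (fun j hj1 hj2 => ⟨hζgb j hj1 hj2, by
      rw [iteratedDeriv_add_const_pos hj1]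
      exact (hζb j hj1 (by omega)).trans (le_self_pow₀ hP1 (by omega))⟩) hE
  have e5 : (fun x => κ (ζ x) + c - κ (ζ (g x))) =
      fun x => -(κ (ζ (g x)) - κ (ζ x + b)) + Ψ x := by
    ext x; rw [hrel]; ring
  have hyz : Bd s (P ^ (e3 * A2 + 1) * η) 1 (fun x => κ (ζ x) + c - κ (ζ (g x))) x := by
    rw [e5]
    refine (Bd.add (((hκ.comp (hζ.comp hg)).sub (hκ.comp (hζ.add contDiff_const))).neg) hΨ
      hdiff.neg hΨb).mono ?_ (by positivity) zero_le_one le_rfl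
    rw [← pow_mul, pow_succ]
    have h1 : 1 ≤ P ^ (e3 * A2) := one_le_pow₀ hP1
    have h3 : P ^ (e3 * A2) * 2 ≤ P ^ (e3 * A2) * P := mul_le_mul_of_nonneg_left hP (by positivity)
    nlinarith
  have hfin := h2 (P ^ e4) (hP2 _ (by omega)) (P ^ (e3 * A2 + 1) * η) (by positivity) K
    (fun x => κ (ζ x) + c) (fun x => κ (ζ (g x))) x hK (hHs.add contDiff_const) (hHs.comp hg)
    (fun j hj1 hj2 w hwm => by
      obtain ⟨z, rfl, hz1, hz2⟩ := hw w hwm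
      have := h1 (P ^ e1) (hP2 _ (by omega)) (fun x => κ (ζ x)) K z hHs hK hpos hr (hl z)
        (hz1.trans (le_self_pow₀ hP1 (by omega))) (hHb z hz2) j hj1 hj2
      rw [← pow_mul] at this
      exact this.trans (hPm (by omega)))
    (fun j hj1 hj2 => ⟨by
      rw [iteratedDeriv_add_const_pos hj1]
      exact (hHb x hζb j hj1 (by omega)).trans (hPm (by omega)),
          (hHg j hj1 hj2).trans (hPm (by omega))⟩)
    hyz
  rw [← pow_mul, ← mul_assoc, ← pow_add] at hfin
  simp only [hl] at hfin
  exact hfin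

theorem chi_iter_le {c w μ C : ℝ} {n : ℕ} (hC : ∀ j ≤ n, ∀ x, |iteratedDeriv j bmp x| ≤ C)
    (hμ0 : 0 < μ) (hw : μ ^ 2 / 2 ≤ w) (hw3 : w ≤ 1 / 3) {j : ℕ} (hj : j ≤ n) (x : ℝ) :
    |iteratedDeriv j (chi c w) x| ≤ C * (2 / μ ^ 2) ^ n := by
  have hw0 : 0 < w := lt_of_lt_of_le (by positivity) hw
  obtain ⟨v, hv⟩ := chi_iter (c := c) hw0 hw3 j x
  rw [hv, abs_mul, abs_of_nonneg (by positivity), mul_comm]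
  have h1 : 1 / w ≤ 2 / μ ^ 2 := by
    rw [div_le_div_iff₀ hw0 (by positivity)]; linarith
  have h2 : 1 ≤ 2 / μ ^ 2 := by
    rw [le_div_iff₀ (by positivity)]; nlinarith
  have hC0 : 0 ≤ C := (abs_nonneg _).trans (hC j hj v)
  refine mul_le_mul (hC j hj v) ?_ (by positivity) hC0
  exact (pow_le_pow_left₀ (by positivity) h1 j).trans (pow_le_pow_right₀ h2 hj)

section
variable {g : ℝ → ℝ} {p : ℤ} {q : ℕ} {y : ℤ → ℝ}

theorem Orb.sum_deriv_iter_le (ho : Orb g p q y) {V : ℝ} (hV0 : 0 ≤ V)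
    (hV : LogLip V g) {k : ℤ} {x : ℝ}
    (hx : x ∈ Set.Icc (y k) (y (k + 1))) :
    (∑ i ∈ Finset.range q, deriv (g^[i]) x) * gap y k ≤ Real.exp (2 * V) * 2 := by
  rw [Finset.sum_mul]
  calc _ ≤ ∑ i ∈ Finset.range q, Real.exp (2 * V) * gap y (k + i * p) :=
        Finset.sum_le_sum fun i hi => ho.deriv_iter_le hV0 hV (by
          have := Finset.mem_range.1 hi; omega) hx
    _ = Real.exp (2 * V) * ∑ i ∈ Finset.range q, gap y (k + i * p) := by rw [Finset.mul_sum]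
    _ ≤ _ := mul_le_mul_of_nonneg_left (ho.sum_gap_le k (by omega)) (Real.exp_pos _).le

theorem deriv_zeta_ge (ho : Orb g p q y) {V θ c w b : ℝ} (hV0 : 0 ≤ V) (hV : LogLip V g)
    (hw0 : 0 < w) (hw : w ≤ 1 / 3) (hω : 0 < Xi c w 1) 
    (hθ : ∀ x ∈ Set.Icc (y 0) (y 1), θ ≤ chi c w x) (hmax : ∀ j, gap y j ≤ gap y 0) (x : ℝ) :
    θ * Real.exp (-(2 * V)) ≤ deriv (zeta g q c w b) x := by
  obtain ⟨k, hk⟩ := ho.exists_gap x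
  obtain ⟨i, hi, m, hm⟩ := exists_step ho.hq ho.cop k 0
  rw [deriv_zeta ho.lift hw0 hw]
  have hx1 : g^[i] x - m ∈ Set.Icc (y 0) (y 1) := by
    have := ho.mem_iter hk i
    rw [show k + 1 + i * p = 1 + q * m by linarith, hm, ho.per_int, ho.per_int] at this
    exact ⟨by linarith [this.1], by linarith [this.2]⟩
  have hper : Function.Periodic (chi c w) 1 := chi_period hw0
  have hchi : θ ≤ chi c w (g^[i] x) := by
    have := hper.sub_int_mul_eq m (x := g^[i] x)
    rw [mul_one] at this
    rw [← this]; exact hθ _ hx1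
  have hD : Real.exp (-(2 * V)) ≤ deriv (g^[i]) x := by
    have h1 := ho.le_deriv_iter hV0 hV (by omega : i ≤ 2 * q) hk
    rw [hm, ho.gap_per_int] at h1
    have h2 := hmax k
    have h3 := ho.gap_pos k
    have h4 : gap y k * 1 ≤ gap y k * (Real.exp (2 * V) * deriv (g^[i]) x) := by linarith
    have h5 := le_of_mul_le_mul_left h4 h3
    rw [Real.exp_neg]
    exact inv_le_of_inv_le₀ ((ho.lift.iter i).pos x) (by
      rw [inv_le_iff_one_le_mul₀ ((ho.lift.iter i).pos x)]; exact h5)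
  have hterm : θ * Real.exp (-(2 * V)) ≤ chi c w (g^[i] x) * deriv (g^[i]) x :=
    mul_le_mul hchi hD (Real.exp_pos _).le (chi_nonneg _)
  have hsum := Finset.single_le_sum (f := fun i => chi c w (g^[i] x) * deriv (g^[i]) x)
    (fun j _ => mul_nonneg (chi_nonneg _) ((ho.lift.iter j).pos x).le) (Finset.mem_range.2 hi)
  have hω1 : 1 ≤ (Xi c w 1)⁻¹ := (one_le_inv₀ hω).2 (Xi_one_le hw0 hw)
  have h0 : 0 ≤ ∑ i ∈ Finset.range q, chi c w (g^[i] x) * deriv (g^[i]) x :=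
    Finset.sum_nonneg fun j _ => mul_nonneg (chi_nonneg _) ((ho.lift.iter j).pos x).le
  calc _ ≤ 1 * ∑ i ∈ Finset.range q, chi c w (g^[i] x) * deriv (g^[i]) x := by
        rw [one_mul]; exact hterm.trans hsum
    _ ≤ _ := mul_le_mul_of_nonneg_right hω1 h0

end

theorem mul_inv_sq_le {T C μ : ℝ} (hC : 1 ≤ C) (hTC : T ≤ C) (hμ0 : 0 < μ) (hμ1 : μ ≤ 1) :
    T / μ ^ 2 ≤ (C / μ) ^ 3 := by
  rw [div_pow]
  rw [div_le_div_iff₀ (by positivity) (by positivity)]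
  have h1 : C ≤ C ^ 3 := le_self_pow₀ hC (by norm_num)
  have h2 : μ ^ 3 ≤ μ ^ 2 := pow_le_pow_of_le_one hμ0.le hμ1 (by norm_num)
  calc T * μ ^ 3 ≤ C ^ 3 * μ ^ 3 := by gcongr; linarith
    _ ≤ C ^ 3 * μ ^ 2 := by gcongr

/-- Polynomial bounds for the integral coordinate on long gaps. -/
theorem zeta_bd (V κ θ : ℝ) (σ : ℕ → ℝ) (hV0 : 0 ≤ V) (hκ : 0 < κ) (hθ : 0 < θ) (s : ℕ) :
    ∃ C, 2 ≤ C ∧ ∀ C', C ≤ C' → ∀ (g : ℝ → ℝ) (p : ℤ) (q : ℕ) (y : ℤ → ℝ), Orb g p q y →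
      LogLip V g → SchwBd σ g → ∀ μ : ℝ, 0 < μ → μ ≤ 1 → (∀ j, gap y j ≤ μ ^ 2) →
      ∀ c w b : ℝ, μ ^ 2 / 2 ≤ w → w ≤ 1 / 3 → θ * μ ^ 2 ≤ Xi c w 1 → ∀ k : ℤ, κ * μ ^ 2 ≤ gap y k →
      ∀ x ∈ Set.Icc (y k) (y (k + 1)), ∀ j, 1 ≤ j → j ≤ s + 1 →
        |iteratedDeriv j (zeta g q c w b) x| ≤ (C' / μ) ^ (3 * s + 7) := by
  obtain ⟨Λ, hΛ, hit⟩ := Orb.iter_bd V κ σ hV0 hκ s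
  obtain ⟨C0, hC0, hb⟩ := bmp_iter_bdd s
  set E := Real.exp (2 * V) with hE
  have hE0 : 0 < E := Real.exp_pos _
  set T := max 1 (E / κ) with hT
  have hT1 : 1 ≤ T := le_max_left _ _
  set R := (2 : ℝ) ^ s * (s.factorial * C0) with hR
  have hR0 : 0 < R := by positivity
  refine ⟨2 + T * Λ + R + 2 * E / κ + θ⁻¹, ?_, ?_⟩
  · have : 0 < T * Λ + R + 2 * E / κ + θ⁻¹ := by positivity
    linarith
  intro C hC g p q y ho hV hσ μ hμ0 hμ1 hμ c w b hw hw3 hω k hk x hx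
  have hpos1 : 0 < T * Λ := by positivity
  have hpos2 : 0 < 2 * E / κ := by positivity
  have hpos3 : 0 < θ⁻¹ := by positivity
  have hC1 : 1 ≤ C := by linarith
  have hw0 : 0 < w := lt_of_lt_of_le (by positivity) hw
  set l := T * Λ / μ with hl
  have hl0 : 0 ≤ l := by positivity
  have hΛl : Λ / μ ≤ l := by
    rw [hl]; gcongr; nlinarith
  have hΛ1 : 1 ≤ Λ / μ := by rw [le_div_iff₀ hμ0]; linarith
  have hgm : ∀ N < q, deriv (g^[N]) x ≤ T := fun N hN =>
    (ho.deriv_le_of_big hV0 hV (by omega) hμ0 hκ hμ hk hx).trans (le_max_right _ _)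
  have hDb : ∀ N < q, Bd s (deriv (g^[N]) x) l (deriv (g^[N])) x := fun N hN j hj => by
    rw [← iteratedDeriv_succ']
    refine (hit g p q y ho hV hσ μ hμ0 hμ1 hμ k hk x hx N hN.le (j + 1) (by omega)
        (by omega)).trans ?_
    have := (ho.lift.iter N).pos x
    simp only [Nat.add_sub_cancel]
    gcongr
  have hXb : ∀ N < q, Bd s (s.factorial * (C0 * (2 / μ ^ 2) ^ s)) l
      (fun x => chi c w (g^[N] x)) x := by
    intro N hN
    refine Bd.comp (chi_sm hw0 hw3) (ho.lift.iter N).sm hl0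
      (fun i hi => chi_iter_le hb hμ0 hw hw3 hi _) (fun i hi1 hi2 => ?_)
    refine (hit g p q y ho hV hσ μ hμ0 hμ1 hμ k hk x hx N hN.le i hi1 (by omega)).trans ?_
    calc _ ≤ T * (Λ / μ) ^ (i - 1) := by gcongr; exact hgm N hN
      _ ≤ T ^ i * (Λ / μ) ^ i := by
        gcongr
        · exact le_self_pow₀ hT1 (by omega)
        · omega
      _ = l ^ i := by rw [← mul_pow, hl, mul_div_assoc]
  have hprod : Bd s (∑ N ∈ Finset.range q, R * (2 / μ ^ 2) ^ s * deriv (g^[N]) x) l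
      (fun x => ∑ N ∈ Finset.range q, chi c w (g^[N] x) * deriv (g^[N]) x) x := by
    refine Bd.sum (fun N _ => ((chi_sm hw0 hw3).comp (ho.lift.iter N).sm).mul
      (Sm.deriv (ho.lift.iter N).sm)) fun N hN => ?_
    have hN := Finset.mem_range.1 hN
    have := Bd.mul ((chi_sm hw0 hw3).comp (ho.lift.iter N).sm) (Sm.deriv (ho.lift.iter N).sm)
      (hXb N hN) (hDb N hN) (by positivity) ((ho.lift.iter N).pos x).le hl0
    refine this.mono (le_of_eq ?_) ?_ hl0 le_rfl
    · rw [hR]; ring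
    · have := (ho.lift.iter N).pos x
      positivity
  rw [← Finset.mul_sum] at hprod
  have hall := hprod.const_mul (Xi c w 1)⁻¹
  have hω0 : 0 < Xi c w 1 := lt_of_lt_of_le (by positivity) hω
  intro j hj1 hj2
  obtain ⟨j, rfl⟩ : ∃ i, j = i + 1 := ⟨j - 1, by omega⟩
  rw [iteratedDeriv_succ', deriv_zeta ho.lift hw0 hw3]
  refine (hall j (by omega)).trans ?_
  have hP1 : 1 ≤ C / μ := by rw [le_div_iff₀ hμ0]; linarith
  have hS : ∑ i ∈ Finset.range q, deriv (g^[i]) x ≤ (2 * E / κ) / μ ^ 2 := by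
    have h1 := ho.sum_deriv_iter_le hV0 hV hx
    have h0 : 0 ≤ ∑ i ∈ Finset.range q, deriv (g^[i]) x :=
      Finset.sum_nonneg fun j _ => ((ho.lift.iter j).pos x).le
    rw [div_div, le_div_iff₀ (by positivity)]
    calc _ ≤ (∑ i ∈ Finset.range q, deriv (g^[i]) x) * gap y k := by gcongr
      _ ≤ _ := by linarith
  have hω' : |(Xi c w 1)⁻¹| ≤ θ⁻¹ / μ ^ 2 := by
    rw [abs_of_pos (by positivity), inv_eq_one_div, inv_eq_one_div, div_div]
    exact one_div_le_one_div_of_le (by positivity) hω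
  have hR' : R ≤ C / μ := by
    rw [le_div_iff₀ hμ0]; nlinarith
  have h2μ : 2 / μ ^ 2 ≤ (C / μ) ^ 3 := mul_inv_sq_le hC1 (by linarith) hμ0 hμ1
  have hl' : l ≤ C / μ := by rw [hl]; gcongr; linarith
  have hS0 : 0 ≤ ∑ i ∈ Finset.range q, deriv (g^[i]) x :=
      Finset.sum_nonneg fun j _ => ((ho.lift.iter j).pos x).le
  have h2μ' : (2 / μ ^ 2) ^ s ≤ (C / μ) ^ (2 * s) := by
    rw [pow_mul]
    refine pow_le_pow_left₀ (by positivity) ?_ s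
    rw [div_pow]; gcongr; nlinarith
  calc _ ≤ (C / μ) ^ 3 * (C / μ * (C / μ) ^ (2 * s) * (C / μ) ^ 3) * (C / μ) ^ s := by
        refine mul_le_mul (mul_le_mul (hω'.trans (mul_inv_sq_le hC1 (by linarith) hμ0 hμ1))
          (mul_le_mul (mul_le_mul hR' h2μ' (by positivity) (by positivity))
            (hS.trans (mul_inv_sq_le hC1 (by linarith) hμ0 hμ1)) hS0 (by positivity))
              (by positivity)
            (by positivity)) ?_ (by positivity) (by positivity)
        exact (pow_le_pow_left₀ hl0 hl' j).trans (pow_le_pow_right₀ hP1 (by omega))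
    _ = _ := by rw [← pow_succ', ← pow_add, ← pow_add, ← pow_add]; congr 1; omega

/-- The defect of the integral coordinate is tiny on hulls of long gaps. -/
theorem return_err (s : ℕ) : ∃ A : ℕ, ∀ (V κ θ : ℝ) (σ : ℕ → ℝ), 0 ≤ V → 0 < κ → 0 < θ →
    ∀ K m : ℕ, 2 ≤ K → 2 * s + m ≤ K + 2 →
    ∃ C, 2 ≤ C ∧ ∀ C', C ≤ C' → ∀ (g : ℝ → ℝ) (p : ℤ) (q : ℕ) (y : ℤ → ℝ), Orb g p q y →
      LogLip V g → SchwBd σ g → ∀ μ : ℝ, 0 < μ → μ ≤ 1 → (∀ j, gap y j ≤ μ ^ 2) →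
      ∀ c w b : ℝ, μ ^ 2 / 2 ≤ w → w ≤ 1 / 3 → θ * μ ^ 2 ≤ Xi c w 1 → ∀ a : ℤ,
      (∀ i : ℕ, i < K → κ * μ ^ 2 ≤ gap y (a + i)) →
      ∀ x ∈ Set.Icc (y a) (y (a + K)),
        Bd s ((C' / μ) ^ A * μ ^ m) 1 (fun x => zeta g q c w b (g x) -
          (zeta g q c w b x + p)) x := by
  obtain ⟨A0, hA0⟩ := comp_diff s
  refine ⟨3 + ((2 * s + 2) * A0 + 1), ?_⟩
  intro V κ θ σ hV0 hκ hθ K m hK hm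
  obtain ⟨Λ, hΛ, hit⟩ := Orb.iter_bd V κ σ hV0 hκ s
  obtain ⟨Λ', hΛ', hflat⟩ := Orb.flat V κ σ hV0 hκ K hK
  obtain ⟨C0, hC0, hb⟩ := bmp_iter_bdd s
  set E := Real.exp (2 * V) with hE
  have hE0 : 0 < E := Real.exp_pos _
  set T := max 1 (E / κ) with hT
  have hT1 : 1 ≤ T := le_max_left _ _
  refine ⟨2 + T * Λ + C0 + Λ' + θ⁻¹, ?_, ?_⟩
  · have : 0 < T * Λ + C0 + Λ' + θ⁻¹ := by positivity
    linarith
  intro C hC g p q y ho hV hσ μ hμ0 hμ1 hμ c w b hw hw3 hω a ha x hx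
  have hpos1 : 0 < T * Λ := by positivity
  have hpos3 : 0 < θ⁻¹ := by positivity
  have hC1 : 1 ≤ C := by linarith
  have hw0 : 0 < w := lt_of_lt_of_le (by positivity) hw
  have hω0 : 0 < Xi c w 1 := lt_of_lt_of_le (by positivity) hω
  have hP2 : 2 ≤ C / μ := by rw [le_div_iff₀ hμ0]; linarith
  have hP1 : 1 ≤ C / μ := by linarith
  obtain ⟨i, hi, hxi⟩ : ∃ i : ℕ, i < K ∧ x ∈ Set.Icc (y (a + i)) (y (a + i + 1)) := by
    obtain ⟨k, hk⟩ := ho.exists_gap x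
    rcases lt_trichotomy x (y (a + K)) with h | h | h
    · by_cases hka : k < a
      · have : x = y a := le_antisymm (hk.2.trans (ho.mono.monotone (by omega))) hx.1
        exact ⟨0, by omega, by
          rw [this]; exact ⟨ho.mono.monotone (by simp), ho.mono.monotone (by simp)⟩⟩
      · have hkK : k < a + K := ho.mono.lt_iff_lt.1 (hk.1.trans_lt h)
        refine ⟨(k - a).toNat, by omega, ?_⟩
        rw [show a + ((k - a).toNat : ℤ) = k by omega]; exact hk
    · refine ⟨K - 1, by omega, ?_⟩
      rw [h]
      exact ⟨ho.mono.monotone (by omega), ho.mono.monotone (by omega)⟩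
    · exact absurd hx.2 (not_le.2 h)
  have hΛ1 : 1 ≤ Λ / μ := by rw [le_div_iff₀ hμ0]; linarith
  set B := (C / μ) ^ (2 * s + 2) with hB
  have hB2 : 2 ≤ B := hP2.trans (le_self_pow₀ hP1 (by omega))
  have hpow : ∀ e, e ≤ 2 * s + 2 → (C / μ) ^ e ≤ B := fun e he => pow_le_pow_right₀ hP1 he
  have h2μ' : (2 / μ ^ 2) ^ s ≤ (C / μ) ^ (2 * s) := by
    rw [pow_mul]
    refine pow_le_pow_left₀ (by positivity) ?_ s
    rw [div_pow]; gcongr; nlinarith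
  have hmain := hA0 B hB2 (Λ' * μ ^ m) (by positivity) (Xi c w) (fun x => g^[q] x - p)
      (fun x => x) x
    (Xi_sm hw0 hw3) ((ho.lift.iter q).sm.sub contDiff_const) contDiff_id
    (fun j hj1 hj2 z _ => by
      obtain ⟨j, rfl⟩ : ∃ i, j = i + 1 := ⟨j - 1, by omega⟩
      rw [iteratedDeriv_succ', deriv_Xi hw0 hw3]
      refine (chi_iter_le hb hμ0 hw hw3 (by omega) _).trans ?_
      calc _ ≤ C / μ * (C / μ) ^ (2 * s) := by
            refine mul_le_mul ?_ h2μ' (by positivity) (by positivity)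
            rw [le_div_iff₀ hμ0]; nlinarith
        _ = (C / μ) ^ (2 * s + 1) := by rw [← pow_succ']
        _ ≤ B := hpow _ (by omega))
    (fun j hj1 hj2 => ⟨by
      have e : (fun x => g^[q] x - (p : ℝ)) = fun x => g^[q] x + (-(p : ℝ)) := by ext; ring
      rw [e, iteratedDeriv_add_const_pos hj1]
      refine (hit g p q y ho hV hσ μ hμ0 hμ1 hμ _ (ha i hi) x hxi q le_rfl j hj1
          (by omega)).trans ?_
      calc _ ≤ T * (Λ / μ) ^ (j - 1) := by
            gcongr
            exact (ho.deriv_le_of_big hV0 hV (by omega) hμ0 hκ hμ (ha i hi) hxi).trans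
                (le_max_right _ _)
        _ ≤ T ^ j * (Λ / μ) ^ j := by
          gcongr
          · exact le_self_pow₀ hT1 (by omega)
          · omega
        _ = (T * Λ / μ) ^ j := by rw [← mul_pow, mul_div_assoc]
        _ ≤ (C / μ) ^ j := by gcongr; linarith
        _ ≤ B := hpow _ (by omega), (iteratedDeriv_id_le j hj1 x).trans (by linarith)⟩)
    (fun j hj => by
      rw [one_pow, mul_one]
      exact hflat g p q y ho hV hσ μ hμ0 hμ1 hμ a ha x hx j m (by omega))
  have e : (fun x => zeta g q c w b (g x) - (zeta g q c w b x + p)) =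
      fun x => (Xi c w 1)⁻¹ * (Xi c w (g^[q] x - p) - Xi c w x) := by
    ext x; rw [zeta_map hw0 hw3 hω0 p]; ring
  rw [e]
  refine (hmain.const_mul (Xi c w 1)⁻¹).mono ?_ (by positivity) zero_le_one le_rfl
  have hω' : |(Xi c w 1)⁻¹| ≤ θ⁻¹ / μ ^ 2 := by
    rw [abs_of_pos (by positivity), inv_eq_one_div, inv_eq_one_div, div_div]
    exact one_div_le_one_div_of_le (by positivity) hω
  have hΛC : Λ' ≤ C / μ := by
    rw [le_div_iff₀ hμ0]; nlinarith
  calc _ ≤ (C / μ) ^ 3 * (B ^ A0 * (C / μ * μ ^ m)) := by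
        gcongr
        exact hω'.trans (mul_inv_sq_le hC1 (by linarith) hμ0 hμ1)
    _ = _ := by rw [hB, ← pow_mul, pow_add, pow_succ ((C / μ))]; ring

section
variable {g : ℝ → ℝ} {p : ℤ} {q : ℕ} {y : ℤ → ℝ}

theorem Orb.exists_gap_mem (ho : Orb g p q y) {a : ℤ} {K : ℕ} (hK : 0 < K) {x : ℝ}
    (hx : x ∈ Set.Icc (y a) (y (a + K))) :
    ∃ i : ℕ, i < K ∧ x ∈ Set.Icc (y (a + i)) (y (a + i + 1)) := by
  obtain ⟨k, hk⟩ := ho.exists_gap x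
  rcases lt_trichotomy x (y (a + K)) with h | h | h
  · by_cases hka : k < a
    · have : x = y a := le_antisymm (hk.2.trans (ho.mono.monotone (by omega))) hx.1
      exact ⟨0, by omega, by
        rw [this]; exact ⟨ho.mono.monotone (by simp), ho.mono.monotone (by simp)⟩⟩
    · have hkK : k < a + K := ho.mono.lt_iff_lt.1 (hk.1.trans_lt h)
      refine ⟨(k - a).toNat, by omega, ?_⟩
      rw [show a + ((k - a).toNat : ℤ) = k by omega]; exact hk
  · refine ⟨K - 1, by omega, ?_⟩
    rw [h]
    exact ⟨ho.mono.monotone (by omega), ho.mono.monotone (by omega)⟩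
  · exact absurd hx.2 (not_le.2 h)

/-- A bump supported near the longest gap and bounded below on it. -/
theorem bump_geom {V : ℝ} (hV0 : 0 ≤ V) : ∃ θ, 0 < θ ∧ ∀ (g : ℝ → ℝ) (p : ℤ) (q : ℕ) (y : ℤ → ℝ),
    Orb g p q y → LogLip V g → (∀ j, gap y j ≤ gap y 0) → gap y 0 ≤ 2 / 9 →
    ∃ c w : ℝ, gap y 0 / 2 ≤ w ∧ w ≤ 1 / 3 ∧ (∀ x ∈ Set.Icc (y 0) (y 1), θ ≤ chi c w x) ∧
      θ * gap y 0 ≤ Xi c w 1 ∧ ∀ x ∈ Set.Icc (y 2) (y (q - 1)), chi c w x = 0 := by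
  set E := Real.exp (2 * V) ^ 2 with hE
  have hE1 : 1 ≤ E := one_le_pow₀ (Real.one_le_exp (by positivity))
  have hE0 : 0 < E := by linarith
  set ρ := (1 / 2) / (1 / 2 + 1 / E) with hρ
  have hρ0 : 0 ≤ ρ := by positivity
  have hE2 : 0 < 1 / E := by positivity
  have hE3 : 1 / E ≤ 1 := by rw [div_le_one hE0]; exact hE1
  have hρ1 : ρ < 1 := by rw [hρ, div_lt_one (by positivity)]; linarith
  obtain ⟨θ, hθ, hb⟩ := bmp_lower hρ0 hρ1
  refine ⟨θ, hθ, fun g p q y ho hV hmax hM => ?_⟩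
  set M := gap y 0 with hMd
  have hM0 : 0 < M := ho.gap_pos 0
  have hy1 : y 1 = y 0 + M := by rw [hMd]; unfold gap; simp
  have hg1 : M ≤ E * (y 2 - y 1) := (ho.gap_adj hV0 hV 0).1
  have hg2 : M ≤ E * (y 0 - y (-1)) := by
    have := (ho.gap_adj hV0 hV (-1)).2
    rw [neg_add_cancel] at this
    unfold gap at this
    rwa [neg_add_cancel] at this
  have hd1 : M * (1 / E) ≤ y 2 - y 1 := by rw [mul_one_div, div_le_iff₀ hE0]; linarith
  have hd2 : M * (1 / E) ≤ y 0 - y (-1) := by rw [mul_one_div, div_le_iff₀ hE0]; linarith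
  have hME : M * (1 / E) ≤ M := by nlinarith
  have hw0 : 0 < M * (1 / 2 + 1 / E) := by positivity
  have hw3 : M * (1 / 2 + 1 / E) ≤ 1 / 3 := by nlinarith
  have hchi : ∀ x ∈ Set.Icc (y 0) (y 1), θ ≤ chi ((y 0 + y 1) / 2) (M * (1 / 2 + 1 / E)) x := by
    intro x hx
    refine chi_ge hw0 hw3 hρ1 hb (m := 0) ?_
    have : ρ * (M * (1 / 2 + 1 / E)) = M / 2 := by rw [hρ]; field_simp
    rw [this, abs_le]
    push_cast
    constructor <;> linarith [hx.1, hx.2]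
  refine ⟨(y 0 + y 1) / 2, M * (1 / 2 + 1 / E), by nlinarith, hw3, hchi, ?_, fun x hx => ?_⟩
  · have h1 := Xi_slope hw0 hw3 (by linarith : y 0 ≤ y 1) hchi
    have hq1 : y 1 ≤ y 0 + 1 := by
      rw [← ho.per, zero_add]; exact ho.mono.monotone (by have := ho.hq; omega)
    have h2 := Xi_mono (c := (y 0 + y 1) / 2) hw0 hw3 hq1
    rw [Xi_add_one hw0 hw3] at h2
    rw [hy1] at h1 h2 ⊢
    ring_nf at h1 h2 ⊢
    linarith
  · have hyq : y (q - 1) = y (-1) + 1 := by rw [← ho.per]; congr 1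
    refine chi_eq_zero hw0 fun m => ?_
    have h1 := hx.1
    have h2 := hx.2
    rcases le_or_gt m 0 with hm | hm
    · have : (m : ℝ) ≤ 0 := by exact_mod_cast hm
      rw [le_abs]; left; linarith
    · have : (1 : ℝ) ≤ m := by exact_mod_cast hm
      rw [le_abs]; right; linarith

end

theorem CrClose_of_periodic {r : ℕ} {ε a : ℝ} {f g : ℝ → ℝ} (hf : ∀ x, f (x + 1) = f x + 1)
    (hg : ∀ x, g (x + 1) = g x + 1)
    (h : ∀ i ≤ r, ∀ x ∈ Set.Ico a (a + 1), |iteratedDeriv i (fun x => f x - g x) x| ≤ ε) :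
    CrClose r ε f g := by
  intro i hi x
  have hper : Function.Periodic (iteratedDeriv i (fun x => f x - g x)) 1 :=
    iteratedDeriv_periodic (fun x => by rw [hf, hg]; ring) i
  obtain ⟨z, hz, hxz⟩ := hper.exists_mem_Ico one_pos x a
  rw [hxz]; exact h i hi z hz

set_option maxHeartbeats 1600000 in
/-- Near-periodic diffeomorphisms with long orbit gaps are close to conjugates of rotations. -/
theorem close_conj (s : ℕ) : ∃ m : ℕ, ∀ (V Bg : ℝ) (σ : ℕ → ℝ), 0 ≤ V → 1 ≤ Bg →
    ∃ C μ₀ : ℝ, 0 < μ₀ ∧ ∀ (g : ℝ → ℝ) (p : ℤ) (q : ℕ) (y : ℤ → ℝ) (τ μ : ℝ), Orb g p q y →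
      LogLip V g → SchwBd σ g → (∀ x, (deriv g x)⁻¹ ≤ Bg) →
      (∀ j, 1 ≤ j → j ≤ s + 1 → ∀ x, |iteratedDeriv j g x| ≤ Bg) →
      (∀ j, gap y j ≤ gap y 0) → 0 < μ → μ ≤ μ₀ → gap y 0 = μ ^ 2 →
      |q * τ - p| * q ^ 2 ≤ μ ^ (m + 1) →
      ∃ h, IsCircleDiffeoLift h ∧ CrClose s (C * μ) (fun x => Function.invFun h (h x + τ)) g := by
  obtain ⟨A2, hA2⟩ := return_err s
  obtain ⟨A3, hA3⟩ := conj_local s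
  set a1 := 3 * s + 7 with ha1
  set e := a1 * A3 + (A2 + 1 + a1 * s) with he
  refine ⟨e + 1, ?_⟩
  intro V Bg σ hV0 hBg
  set K := 2 * s + (e + 1) + 3 with hK
  set E := Real.exp (2 * V) with hE
  have hE0 : 0 < E := Real.exp_pos _
  have hE1 : 1 ≤ E := Real.one_le_exp (by positivity)
  set κ := (E ^ (2 * K) * Bg)⁻¹ with hκ
  have hκ0 : 0 < κ := by positivity
  obtain ⟨θ, hθ0, hgeom⟩ := bump_geom hV0
  obtain ⟨C1, hC1, hz⟩ := zeta_bd V κ θ σ hV0 hκ0 hθ0 s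
  obtain ⟨C2, hC2, hret⟩ := hA2 V κ θ σ hV0 hκ0 hθ0 K (e + 1) (by omega) (by omega)
  obtain ⟨C0, hC0, hb⟩ := bmp_iter_bdd (s + 1)
  set C := C1 + C2 + s.factorial * C0 + Bg + 2 * E / θ with hC
  have hp1 : 0 < s.factorial * C0 := by positivity
  have hp2 : 0 < 2 * E / θ := by positivity
  refine ⟨C ^ e, min (1 / 3) (1 / (2 * C0)), by positivity, ?_⟩
  intro g p q y τ μ ho hV hσ hgi hgb hmax hμ0 hμ₀ hgap hs''
  have hμ3 : μ ≤ 1 / 3 := hμ₀.trans (min_le_left _ _)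
  have hμC : μ ≤ 1 / (2 * C0) := hμ₀.trans (min_le_right _ _)
  have hμ1 : μ ≤ 1 := by linarith
  have hM : gap y 0 ≤ 2 / 9 := by rw [hgap]; nlinarith
  have hmax' : ∀ j, gap y j ≤ μ ^ 2 := fun j => (hmax j).trans hgap.le
  have hq : 3 ≤ q := by
    have h1 := ho.sum_gap
    have h2 : ∑ j ∈ Finset.range q, gap y j ≤ ∑ j ∈ Finset.range q, (2 / 9 : ℝ) :=
      Finset.sum_le_sum fun j _ => (hmax j).trans hM
    rw [h1] at h2
    simp only [Finset.sum_const, Finset.card_range, nsmul_eq_mul] at h2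
    have : (3 : ℝ) ≤ q := by linarith
    exact_mod_cast this
  have hq3 : (3 : ℝ) ≤ q := by exact_mod_cast hq
  have hq0 : (0 : ℝ) < q := by linarith
  obtain ⟨c, w, hw, hw3, hchi, hω, hchi0⟩ := hgeom g p q y ho hV hmax hM
  rw [hgap] at hw hω
  have hw0 : 0 < w := lt_of_lt_of_le (by positivity) hw
  have hω0 : 0 < Xi c w 1 := lt_of_lt_of_le (by positivity) hω
  have hg := ho.lift
  -- the coordinate
  set b := (Xi c w 1)⁻¹ * ∑ i ∈ Finset.range q, Xi c w (g^[i] (y 0)) with hbd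
  set ζ := zeta g q c w b with hζ
  have hζs : Sm ζ := zeta_sm hg hw0 hw3
  have hζy : ∀ k : ℤ, ζ (y k) = k := by
    intro k
    induction k using Int.induction_on with
    | zero => simp [hζ, zeta, hbd]
    | succ k ih =>
      rw [hζ, zeta_orbit ho hw0 hw3 hω0, ← hζ, ih]; push_cast; ring
    | pred k ih =>
      have := zeta_orbit (b := b) ho hw0 hw3 hω0 (-k - 1)
      rw [sub_add_cancel, ← hζ, ih] at this
      push_cast at this ⊢; linarith
  have hζd : ∀ x, θ * E⁻¹ ≤ deriv ζ x := fun x => by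
    rw [hE, ← Real.exp_neg]
    exact deriv_zeta_ge ho hV0 hV hw0 hw3 hω0 hchi hmax x
  have hζ0 : ∀ x, 0 < deriv ζ x := fun x => lt_of_lt_of_le (by positivity) (hζd x)
  have hζm : StrictMono ζ := strictMono_of_deriv_pos hζ0
  set s'' := q * τ - p with hs2
  set kp := kap p q s'' with hkp
  have hq2 : |s''| * q ^ 2 ≤ μ := hs''.trans (pow_le_of_le_one hμ0.le hμ1 (by omega))
  have hsC : |s''| * q ^ 2 * C0 ≤ 1 / 2 := by
    calc _ ≤ 1 / (2 * C0) * C0 := by gcongr; exact hq2.trans hμC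
      _ = 1 / 2 := by field_simp
  have hks : Sm kp := kap_sm hq
  have hkd : ∀ z, 1 / 2 ≤ deriv kp z := fun z => deriv_kap hq hb hsC (by omega) z
  have hkm : StrictMono kp := strictMono_of_deriv_pos fun z => by linarith [hkd z]
  have hkb : ∀ j, 1 ≤ j → j ≤ s + 1 → ∀ z, |iteratedDeriv j kp z| ≤ 2 := fun j h1 h2 z =>
    kap_iter_le hq hb hsC h1 h2 z
  have hHs : Sm (fun x => kp (ζ x)) := hks.comp hζs
  have hHd : ∀ x, 1 / 2 * (θ * E⁻¹) ≤ deriv (fun x => kp (ζ x)) x := fun x => by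
    rw [deriv_comp_sm hks hζs]
    exact mul_le_mul (hkd _) (hζd x) (by positivity) (by linarith [hkd (ζ x)])
  have hH0 : ∀ x, 0 < deriv (fun x => kp (ζ x)) x := fun x => lt_of_lt_of_le (by positivity) (hHd x)
  have hHm : StrictMono (fun x => kp (ζ x)) := strictMono_of_deriv_pos hH0
  have hh : IsCircleDiffeoLift (fun x => (q : ℝ)⁻¹ * kp (ζ x)) := by
    refine ⟨contDiff_const.mul hHs, fun x => ?_, fun x => ?_⟩
    · simp only
      rw [hζ, zeta_add_one hg hw0 hw3 hω0, hkp, kap_add_q hq, mul_add, inv_mul_cancel₀ hq0.ne']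
    · rw [deriv_const_mul _ (Sm.diff hHs x)]
      have := hH0 x
      positivity
  set h : ℝ → ℝ := fun x => (q : ℝ)⁻¹ * kp (ζ x) with hhd
  set Kf : ℝ → ℝ := fun z => Function.invFun h ((q : ℝ)⁻¹ * z) with hKf
  have hKs : Sm Kf := hh.inv_sm.comp (contDiff_const.mul contDiff_id)
  have hl : ∀ x, Kf (kp (ζ x)) = x := fun x => hh.inv_apply x
  have hr : ∀ x, kp (ζ (Kf x)) = x := fun x => by
    have := hh.apply_inv ((q : ℝ)⁻¹ * x)
    exact mul_left_cancel₀ (inv_ne_zero hq0.ne') this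
  have hf : (fun x => Function.invFun h (h x + τ)) = fun x => Kf (kp (ζ x) + q * τ) := by
    ext x
    simp only [hKf, hhd]
    congr 1; field_simp
  refine ⟨h, hh, ?_⟩
  -- the relation satisfied by the corrected coordinate
  set Ψ : ℝ → ℝ := fun x => s'' * (q * pbmp q (ζ x)) with hΨ
  have hΨs : Sm Ψ := contDiff_const.mul (contDiff_const.mul ((pbmp_sm hq3).comp hζs))
  have hrel : ∀ x, kp (ζ x + p) = kp (ζ x) + q * τ - Ψ x := fun x => by
    rw [hkp, kap_add_p hq ho.cop]; simp only [hΨ, hs2]; ring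
  have hs1 : |s''| * q ≤ 1 / 2 := by
    have h1 : |s''| * q ≤ |s''| * q ^ 2 := by
      gcongr; exact le_self_pow₀ (by linarith) (by norm_num)
    linarith
  have hΨ2 : ∀ x, |Ψ x| ≤ 1 / 2 := fun x => by
    simp only [hΨ]
    rw [abs_mul, abs_mul, abs_of_pos hq0, abs_of_nonneg (pbmp_nonneg _ _), ← mul_assoc]
    calc _ ≤ |s''| * q * 1 := by gcongr; exact pbmp_le_one _ _
      _ ≤ _ := by linarith
  have hbig : ∀ k : ℤ, |k| ≤ K → κ * μ ^ 2 ≤ gap y k ∧ κ * μ ^ 2 ≤ gap y (k + p) := by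
    intro k hk
    have h1 := ho.gap_near hV0 hV 0 K k hk
    rw [hgap, zero_add, ← hE] at h1
    have h2 : κ * μ ^ 2 * Bg ≤ gap y k := by
      rw [hκ, mul_inv]
      calc _ = (E ^ (2 * K))⁻¹ * μ ^ 2 := by field_simp
        _ ≤ (E ^ (2 * K))⁻¹ * (E ^ (2 * K) * gap y k) := by gcongr
        _ = _ := by field_simp
    have h3 : κ * μ ^ 2 ≤ κ * μ ^ 2 * Bg := le_mul_of_one_le_right (by positivity) hBg
    refine ⟨h3.trans h2, ?_⟩
    obtain ⟨u, -, hu⟩ := ho.exists_deriv_eq 1 (lt_add_one k)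
    rw [Function.iterate_one] at hu
    have h4 : deriv g u * gap y k = gap y (k + p) := by
      unfold gap; rw [hu]; congr 2 <;> push_cast <;> ring
    have h5 : Bg⁻¹ ≤ deriv g u := inv_le_of_inv_le₀ (hg.pos u) (hgi u)
    rw [← h4]
    calc _ = Bg⁻¹ * (κ * μ ^ 2 * Bg) := by field_simp
      _ ≤ _ := by
        have := hg.pos u
        gcongr
  set P := C / μ with hP
  have hCμ : C ≤ P := by rw [hP, le_div_iff₀ hμ0]; nlinarith
  have hP2 : 2 ≤ P := by linarith
  have hP1 : 1 ≤ P := by linarith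
  have hPa : P ≤ P ^ a1 := le_self_pow₀ hP1 (by omega)
  set η := P ^ (A2 + 1 + a1 * s) * μ ^ (e + 1) with hη
  have hfinal : (P ^ a1) ^ A3 * η = C ^ e * μ := by
    have h1 : (P ^ a1) ^ A3 * P ^ (A2 + 1 + a1 * s) = P ^ e := by
      rw [← pow_mul, ← pow_add, he]
    rw [hη, ← mul_assoc, h1, hP, div_pow, pow_succ]
    field_simp
  have hζloc : ∀ (a : ℤ) (n : ℕ) (x : ℝ), 0 < n → (∀ i : ℕ, i < n → κ * μ ^ 2 ≤ gap y (a + i)) →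
      x ∈ Set.Icc (y a) (y (a + n)) → ∀ j, 1 ≤ j → j ≤ s + 1 → |iteratedDeriv j ζ x| ≤ P ^ a1 := by
    intro a n x hn ha hx
    obtain ⟨i, hi, hxi⟩ := ho.exists_gap_mem hn hx
    exact hz C (by linarith) g p q y ho hV hσ μ hμ0 hμ1 hmax' c w b hw hw3 hω _ (ha i hi) x hxi
  refine CrClose_of_periodic (a := y (-1)) (hh.conj τ).2.1 hg.2.1 fun i hi x hx => ?_
  rw [show (fun x => Function.invFun h (h x + τ) - g x) =
      fun x => Kf (kp (ζ x) + q * τ) - g x from by ext x; exact congrArg (· - g x) (congrFun hf x)]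
  rcases le_or_gt x (y 2) with hx2 | hx2
  · have hxJ : x ∈ Set.Icc (y (-1)) (y 2) := ⟨hx.1, hx2⟩
    have hζx := hζloc (-1) 3 x (by norm_num) (fun i hi => (hbig _ (by rw [abs_le]; omega)).1) hxJ
    have hζxI : ζ x ∈ Set.Icc (-1 : ℝ) 2 := by
      have h1 := hζm.monotone hxJ.1
      have h2 := hζm.monotone hxJ.2
      rw [hζy] at h1 h2
      push_cast at h1 h2
      exact ⟨h1, h2⟩
    have hgx := ho.mem_iter hxJ 1
    rw [Function.iterate_one] at hgx
    have hmain := hA3 (P ^ a1) (hP2.trans hPa) η (by positivity) g ζ kp Kf Ψ p (q * τ) x hg.sm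
        hζs hks hKs
      hΨs hH0 hr hl hrel
      ((hret C (by linarith) g p q y ho hV hσ μ hμ0 hμ1 hmax' c w b hw hw3 hω (-1)
        (fun i hi => (hbig _ (by rw [abs_le]; omega)).1) x
        ⟨hxJ.1, hxJ.2.trans (ho.mono.monotone (by omega))⟩).mono (by
          rw [hη]
          exact mul_le_mul_of_nonneg_right (pow_le_pow_right₀ hP1 (by omega)) (by positivity))
              (by positivity) zero_le_one le_rfl)
      (by
        have h1 := Bd.comp (s := s) (C := C0) (l := P ^ a1) (x := x) (f := pbmp q) (pbmp_sm hq3) hζs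
          (by positivity) (fun i hi => by
            obtain ⟨v, hv⟩ := pbmp_iter hq3 i (ζ x)
            rw [hv]; exact hb i (by omega) v)
          (fun i h1 h2 => (hζx i h1 (by omega)).trans (le_self_pow₀ (hP1.trans hPa) (by omega)))
        have h2 := h1.const_mul (s'' * q)
        intro j hj
        have h3 := h2 j hj
        have e1 : Ψ = fun x => s'' * q * pbmp q (ζ x) := by ext; simp only [hΨ]; ring
        rw [e1, one_pow, mul_one]
        refine h3.trans ?_
        have h4 : |s'' * q| ≤ μ ^ (e + 1) := by
          rw [abs_mul, Nat.abs_cast]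
          calc _ ≤ |s''| * q ^ 2 := by
                gcongr; exact le_self_pow₀ (by linarith) (by norm_num)
            _ ≤ μ ^ (e + 1 + 1) := hs''
            _ ≤ μ ^ (e + 1) := pow_le_pow_of_le_one hμ0.le hμ1 (by omega)
        calc _ ≤ μ ^ (e + 1) * P * (P ^ a1) ^ s := by
              refine mul_le_mul (mul_le_mul h4 (by linarith) hp1.le (by positivity)) ?_
                  (by positivity)
                (by positivity)
              exact pow_le_pow_right₀ (hP1.trans hPa) hj
          _ = P ^ (1 + a1 * s) * μ ^ (e + 1) := by rw [← pow_mul, pow_add P 1, pow_one]; ring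
          _ ≤ η := by
            rw [hη]
            exact mul_le_mul_of_nonneg_right (pow_le_pow_right₀ hP1 (by omega)) (by positivity))
      (fun j h1 h2 z => (hkb j h1 h2 z).trans (hP2.trans hPa))
      (fun j h1 h2 => (hgb j h1 h2 x).trans (le_trans (by linarith) hPa)) hζx
      (fun w' hw' => by
        refine ⟨Kf w', (hr w').symm, ?_, ?_⟩
        · have h1 := hHd (Kf w')
          calc _ ≤ (1 / 2 * (θ * E⁻¹))⁻¹ := inv_anti₀ (by positivity) h1
            _ = 2 * E / θ := by field_simp
            _ ≤ P := by linarith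
            _ ≤ _ := hPa
        · refine hζloc (p - 2) 5 _ (by norm_num) (fun i hi => ?_) ?_
          · have := (hbig (-2 + i) (by rw [abs_le]; omega)).2
            rwa [show -2 + (i : ℤ) + p = p - 2 + i by ring] at this
          · have hk1 : ∀ a b : ℝ, a ≤ b → 1 / 2 * (b - a) ≤ kp b - kp a := fun a b hab => by
              refine (convex_Icc a b).mul_sub_le_image_sub_of_le_deriv hks.continuous.continuousOn
                (Sm.diff hks).differentiableOn (fun z _ => hkd z) a ⟨le_rfl, hab⟩ b
                  ⟨hab, le_rfl⟩ hab
            have hlow : kp (p - 2) ≤ min (kp (ζ x) + q * τ) (kp (ζ (g x))) := by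
              refine le_min ?_ ?_
              · have h1 := hrel x
                have h2 := hk1 (p - 2) (ζ x + p) (by linarith [hζxI.1])
                have h3 := (abs_le.1 (hΨ2 x)).1
                have h4 := hζxI.1
                linarith
              · refine hkm.monotone ?_
                have := hζm.monotone hgx.1
                rw [hζy] at this; push_cast at this; linarith
            have hup : max (kp (ζ x) + q * τ) (kp (ζ (g x))) ≤ kp (p + 3) := by
              refine max_le ?_ ?_
              · have h1 := hrel x
                have h2 := hk1 (ζ x + p) (p + 3) (by linarith [hζxI.2])
                have h3 := (abs_le.1 (hΨ2 x)).2
                have h4 := hζxI.2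
                linarith
              · refine hkm.monotone ?_
                have := hζm.monotone hgx.2
                rw [hζy] at this; push_cast at this; linarith
            have hw1 := hlow.trans hw'.1
            have hw2 := hw'.2.trans hup
            rw [← hr w'] at hw1 hw2
            have h1 := hkm.le_iff_le.1 hw1
            have h2 := hkm.le_iff_le.1 hw2
            constructor
            · refine hζm.le_iff_le.1 ?_
              rw [hζy]; push_cast; exact h1
            · refine hζm.le_iff_le.1 ?_
              rw [hζy]; push_cast; linarith)
    have := hmain i hi
    rwa [one_pow, mul_one, hfinal] at this
  · have hyq : y (q - 1) = y (-1) + 1 := by rw [← ho.per]; congr 1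
    have hC : 0 ≤ C ^ e * μ := by positivity
    have hev : (fun x => Kf (kp (ζ x) + q * τ) - g x) =ᶠ[𝓝 x] fun _ => 0 := by
      filter_upwards [Ioo_mem_nhds hx2 (by rw [hyq]; exact hx.2 : x < y (q - 1))] with z hz
      have hz' : z ∈ Set.Icc (y 2) (y (q - 1)) := Set.Ioo_subset_Icc_self hz
      have hζ2 : (2 : ℝ) ≤ ζ z := by
        have := hζm.monotone hz'.1; rw [hζy] at this; exact_mod_cast this
      have hζq : ζ z ≤ q - 1 := by
        have := hζm.monotone hz'.2; rw [hζy] at this; push_cast at this; exact this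
      have hΨ0 : Ψ z = 0 := by
        have : pbmp q (ζ z) = 0 := pbmp_eq_zero fun m => by
          rcases le_or_gt m 0 with hm | hm
          · have hm' : (m : ℝ) ≤ 0 := by exact_mod_cast hm
            have := mul_nonpos_of_nonpos_of_nonneg hm' hq0.le; rw [le_abs]; left; nlinarith
          · have hm' : (1 : ℝ) ≤ m := by exact_mod_cast hm
            have := le_mul_of_one_le_left hq0.le hm'; rw [le_abs]; right; nlinarith
        simp [hΨ, this]
      have hF : g^[q] z - p ∈ Set.Icc (y 2) (y (q - 1)) := by
        have hmo := (hg.iter q).strictMono.monotone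
        have h1 := hmo hz'.1
        have h2 := hmo hz'.2
        rw [ho.map_pow_q] at h1 h2
        exact ⟨by linarith, by linarith⟩
      have hE0 := zeta_map (b := b) (g := g) (q := q) hw0 hw3 hω0 p z
      rw [Xi_const hw0 hw3 hchi0 hF hz', sub_self, mul_zero, add_zero] at hE0
      have h3 := hrel z
      rw [hΨ0, sub_zero, ← hE0] at h3
      rw [← h3, hl, sub_self]
    rw [hev.iteratedDeriv_eq, iteratedDeriv_const]
    split_ifs <;> simpa using hC

theorem exists_logLip {g : ℝ → ℝ} (hg : IsCircleDiffeoLift g) : ∃ V, 0 ≤ V ∧ LogLip V g := by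
  obtain ⟨C, hC⟩ := periodic_bdd (nonlin_sm hg).continuous (nonlin_periodic hg)
  refine ⟨C, (abs_nonneg _).trans (hC 0), fun u v => ?_⟩
  have h := Convex.norm_image_sub_le_of_norm_hasDerivWithin_le (f := fun x => Real.log (deriv g x))
    (f' := nonlin g) (C := C) (s := Set.univ) (x := v) (y := u) (fun x _ => ?_)
    (fun x _ => hC x) convex_univ (Set.mem_univ _) (Set.mem_univ _)
  · exact h
  · have h1 := (Sm.diff (Sm.deriv hg.sm) x).hasDerivAt.log (hg.pos x).ne'
    simpa only [nonlin, div_eq_mul_inv] using h1.hasDerivWithinAt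

theorem schw_periodic {f : ℝ → ℝ} (hf : IsCircleDiffeoLift f) (x : ℝ) :
    schw f (x + 1) = schw f x := by
  have := iteratedDeriv_periodic (nonlin_periodic hf) 1 x
  rw [iteratedDeriv_one] at this
  simp only [schw, this, nonlin_periodic hf]

theorem exists_schwBd {g : ℝ → ℝ} (hg : IsCircleDiffeoLift g) : ∃ σ, SchwBd σ g := by
  choose σ hσ using fun j => periodic_iter_bdd (schw_sm hg) (schw_periodic hg) j
  exact ⟨σ, fun j x => hσ j j le_rfl x⟩

theorem Liouville.exists_coprime {τ : ℝ} (hτ : Liouville τ) (N Q : ℕ) :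
    ∃ (p : ℤ) (q : ℕ), Q < q ∧ IsCoprime p (q : ℤ) ∧ 1 < q ∧ |τ - p / q| < 1 / q ^ N := by
  have hirr := hτ.irrational
  obtain ⟨δ, hδ, hδ0⟩ := ((hirr.eventually_forall_le_dist_cast_div_of_denom_le (Q + 1)).filter_mono
    (nhdsWithin_le_nhds (s := Set.Ioi 0)) |>.and self_mem_nhdsWithin).exists
  obtain ⟨M, hM⟩ := exists_pow_lt_of_lt_one hδ0 (show (1 / 2 : ℝ) < 1 by norm_num)
  obtain ⟨a, b, hb, -, hab⟩ := hτ (max M N)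
  have hb0 : b ≠ 0 := by omega
  set x : ℚ := a / b with hx
  have hxr : (a : ℝ) / b = x.num / x.den := by
    rw [← Rat.cast_def, hx]; push_cast; rfl
  have hden : (x.den : ℤ) ∣ b := by
    rw [hx, ← Rat.divInt_eq_div]; exact Rat.den_dvd a b
  have hle : (x.den : ℝ) ≤ b := by
    have := Int.le_of_dvd (by omega) hden
    exact_mod_cast this
  have hd1 : (1 : ℝ) ≤ x.den := by exact_mod_cast x.den_pos
  have hb2 : (2 : ℝ) ≤ b := by exact_mod_cast hb
  rw [hxr] at hab
  have hlt : |τ - x.num / x.den| < δ := by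
    refine hab.trans (lt_of_le_of_lt ?_ hM)
    rw [← one_div_pow]
    calc (1 / (b : ℝ)) ^ (max M N) ≤ (1 / 2) ^ (max M N) := by gcongr
      _ ≤ (1 / 2) ^ M := pow_le_pow_of_le_one (by norm_num) (by norm_num) (le_max_left _ _)
  have hQ : Q + 1 < x.den := by
    by_contra! hcon
    have := hδ x.den hcon x.num
    rw [Real.dist_eq] at this
    linarith
  refine ⟨x.num, x.den, by omega, ?_, by omega, hab.trans_le ?_⟩
  · rw [Int.isCoprime_iff_gcd_eq_one]
    simpa [Int.gcd] using x.reduced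
  · calc 1 / (b : ℝ) ^ (max M N) ≤ 1 / (x.den : ℝ) ^ (max M N) := by gcongr
      _ ≤ 1 / (x.den : ℝ) ^ N := by
        exact one_div_le_one_div_of_le (by positivity) (pow_le_pow_right₀ hd1 (le_max_right _ _))

theorem exists_iterate_eq {g : ℝ → ℝ} (hg : IsCircleDiffeoLift g) {τ : ℝ}
    (hτ : Tendsto (fun n : ℕ => g^[n] 0 / (n : ℝ)) atTop (𝓝 τ)) (q : ℕ) :
    ∃ x, g^[q] x = x + q * τ := by
  have h1 : CircleDeg1Lift.translationNumber hg.toLift = τ := by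
    apply CircleDeg1Lift.translationNumber_eq_of_tendsto₀
    simpa only [CircleDeg1Lift.coe_pow, hg.coe_toLift] using hτ
  obtain ⟨x, hx⟩ := CircleDeg1Lift.exists_eq_add_translationNumber (hg.toLift ^ q)
    (by rw [CircleDeg1Lift.coe_pow, hg.coe_toLift]; exact (hg.iter q).cont)
  refine ⟨x, ?_⟩
  rw [CircleDeg1Lift.translationNumber_pow, h1, CircleDeg1Lift.coe_pow, hg.coe_toLift] at hx
  exact hx

theorem iterate_add_le {g : ℝ → ℝ} (hg : Monotone g) {t : ℝ} (ht : 0 ≤ t) (q : ℕ) (x : ℝ) :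
    g^[q + 1] x + t ≤ (fun y => g y + t)^[q + 1] x := by
  have h : ∀ q : ℕ, g^[q] x ≤ (fun y => g y + t)^[q] x := fun q => by
    induction q with
    | zero => simp
    | succ n ih =>
      rw [Function.iterate_succ_apply', Function.iterate_succ_apply']
      have := hg ih
      show _ ≤ g _ + t
      linarith
  rw [Function.iterate_succ_apply', Function.iterate_succ_apply']
  have := hg (h q)
  show _ ≤ g _ + t
  linarith

theorem iterate_sub_le {g : ℝ → ℝ} (hg : Monotone g) {t : ℝ} (ht : 0 ≤ t) (q : ℕ) (x : ℝ) :
    (fun y => g y + -t)^[q + 1] x ≤ g^[q + 1] x - t := by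
  have h : ∀ q : ℕ, (fun y => g y + -t)^[q] x ≤ g^[q] x := fun q => by
    induction q with
    | zero => simp
    | succ n ih =>
      rw [Function.iterate_succ_apply', Function.iterate_succ_apply']
      have := hg ih
      show g _ + -t ≤ _
      linarith
  rw [Function.iterate_succ_apply', Function.iterate_succ_apply']
  have := hg (h q)
  show g _ + -t ≤ _
  linarith

theorem exists_translate_periodic {g : ℝ → ℝ} (hg : IsCircleDiffeoLift g) {q : ℕ} (hq : 0 < q)
    {x a δ : ℝ} (hδ : 0 ≤ δ) (ha : |g^[q] x - a| ≤ δ) :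
    ∃ t, |t| ≤ δ ∧ (fun y => g y + t)^[q] x = a := by
  obtain ⟨q, rfl⟩ : ∃ k, q = k + 1 := ⟨q - 1, by omega⟩
  have hc : Continuous fun t : ℝ => (fun y => g y + t)^[q + 1] x := by
    have : ∀ n : ℕ, Continuous fun t : ℝ => (fun y => g y + t)^[n] x := fun n => by
      induction n with
      | zero => simpa using continuous_const
      | succ n ih =>
        simp only [Function.iterate_succ_apply']
        exact (hg.cont.comp ih).add continuous_id
    exact this _
  rw [abs_le] at ha
  have h1 := iterate_add_le hg.strictMono.monotone hδ q x
  have h2 := iterate_sub_le hg.strictMono.monotone hδ q x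
  obtain ⟨t, ht, hta⟩ := intermediate_value_Icc (show -δ ≤ δ by linarith) hc.continuousOn
    (show a ∈ Set.Icc _ _ from ⟨by linarith, by linarith⟩)
  exact ⟨t, abs_le.2 ht, hta⟩

theorem Orb.shift {g : ℝ → ℝ} {p : ℤ} {q : ℕ} {y : ℤ → ℝ} (h : Orb g p q y) (a : ℤ) :
    Orb g p q (fun k => y (k + a)) where
  lift := h.lift
  hq := h.hq
  cop := h.cop
  mono := fun i j hij => h.mono (by omega)
  per := fun k => by rw [← h.per]; congr 1; ring
  map := fun k => by rw [h.map]; congr 1; ring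

/-- Every smooth diffeomorphism with Liouville rotation number is a limit of smooth conjugates of
the rotation. -/
theorem exists_conj_close {g : ℝ → ℝ} (hg : IsCircleDiffeoLift g) {τ : ℝ} (hL : Liouville τ)
    (hτ : Tendsto (fun n : ℕ => g^[n] 0 / (n : ℝ)) atTop (𝓝 τ)) (s : ℕ) {ε : ℝ} (hε : 0 < ε) :
    ∃ h, IsCircleDiffeoLift h ∧ CrClose s ε (fun x => Function.invFun h (h x + τ)) g := by
  obtain ⟨V, hV0, hV⟩ := exists_logLip hg
  obtain ⟨σ, hσ⟩ := exists_schwBd hg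
  obtain ⟨B, hB2, hBi, hBd⟩ := lift_iter_bdd hg (s + 1)
  obtain ⟨m, hm⟩ := close_conj s
  obtain ⟨C, μ₀, hμ₀, hC⟩ := hm V B σ hV0 (by linarith)
  set μ₁ := min (min μ₀ 1) (ε / 2 / (|C| + 1)) with hμ₁
  have hμ₁0 : 0 < μ₁ := by
    rw [hμ₁]; refine lt_min (lt_min hμ₀ one_pos) (by positivity)
  obtain ⟨ρ, hρ0, hρ⟩ := Metric.eventually_nhds_iff.1
    (gap_small (η := μ₁ ^ 2) hV0 hL.irrational (by positivity))
  obtain ⟨Q, hQ⟩ := exists_nat_gt (max (1 / ρ) (2 / ε))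
  obtain ⟨p, q, hQq, hc, hq1, hpq⟩ := hL.exists_coprime (m + 4) Q
  have hq0 : (0 : ℝ) < q := by exact_mod_cast (by omega : 0 < q)
  have hq1' : (1 : ℝ) ≤ q := by exact_mod_cast hq1.le
  have hQq' : (Q : ℝ) < q := by exact_mod_cast hQq
  set δ : ℝ := |q * τ - p| with hδ
  have hδq : δ = q * |τ - p / q| := by
    rw [hδ, ← abs_of_pos hq0, ← abs_mul, abs_of_pos hq0]; congr 1; field_simp
  have hδlt : δ ≤ 1 / q ^ (m + 3) := by
    rw [hδq]
    calc _ ≤ (q : ℝ) * (1 / q ^ (m + 4)) := by gcongr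
      _ = _ := by rw [pow_succ]; field_simp
  have hinv : (1 : ℝ) / q ^ (m + 3) ≤ 1 / q := by
    gcongr; exact le_self_pow₀ hq1' (by omega)
  have hqε : (1 : ℝ) / q ≤ ε / 2 := by
    rw [div_le_iff₀ hq0]
    have : 2 / ε < q := (le_max_right _ _).trans_lt (hQ.trans hQq')
    rw [div_lt_iff₀ hε] at this
    linarith
  obtain ⟨x, hx⟩ := exists_iterate_eq hg hτ q
  obtain ⟨t, ht, htx⟩ := exists_translate_periodic hg (by omega : 0 < q) (x := x) (a := x + p)
    (abs_nonneg (q * τ - p)) (by rw [hx]; apply le_of_eq; congr 1; ring)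
  have hgt := hg.add_const t
  have hder : deriv (fun y => g y + t) = deriv g := by ext z; rw [deriv_add_const]
  obtain ⟨y', hy', -⟩ := exists_orb hgt (by omega) hc htx
  obtain ⟨k, hk⟩ := hy'.exists_max_gap
  have hy := hy'.shift k
  set y : ℤ → ℝ := fun j => y' (j + k) with hyd
  have hgy : ∀ j, gap y j = gap y' (j + k) := fun j => by
    simp only [gap, hyd]; congr 2; ring
  have hmax : ∀ j, gap y j ≤ gap y 0 := fun j => by
    rw [hgy, hgy, zero_add]; exact hk _
  have hVt : LogLip V (fun y => g y + t) := by unfold LogLip; rw [hder]; exact hV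
  have hσt : SchwBd σ (fun y => g y + t) := by
    unfold SchwBd schw nonlin; rw [hder]; exact hσ
  have h0 := hy.gap_pos 0
  set μ := Real.sqrt (gap y 0) with hμ
  have hμ2 : gap y 0 = μ ^ 2 := (Real.sq_sqrt h0.le).symm
  have hμ0 : 0 < μ := Real.sqrt_pos.2 h0
  have hμ1 : μ ≤ μ₁ := by
    have := @hρ (p / q) ?_ _ p q y hy hVt rfl 0
    · rw [hμ2] at this
      exact (pow_le_pow_iff_left₀ hμ0.le hμ₁0.le two_ne_zero).1 this
    · rw [dist_comm, Real.dist_eq]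
      refine hpq.trans_le ?_
      calc (1 : ℝ) / q ^ (m + 4) ≤ 1 / q := by
            gcongr; exact le_self_pow₀ hq1' (by omega)
        _ ≤ ρ := by
          rw [div_le_iff₀ hq0]
          have : 1 / ρ < q := (le_max_left _ _).trans_lt (hQ.trans hQq')
          rw [div_lt_iff₀ hρ0] at this
          linarith
  have hμone : μ ≤ 1 := hμ1.trans ((min_le_left _ _).trans (min_le_right _ _))
  have hqμ : 1 / q ≤ μ ^ 2 := by
    rw [← hμ2, div_le_iff₀ hq0]
    have h1 := hy.sum_gap
    have h2 : ∑ j ∈ Finset.range q, gap y j ≤ ∑ j ∈ Finset.range q, gap y 0 :=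
      Finset.sum_le_sum fun j _ => hmax j
    rw [h1] at h2
    simp only [Finset.sum_const, Finset.card_range, nsmul_eq_mul] at h2
    linarith
  obtain ⟨h, hh, hclose⟩ := hC _ p q y τ μ hy hVt hσt (by rw [hder]; exact hBi)
    (fun j h1 h2 x => by rw [iteratedDeriv_add_const_pos h1]; exact hBd j h1 h2 x) hmax hμ0
    (hμ1.trans ((min_le_left _ _).trans (min_le_left _ _))) hμ2 (by
      rw [← hδ]
      calc δ * (q : ℝ) ^ 2 ≤ 1 / (q : ℝ) ^ (m + 3) * (q : ℝ) ^ 2 := by gcongr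
        _ = (1 / q : ℝ) ^ (m + 1) := by
          rw [one_div_pow, show m + 3 = m + 1 + 2 by ring, pow_add _ (m + 1) 2]; field_simp
        _ ≤ (μ ^ 2) ^ (m + 1) := by gcongr
        _ ≤ μ ^ (m + 1) := by
          exact pow_le_pow_left₀ (by positivity) (pow_le_of_le_one hμ0.le hμone two_ne_zero) _)
  refine ⟨h, hh, ?_⟩
  have hgg : CrClose s (1 / q) (fun y => g y + t) g := by
    intro i hi x
    have e : (fun x => g x + t - g x) = fun _ => t := by ext; ring
    rw [e, iteratedDeriv_const]
    split_ifs
    · exact ht.trans (hδlt.trans hinv)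
    · simp only [abs_zero]; positivity
  refine (CrClose.trans (hh.conj τ).sm hgt.sm hg.sm hclose hgg).mono le_rfl ?_
  have : C * μ ≤ ε / 2 := by
    have h1 : μ ≤ ε / 2 / (|C| + 1) := hμ1.trans (min_le_right _ _)
    rw [le_div_iff₀ (by positivity)] at h1
    have := le_abs_self C
    nlinarith
  linarith

/-- A lift whose derivative takes two values in ratio `K` away from the zeros of `sin (2πx)`. -/
theorem exists_two_speed {K : ℕ} (hK : 1 ≤ K) {δ : ℝ} (hδ : 0 < δ) :
    ∃ (a : ℝ → ℝ) (c : ℝ), IsCircleDiffeoLift a ∧ 1 ≤ c ∧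
      (∀ x, δ ≤ Real.sin (2 * Real.pi * x) → deriv a x = c) ∧
      (∀ x, Real.sin (2 * Real.pi * x) ≤ -δ → deriv a x = c / K) ∧
      (∀ x, c / K ≤ deriv a x ∧ deriv a x ≤ c) := by
  have hK0 : (0 : ℝ) < K := by exact_mod_cast hK
  have hK1 : (1 : ℝ) ≤ K := by exact_mod_cast hK
  set b : ℝ → ℝ := fun x => Real.smoothTransition (Real.sin (2 * Real.pi * x) / (2 * δ) + 1 / 2)
    with hb
  have hbs : Sm b := Real.smoothTransition.contDiff.comp
    (((Real.contDiff_sin.comp (contDiff_const.mul contDiff_id)).div_const _).add contDiff_const)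
  have hb0 : ∀ x, 0 ≤ b x := fun x => Real.smoothTransition.nonneg _
  have hb1 : ∀ x, b x ≤ 1 := fun x => Real.smoothTransition.le_one _
  have hbp : ∀ x, b (x + 1) = b x := fun x => by
    simp only [hb]
    rw [mul_add, mul_one, Real.sin_add_two_pi]
  set ψ : ℝ → ℝ := fun x => 1 / K + (1 - 1 / K) * b x with hψ
  have hKi : 1 / (K : ℝ) ≤ 1 := by rw [div_le_one hK0]; exact hK1
  have hψs : Sm ψ := contDiff_const.add (contDiff_const.mul hbs)
  have hψl : ∀ x, 1 / K ≤ ψ x := fun x => by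
    simp only [hψ]; have := mul_nonneg (sub_nonneg.2 hKi) (hb0 x); linarith
  have hψu : ∀ x, ψ x ≤ 1 := fun x => by
    simp only [hψ]; have := mul_le_mul_of_nonneg_left (hb1 x) (sub_nonneg.2 hKi); linarith
  have hψp : Function.Periodic ψ 1 := fun x => by simp only [hψ, hbp]
  have hInt : ∀ u v, IntervalIntegrable ψ volume u v := fun u v =>
    hψs.continuous.intervalIntegrable _ _
  set Z := ∫ x in (0 : ℝ)..1, ψ x with hZ
  have hZ1 : Z ≤ 1 := by
    have := intervalIntegral.integral_mono_on zero_le_one (hInt 0 1)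
      (continuous_const.intervalIntegrable (μ := volume) 0 1)
        (g := fun _ => (1 : ℝ)) fun x _ => hψu x
    simpa using this
  have hZ0 : 0 < Z := by
    have := intervalIntegral.integral_mono_on zero_le_one
      (continuous_const.intervalIntegrable (μ := volume) 0 1) (hInt 0 1) (f := fun _ => 1 / (K : ℝ))
      fun x _ => hψl x
    have h2 : 1 / (K : ℝ) ≤ Z := by simpa using this
    exact lt_of_lt_of_le (by positivity) h2
  have hderiv : ∀ x, HasDerivAt (fun x => (∫ t in (0 : ℝ)..x, ψ t) / Z) (ψ x / Z) x := fun x =>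
    ((intervalIntegral.integral_hasDerivAt_right (hInt 0 x)
      (hψs.continuous.stronglyMeasurableAtFilter _ _) hψs.continuous.continuousAt)).div_const Z
  have hd : deriv (fun x => (∫ t in (0 : ℝ)..x, ψ t) / Z) = fun x => ψ x / Z :=
    funext fun x => (hderiv x).deriv
  have hψpos : ∀ x, 0 < ψ x := fun x => lt_of_lt_of_le (by positivity) (hψl x)
  refine ⟨fun x => (∫ t in (0 : ℝ)..x, ψ t) / Z, 1 / Z, ⟨?_, fun x => ?_, fun x => ?_⟩, ?_,
      ?_, ?_, ?_⟩
  · refine contDiff_infty_iff_deriv.2 ⟨fun x => (hderiv x).differentiableAt, ?_⟩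
    rw [hd]; exact hψs.div_const Z
  · have h1 := hψp.intervalIntegral_add_eq x 0
    rw [zero_add] at h1
    beta_reduce
    rw [← intervalIntegral.integral_add_adjacent_intervals (hInt 0 x) (hInt x (x + 1)), h1, add_div,
      div_self hZ0.ne']
  · rw [hd]; exact div_pos (hψpos x) hZ0
  · rw [le_div_iff₀ hZ0]; linarith
  · intro x hx
    rw [hd]
    have : b x = 1 := Real.smoothTransition.one_of_one_le (by
      have : 1 / 2 ≤ Real.sin (2 * Real.pi * x) / (2 * δ) := by
        rw [le_div_iff₀ (by positivity)]; linarith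
      linarith)
    simp only [hψ, this]; ring
  · intro x hx
    rw [hd]
    have : b x = 0 := Real.smoothTransition.zero_of_nonpos (by
      have : Real.sin (2 * Real.pi * x) / (2 * δ) ≤ -1 / 2 := by
        rw [div_le_iff₀ (by positivity)]; linarith
      linarith)
    simp only [hψ, this]; ring
  · intro x
    rw [hd]
    constructor
    · rw [div_right_comm]; exact div_le_div_of_nonneg_right (hψl x) hZ0.le
    · exact div_le_div_of_nonneg_right (hψu x) hZ0.le

theorem volume_image_le {f : ℝ → ℝ} {s : Set ℝ} {C : NNReal} (h : LipschitzOnWith C f s) :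
    volume (f '' s) ≤ C * volume s := by
  have := h.hausdorffMeasure_image_le (d := 1) zero_le_one
  rwa [hausdorffMeasure_real, ENNReal.rpow_one] at this

theorem volume_periodic {S : Set ℝ} (hS : MeasurableSet S) (hp : ∀ w, w + 1 ∈ S ↔ w ∈ S) {q : ℕ}
    (hq : 0 < q) (c : ℝ) :
    volume {z | z ∈ Set.Ioc c (c + 1) ∧ (q : ℝ) * z ∈ S} = volume (S ∩ Set.Ioc 0 1) := by
  have hq0 : (q : ℝ) ≠ 0 := by positivity
  have hper : Function.Periodic (S.indicator fun _ => (1 : ℝ)) 1 := fun w => by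
    by_cases hw : w ∈ S
    · rw [Set.indicator_of_mem ((hp w).2 hw), Set.indicator_of_mem hw]
    · rw [Set.indicator_of_notMem (fun h => hw ((hp w).1 h)), Set.indicator_of_notMem hw]
  have hInt : ∀ u v, IntervalIntegrable (S.indicator fun _ => (1 : ℝ)) volume u v := fun u v => by
    constructor <;> exact (integrable_const (1 : ℝ)).indicator hS
  have h1 : ∫ z in c..c + 1, S.indicator (fun _ => (1 : ℝ)) ((q : ℝ) * z) =
      ∫ z in (0 : ℝ)..1, S.indicator (fun _ => (1 : ℝ)) z := by
    rw [intervalIntegral.integral_comp_mul_left _ hq0]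
    have := hper.intervalIntegral_add_zsmul_eq q (q * c) hInt
    rw [show (q : ℝ) * (c + 1) = q * c + (q : ℤ) • (1 : ℝ) by simp; ring, this,
      hper.intervalIntegral_add_eq _ 0, zero_add]
    simp only [smul_eq_mul, zsmul_eq_mul, Int.cast_natCast]
    field_simp
  have hm : MeasurableSet {z : ℝ | (q : ℝ) * z ∈ S} := (measurable_const_mul (q : ℝ)) hS
  have h2 : (fun z => S.indicator (fun _ => (1 : ℝ)) ((q : ℝ) * z)) =
      {z : ℝ | (q : ℝ) * z ∈ S}.indicator fun _ => (1 : ℝ) := by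
    ext z; rfl
  rw [h2, intervalIntegral.integral_of_le (by linarith),
      intervalIntegral.integral_of_le zero_le_one,
    setIntegral_indicator hm, setIntegral_indicator hS, setIntegral_const, setIntegral_const,
    smul_eq_mul, smul_eq_mul, mul_one, mul_one] at h1
  rw [Set.inter_comm S]
  refine (measureReal_eq_measureReal_iff ?_ ?_).1 h1
  · exact (measure_mono Set.inter_subset_left |>.trans_lt measure_Ioc_lt_top).ne
  · exact (measure_mono Set.inter_subset_left |>.trans_lt measure_Ioc_lt_top).ne

theorem exists_sin_small {ρ : ENNReal} (hρ : 0 < ρ) : ∃ δ : ℝ, 0 < δ ∧ δ ≤ 1 / 2 ∧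
    volume ({w : ℝ | |Real.sin (2 * Real.pi * w)| < δ} ∩ Set.Ioc 0 1) ≤ ρ := by
  have hcont : Continuous fun w : ℝ => |Real.sin (2 * Real.pi * w)| := by fun_prop
  have h := tendsto_measure_iInter_atTop (μ := volume)
    (s := fun n : ℕ => {w : ℝ | |Real.sin (2 * Real.pi * w)| < 1 / ((n : ℝ) + 1)} ∩ Set.Ioc 0 1)
    (fun n => ((isOpen_lt hcont continuous_const).measurableSet.inter
      measurableSet_Ioc).nullMeasurableSet)
    (fun m n hmn w hw => ⟨lt_of_lt_of_le (b := 1 / ((n : ℝ) + 1)) hw.1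
      (Nat.one_div_le_one_div hmn), hw.2⟩)
    ⟨0, (measure_mono Set.inter_subset_right |>.trans_lt measure_Ioc_lt_top).ne⟩
  have h0 : volume (⋂ n : ℕ, {w : ℝ | |Real.sin (2 * Real.pi * w)| < 1 / ((n : ℝ) + 1)} ∩
      Set.Ioc 0 1) = 0 := by
    refine measure_mono_null (t := Set.range fun n : ℤ => (n : ℝ) / 2) (fun w hw => ?_)
      ((Set.countable_range _).measure_zero _)
    have h1 : |Real.sin (2 * Real.pi * w)| ≤ 0 := by
      refine ge_of_tendsto' tendsto_one_div_add_atTop_nhds_zero_nat fun n => ?_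
      exact (Set.mem_iInter.1 hw n).1.le
    obtain ⟨n, hn⟩ := Real.sin_eq_zero_iff.1 (abs_nonpos_iff.1 h1)
    refine ⟨n, ?_⟩
    have hπ := Real.pi_pos.ne'
    field_simp
    have : Real.pi * n = Real.pi * (2 * w) := by linarith
    have := mul_left_cancel₀ hπ this
    linarith
  rw [h0] at h
  obtain ⟨n, hn, hn1⟩ := ((h.eventually (gt_mem_nhds hρ)).and (eventually_ge_atTop 1)).exists
  refine ⟨1 / ((n : ℝ) + 1), by positivity, ?_, hn.le⟩
  have : (1 : ℝ) ≤ n := by exact_mod_cast hn1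
  apply one_div_le_one_div_of_le <;> linarith

theorem inv_lipschitz {h : ℝ → ℝ} (hh : IsCircleDiffeoLift h) {B : ℝ} (hB : ∀ x, (deriv h x)⁻¹ ≤ B)
    (u v : ℝ) : |Function.invFun h u - Function.invFun h v| ≤ B * |u - v| := by
  have h1 := Convex.norm_image_sub_le_of_norm_deriv_le (f := Function.invFun h) (C := B)
    (s := Set.univ) (x := v) (y := u) (fun x _ => (Sm.diff hh.inv_sm).differentiableAt)
      (fun x _ => ?_)
    convex_univ (Set.mem_univ _) (Set.mem_univ _)
  · exact h1
  · rw [hh.deriv_inv, Real.norm_of_nonneg (inv_pos.2 (hh.pos _)).le]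
    exact hB _

theorem exists_small_bad {h : ℝ → ℝ} (hh : IsCircleDiffeoLift h) {ρ : ENNReal} (hρ : 0 < ρ) :
    ∃ δ : ℝ, 0 < δ ∧ δ ≤ 1 / 2 ∧ ∀ q : ℕ, 0 < q →
      volume {x | x ∈ Set.Ioc (0 : ℝ) 1 ∧ |Real.sin (2 * Real.pi * (q * h x))| < δ} ≤ ρ := by
  obtain ⟨B, hB2, hB, -⟩ := lift_iter_bdd hh 0
  have hB0 : 0 ≤ B := by linarith
  set b : NNReal := ⟨B, hB0⟩ with hb
  have hbne : (b : ENNReal) ≠ ⊤ := ENNReal.coe_ne_top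
  obtain ⟨δ, hδ, hδ2, hv⟩ := exists_sin_small (ρ := ρ / b) (ENNReal.div_pos hρ.ne' hbne)
  refine ⟨δ, hδ, hδ2, fun q hq => ?_⟩
  set S := {w : ℝ | |Real.sin (2 * Real.pi * w)| < δ} with hS
  have hcont : Continuous fun w : ℝ => |Real.sin (2 * Real.pi * w)| := by fun_prop
  have hSm : MeasurableSet S := (isOpen_lt hcont continuous_const).measurableSet
  have hSp : ∀ w, w + 1 ∈ S ↔ w ∈ S := fun w => by
    simp only [hS, Set.mem_ofPred_eq, mul_add, mul_one, Real.sin_add_two_pi]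
  have hlip : LipschitzOnWith b (Function.invFun h)
      {z | z ∈ Set.Ioc (h 0) (h 0 + 1) ∧ (q : ℝ) * z ∈ S} :=
    LipschitzWith.lipschitzOnWith (LipschitzWith.of_dist_le_mul fun u v => by
      rw [Real.dist_eq, Real.dist_eq]; exact inv_lipschitz hh hB u v)
  calc _ ≤ volume (Function.invFun h '' {z | z ∈ Set.Ioc (h 0) (h 0 + 1) ∧ (q : ℝ) * z ∈ S}) := by
        refine measure_mono fun x hx => ⟨h x, ⟨⟨hh.strictMono hx.1.1, ?_⟩, hx.2⟩, hh.inv_apply x⟩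
        have := hh.strictMono.monotone hx.1.2
        have h1 := hh.2.1 0
        rw [zero_add] at h1
        linarith
    _ ≤ b * volume {z | z ∈ Set.Ioc (h 0) (h 0 + 1) ∧ (q : ℝ) * z ∈ S} := volume_image_le hlip
    _ = b * volume (S ∩ Set.Ioc 0 1) := by rw [volume_periodic hSm hSp hq]
    _ ≤ b * (ρ / b) := by gcongr
    _ ≤ ρ := ENNReal.mul_div_le

theorem conj_diff (s : ℕ) : ∃ A : ℕ, ∀ B : ℝ, 2 ≤ B → ∀ G : ℝ → ℝ, IsCircleDiffeoLift G →
    (∀ x, (deriv G x)⁻¹ ≤ B) → (∀ j, 1 ≤ j → j ≤ s + 1 → ∀ x, |iteratedDeriv j G x| ≤ B) →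
    ∀ u v : ℝ, CrClose s (B ^ A * |u - v|) (fun x => Function.invFun G (G x + u))
      (fun x => Function.invFun G (G x + v)) := by
  obtain ⟨A1, hA1, h1⟩ := inverse_bound (s + 1)
  obtain ⟨A2, h2⟩ := comp_diff s
  refine ⟨A1 * A2, fun B hB G hG hGi hGb u v i hi x => ?_⟩
  have hB1 : 1 ≤ B := by linarith
  have hBA : B ≤ B ^ A1 := le_self_pow₀ hB1 (by omega)
  have hk : ∀ j, 1 ≤ j → j ≤ s + 1 → ∀ w, |iteratedDeriv j (Function.invFun G) w| ≤ B ^ A1 := by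
    intro j hj1 hj2 w
    have := h1 B hB G (Function.invFun G) (Function.invFun G w) hG.sm hG.inv_sm hG.pos hG.apply_inv
      (by rw [hG.apply_inv]) (hGi _) (fun j h3 h4 => hGb j h3 h4 _) j hj1 hj2
    rwa [hG.apply_inv] at this
  have hb : ∀ c : ℝ, ∀ j, 1 ≤ j → j ≤ s → |iteratedDeriv j (fun x => G x + c) x| ≤ B ^ A1 :=
    fun c j hj1 hj2 => by
      rw [iteratedDeriv_add_const_pos hj1]
      exact (hGb j hj1 (by omega) x).trans hBA
  have := h2 (B ^ A1) (hB.trans hBA) |u - v| (abs_nonneg _) (Function.invFun G) (fun x => G x + u)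
    (fun x => G x + v) x hG.inv_sm (hG.sm.add contDiff_const) (hG.sm.add contDiff_const)
    (fun j hj1 hj2 w _ => hk j hj1 hj2 w) (fun j hj1 hj2 => ⟨hb u j hj1 hj2, hb v j hj1 hj2⟩)
    (by
      have e : (fun x => G x + u - (G x + v)) = fun _ => u - v := by ext; ring
      rw [e]
      exact Bd.const x _ le_rfl zero_le_one) i hi
  rwa [one_pow, mul_one, ← pow_mul] at this

theorem IsCircleDiffeoLift.rescale {H a : ℝ → ℝ} (hH : IsCircleDiffeoLift H)
    (ha : IsCircleDiffeoLift a) {q : ℕ} (hq : 0 < q) :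
    IsCircleDiffeoLift (fun x => a (q * H x) / q) ∧
      ∀ x, deriv (fun x => a (q * H x) / q) x = deriv a (q * H x) * deriv H x := by
  have hq0 : (0 : ℝ) < q := by exact_mod_cast hq
  have hd : ∀ x, deriv (fun x => a (q * H x) / q) x = deriv a (q * H x) * deriv H x := fun x => by
    have h1 := ((Sm.diff hH.sm x).hasDerivAt.const_mul (q : ℝ))
    have h2 := ((Sm.diff ha.sm (q * H x)).hasDerivAt.comp x h1).div_const (q : ℝ)
    rw [show (fun x => a (q * H x) / q) = fun x => (a ∘ fun y => (q : ℝ) * H y) x / q from rfl,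
        h2.deriv]
    field_simp
  refine ⟨⟨?_, fun x => ?_, fun x => ?_⟩, hd⟩
  · exact (comp_sm ha.sm (contDiff_const.mul hH.sm)).div_const _
  · have := ha.add_int (q * H x) q
    push_cast at this
    simp only [hH.2.1, mul_add, mul_one, this]
    field_simp
  · rw [hd]; exact mul_pos (ha.pos _) (hH.pos _)

theorem conj_rescale {H a : ℝ → ℝ} (hH : IsCircleDiffeoLift H)
    (ha : IsCircleDiffeoLift a) {q : ℕ} (hq : 0 < q) (i : ℤ) (x : ℝ) :
    Function.invFun (fun x => a (q * H x) / q) (a (q * H x) / q + i / q) =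
      Function.invFun H (H x + i / q) := by
  have hq0 : (0 : ℝ) < q := by exact_mod_cast hq
  have hH' := (hH.rescale ha hq).1
  have : a (q * H x) / q + i / q =
      (fun x => a (q * H x) / q) (Function.invFun H (H x + i / q)) := by
    beta_reduce
    rw [hH.apply_inv, mul_add, mul_div_cancel₀ _ hq0.ne', ha.add_int, add_div]
  rw [this, hH'.inv_apply]

theorem rescale_iter_bdd {H a : ℝ → ℝ} (hH : IsCircleDiffeoLift H) (ha : IsCircleDiffeoLift a)
    (s : ℕ) : ∃ C : ℝ, 2 ≤ C ∧ ∃ M : ℕ, 1 ≤ M ∧ ∀ q : ℕ, 0 < q →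
      (∀ x, (deriv (fun x => a (q * H x) / q) x)⁻¹ ≤ (C * q) ^ M) ∧
      ∀ j, 1 ≤ j → j ≤ s → ∀ x, |iteratedDeriv j (fun x => a (q * H x) / q) x| ≤ (C * q) ^ M := by
  obtain ⟨B, hB, hBi, hBd⟩ := lift_iter_bdd hH s
  obtain ⟨D, hD, hDi, hDd⟩ := lift_iter_bdd ha s
  refine ⟨B * D, by nlinarith, s * s + 1 + 1 * s, by omega, fun q hq => ?_⟩
  have hq1 : (1 : ℝ) ≤ q := by exact_mod_cast hq
  have hBD : B * D ≤ B * D * q := le_mul_of_one_le_right (by positivity) hq1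
  have hP2 : 2 ≤ B * D * q := by nlinarith
  constructor
  · intro x
    rw [(hH.rescale ha hq).2, mul_inv, mul_comm]
    calc _ ≤ B * D := mul_le_mul (hBi x) (hDi _) (inv_pos.2 (ha.pos _)).le (by linarith)
      _ ≤ B * D * q := hBD
      _ ≤ _ := le_self_pow₀ (by linarith) (by omega)
  · intro j hj1 hj2 x
    have hus : Sm (fun x => (q : ℝ) * H x) := contDiff_const.mul hH.sm
    have h1 := comp_pow_pos s hP2 (f := a) (u := fun x => q * H x) (x := x) 1 1 ha.sm hus
      (fun i hi1 hi2 => by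
        rw [pow_one]
        refine (hDd i hi1 hi2 _).trans (le_trans ?_ hBD)
        nlinarith)
      (fun i hi1 hi2 => by
        rw [pow_one, iteratedDeriv_const_mul_field, abs_mul, Nat.abs_cast, mul_comm]
        have := hBd i hi1 hi2 x
        gcongr
        nlinarith) j hj1 hj2
    have e : (fun x => a (q * H x) / q) = fun x => (q : ℝ)⁻¹ * a (q * H x) := by
      ext; rw [div_eq_inv_mul]
    rw [e, iteratedDeriv_const_mul_field, abs_mul]
    refine le_trans ?_ h1
    rw [abs_of_pos (a := (q : ℝ)⁻¹) (by positivity)]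
    exact mul_le_of_le_one_left (abs_nonneg _) (inv_le_one_of_one_le₀ hq1)

/-- One step of the approximation by conjugation. -/
theorem exists_conj_step {H : ℝ → ℝ} (hH : IsCircleDiffeoLift H) {τ : ℝ} (hL : Liouville τ) {K : ℕ}
    (hK : 1 ≤ K) (s J : ℕ) {ε η : ℝ} (hε : 0 < ε) (hη : 0 < η) {ρ : ENNReal} (hρ : 0 < ρ) :
    ∃ (a : ℝ → ℝ) (c : ℝ) (q : ℕ), 0 < q ∧ IsCircleDiffeoLift a ∧ 1 ≤ c ∧ 1 / (q : ℝ) ≤ η ∧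
      (∀ x, 1 / 2 ≤ Real.sin (2 * Real.pi * x) → deriv a x = c) ∧
      (∀ x, Real.sin (2 * Real.pi * x) ≤ -(1 / 2) → deriv a x = c / K) ∧
      (∀ x, c / K ≤ deriv a x ∧ deriv a x ≤ c) ∧
      volume {x | x ∈ Set.Ioc (0 : ℝ) 1 ∧ ¬ (deriv a (q * H x) = c ∨ deriv a (q * H x) =
        c / K)} ≤ ρ ∧
      ∀ j ≤ J, CrClose s ε
        (fun x => Function.invFun (fun x => a (q * H x) / q) (a (q * H x) / q + j * τ))
        (fun x => Function.invFun H (H x + j * τ)) := by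
  obtain ⟨δ, hδ, hδ2, hbad⟩ := exists_small_bad hH hρ
  obtain ⟨a, c, ha, hc, hac, hack, hab⟩ := exists_two_speed hK hδ
  obtain ⟨A, hA⟩ := conj_diff s
  obtain ⟨C, hC, M, hM, hCM⟩ := rescale_iter_bdd hH ha (s + 1)
  obtain ⟨B, hB, hBi, hBd⟩ := lift_iter_bdd hH (s + 1)
  set W := B ^ A + C ^ (M * A) with hW
  have hW0 : 0 < W := by positivity
  obtain ⟨Q, hQ⟩ := exists_nat_gt (max (1 / η) (J * W / ε))
  obtain ⟨p, q, hQq, -, hq1, hpq⟩ := hL.exists_coprime (M * A + 1) Q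
  have hq0 : (0 : ℝ) < q := by exact_mod_cast (by omega : 0 < q)
  have hq1' : (1 : ℝ) ≤ q := by exact_mod_cast hq1.le
  have hQq' : (Q : ℝ) < q := by exact_mod_cast hQq
  refine ⟨a, c, q, by omega, ha, hc, ?_, fun x hx => hac x (hδ2.trans hx),
    fun x hx => hack x (by linarith), hab, ?_, fun j hj => ?_⟩
  · have : 1 / η < q := (le_max_left _ _).trans_lt (hQ.trans hQq')
    rw [div_lt_iff₀ hη] at this
    rw [div_le_iff₀ hq0]; linarith
  · refine le_trans (measure_mono ?_) (hbad q (by omega))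
    rintro x ⟨hx, hx2⟩
    refine ⟨hx, ?_⟩
    by_contra! hcon
    refine hx2 ?_
    rcases le_abs.1 hcon with h | h
    · exact Or.inl (hac _ h)
    · exact Or.inr (hack _ (by linarith))
  · have hres := hH.rescale ha (q := q) (by omega)
    have hCq : 2 ≤ (C * q) ^ M := by
      refine le_trans ?_ (le_self_pow₀ ?_ (by omega)) <;> nlinarith
    have e1 := hA ((C * q) ^ M) hCq _ hres.1 (hCM q (by omega)).1
      (fun j h1 h2 => (hCM q (by omega)).2 j h1 h2) (j * τ) (((j * p : ℤ) : ℝ) / q)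
    have e2 := hA B hB _ hH hBi hBd (((j * p : ℤ) : ℝ) / q) (j * τ)
    have e3 : (fun x => Function.invFun (fun x => a (q * H x) / q)
        (a (q * H x) / q + ((j * p : ℤ) : ℝ) / q)) =
        fun x => Function.invFun H (H x + ((j * p : ℤ) : ℝ) / q) :=
      funext fun x => conj_rescale hH ha (by omega) _ x
    rw [e3] at e1
    refine (CrClose.trans (hres.1.conj _).sm (hH.conj _).sm (hH.conj _).sm e1 e2).mono le_rfl ?_
    rw [abs_sub_comm (((j * p : ℤ) : ℝ) / q) (j * τ), ← add_mul]
    have h4 : |j * τ - ((j * p : ℤ) : ℝ) / q| ≤ J * (1 / q ^ (M * A + 1)) := by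
      have : j * τ - ((j * p : ℤ) : ℝ) / q = j * (τ - p / q) := by push_cast; ring
      rw [this, abs_mul, Nat.abs_cast]
      have : (j : ℝ) ≤ J := by exact_mod_cast hj
      gcongr
    have hqA : (1 : ℝ) ≤ q ^ (M * A) := one_le_pow₀ hq1'
    calc _ ≤ (W * q ^ (M * A)) * (J * (1 / q ^ (M * A + 1))) := by
          refine mul_le_mul ?_ h4 (abs_nonneg _) (by positivity)
          rw [← pow_mul, mul_pow, hW, add_mul, add_comm]
          have := le_mul_of_one_le_right (a := B ^ A) (by positivity) hqA
          linarith
      _ = J * W / q := by rw [pow_succ]; field_simp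
      _ ≤ ε := by
        have : J * W / ε < q := (le_max_right _ _).trans_lt (hQ.trans hQq')
        rw [div_lt_iff₀ hε] at this
        rw [div_le_iff₀ hq0]; linarith

theorem exists_dense_time {τ : ℝ} (hτ : Irrational τ) {ζ : ℝ} (hζ : 0 < ζ) :
    ∃ J : ℕ, ∀ θ : ℝ, ∃ j ≤ J, ∃ m : ℤ, |j * τ - θ - m| ≤ ζ := by
  obtain ⟨n, hn⟩ := exists_nat_gt (1 / ζ)
  have hn0 : 0 < n := by
    have : (0 : ℝ) < n := lt_trans (by positivity) hn
    exact_mod_cast this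
  obtain ⟨k, hk0, -, hk⟩ := Real.exists_nat_abs_mul_sub_round_le τ hn0
  set β : ℝ := k * τ - round (k * τ) with hβ
  have hβ0 : β ≠ 0 := by
    intro h
    have h1 := (hτ.natCast_mul hk0.ne').ne_int (round (k * τ))
    exact h1 (by linarith)
  have hβζ : |β| ≤ ζ := hk.trans (by
    rw [div_lt_iff₀ hζ] at hn
    rw [div_le_iff₀ (by positivity)]; nlinarith)
  have hb0 : 0 < |β| := abs_pos.2 hβ0
  have key : ∀ θ : ℝ, ∃ i : ℕ, i ≤ ⌈1 / |β|⌉₊ ∧ ∃ m : ℤ, |i * |β| - θ - m| ≤ ζ := fun θ => by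
    refine ⟨⌊Int.fract θ / |β|⌋₊, ?_, -⌊θ⌋, ?_⟩
    · refine (Nat.floor_le_ceil _).trans (Nat.ceil_mono ?_)
      have := (Int.fract_lt_one θ).le
      gcongr
    · have h0 : 0 ≤ Int.fract θ / |β| := div_nonneg (Int.fract_nonneg θ) hb0.le
      have h1 := Nat.floor_le h0
      have h2 := Nat.lt_floor_add_one (Int.fract θ / |β|)
      rw [le_div_iff₀ hb0] at h1
      rw [div_lt_iff₀ hb0] at h2
      have h3 := Int.fract_add_floor θ
      push_cast
      rw [abs_le]; constructor <;> nlinarith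
  refine ⟨⌈1 / |β|⌉₊ * k, fun θ => ?_⟩
  rcases lt_or_gt_of_ne hβ0 with hneg | hpos
  · obtain ⟨i, hi, m, hm⟩ := key (-θ)
    refine ⟨i * k, Nat.mul_le_mul_right _ hi, i * round (k * τ) - m, ?_⟩
    rw [abs_of_neg hneg] at hm
    rw [← abs_neg]
    convert hm using 2
    push_cast; rw [hβ]; ring
  · obtain ⟨i, hi, m, hm⟩ := key θ
    refine ⟨i * k, Nat.mul_le_mul_right _ hi, i * round (k * τ) + m, ?_⟩
    rw [abs_of_pos hpos] at hm
    convert hm using 2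
    push_cast; rw [hβ]; ring

/-- The ratio of the two speeds used at stage `n` of the construction. -/
def spd (n : ℕ) : ℕ := 2 ^ 4 ^ n

theorem one_le_spd (n : ℕ) : 1 ≤ spd n := Nat.one_le_two_pow

theorem log_spd (n : ℕ) : Real.log (spd n) = 4 ^ n * Real.log 2 := by
  simp [spd]

/-- The data of one stage of the construction: the conjugacy `H`, its combinatorial scale `q`, a
bound `B` for its derivatives, the tolerance `δ` for later modifications, and the number `J` of
iterates that later modifications have to control. -/
structure Stage where
  H : ℝ → ℝ
  q : ℕ
  B : ℝ
  δ : ℝ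
  J : ℕ

/-- The scale against which the tolerance of a stage is measured. -/
def Stage.M (n : ℕ) (S : Stage) : ℝ := 100 * 2 ^ n * S.B ^ 3 * spd n * S.q

structure Stage.Good (τ : ℝ) (n : ℕ) (S : Stage) : Prop where
  lift : IsCircleDiffeoLift S.H
  hq : 0 < S.q
  hB : 2 ≤ S.B
  inv_le : ∀ x, (deriv S.H x)⁻¹ ≤ S.B
  le : ∀ x, deriv S.H x ≤ S.B
  logLip : LogLip S.B S.H
  δpos : 0 < S.δ
  δle : S.δ * S.M n ≤ 1
  dense : ∀ θ : ℝ, ∃ j ≤ S.J, ∃ m : ℤ, |j * τ - θ - m| * S.M n ≤ 1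
  le_J : n + 1 ≤ S.J

structure Stage.Next (τ : ℝ) (r n : ℕ) (S S' : Stage) (a : ℝ → ℝ) (c : ℝ) : Prop where
  lift : IsCircleDiffeoLift a
  eq : S'.H = fun x => a (S'.q * S.H x) / S'.q
  one_le : 1 ≤ c
  scale : 2 * (n + 2) * S.B ^ 2 ≤ S'.q
  fast : ∀ x, 1 / 2 ≤ Real.sin (2 * Real.pi * x) → deriv a x = c
  slow : ∀ x, Real.sin (2 * Real.pi * x) ≤ -(1 / 2) → deriv a x = c / spd (n + 1)
  bad : volume {x | x ∈ Set.Ioc (0 : ℝ) 1 ∧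
    ¬ (deriv a (S'.q * S.H x) = c ∨ deriv a (S'.q * S.H x) = c / spd (n + 1))} ≤ 2⁻¹ ^ (n + 3)
  close : ∀ j ≤ S.J, CrClose (n + r) S.δ (fun x => Function.invFun S'.H (S'.H x + j * τ))
    (fun x => Function.invFun S.H (S.H x + j * τ))
  δle : S'.δ ≤ S.δ / 2
  Jle : S.J ≤ S'.J

theorem exists_good {τ : ℝ} (hτ : Irrational τ) {H : ℝ → ℝ} (hH : IsCircleDiffeoLift H) {q : ℕ}
    (hq : 0 < q) (n : ℕ) {E : ℝ} (hE : 0 < E) (J₀ : ℕ) :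
    ∃ S : Stage, S.H = H ∧ S.q = q ∧ S.Good τ n ∧ S.δ ≤ E ∧ J₀ ≤ S.J := by
  obtain ⟨B, hB, hBi, hBd⟩ := lift_iter_bdd hH 1
  obtain ⟨V, hV0, hV⟩ := exists_logLip hH
  set B' := B + V with hB'
  set M : ℝ := 100 * 2 ^ n * B' ^ 3 * spd n * q with hM
  have hs : (0 : ℝ) < spd n := by exact_mod_cast one_le_spd n
  have hq0 : (0 : ℝ) < q := by exact_mod_cast hq
  have hB'2 : 2 ≤ B' := by linarith
  have hM0 : 0 < M := by positivity
  obtain ⟨J, hJ⟩ := exists_dense_time hτ (ζ := 1 / M) (by positivity)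
  refine ⟨⟨H, q, B', min E (1 / M), max (max J J₀) (n + 1)⟩, rfl, rfl, ?_, min_le_left _ _,
    (le_max_right _ _).trans (le_max_left _ _)⟩
  refine ⟨hH, hq, hB'2, fun x => (hBi x).trans (by linarith), fun x => ?_, fun u v => ?_,
    lt_min hE (by positivity), ?_, fun θ => ?_, le_max_right _ _⟩
  · have := hBd 1 le_rfl le_rfl x
    rw [iteratedDeriv_one] at this
    exact (le_abs_self _).trans (this.trans (by linarith))
  · refine (hV u v).trans ?_
    gcongr; linarith
  · show min E (1 / M) * M ≤ 1
    rw [← le_div_iff₀ hM0]; exact min_le_right _ _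
  · obtain ⟨j, hj, m, hm⟩ := hJ θ
    refine ⟨j, hj.trans ((le_max_left _ _).trans (le_max_left _ _)), m, ?_⟩
    show _ * M ≤ 1
    rw [← le_div_iff₀ hM0]; exact hm

theorem Stage.Good.exists_next {τ : ℝ} (hL : Liouville τ) (r : ℕ) {n : ℕ} {S : Stage}
    (hS : S.Good τ n) : ∃ S' : Stage, S'.Good τ (n + 1) ∧ ∃ a c, S.Next τ r n S' a c := by
  have hB := hS.hB
  obtain ⟨a, c, q, hq, ha, hc, hqη, hf, hs, hcl, hbad, hclose⟩ := exists_conj_step hS.lift hL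
    (one_le_spd (n + 1)) (n + r) S.J hS.δpos (η := 1 / (2 * (n + 2) * S.B ^ 2)) (by positivity)
    (ρ := 2⁻¹ ^ (n + 3)) (ENNReal.pow_pos (by simp) _)
  obtain ⟨S', hS'H, hS'q, hG, hδ, hJ⟩ := exists_good hL.irrational (hS.lift.rescale ha hq).1
      hq (n + 1)
    (half_pos hS.δpos) S.J
  refine ⟨S', hG, a, c, ha, by rw [hS'H, hS'q], hc, ?_, hf, hs, ?_, ?_, hδ, hJ⟩
  · have hq0 : (0 : ℝ) < q := by exact_mod_cast hq
    rw [hS'q]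
    exact (one_div_le_one_div hq0 (by positivity)).1 hqη
  · rw [hS'q]; exact hbad
  · rw [hS'H]; exact hclose

theorem exists_stages {τ : ℝ} (hL : Liouville τ) (r : ℕ) {H : ℝ → ℝ} (hH : IsCircleDiffeoLift H)
    {E : ℝ} (hE : 0 < E) : ∃ (S : ℕ → Stage) (a : ℕ → ℝ → ℝ) (c : ℕ → ℝ), (S 0).H = H ∧
      (S 0).δ ≤ E ∧ (∀ n, (S n).Good τ n) ∧ ∀ n, (S n).Next τ r n (S (n + 1)) (a n) (c n) := by
  obtain ⟨S₀, h1, -, h2, h3, -⟩ := exists_good hL.irrational hH one_pos 0 hE 0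
  choose! nx hnx hnx' using fun (n : ℕ) (S : Stage) (hS : S.Good τ n) => hS.exists_next hL r
  let S : ℕ → Stage := fun n => Nat.rec S₀ (fun n S => nx n S) n
  have hS : ∀ n, (S n).Good τ n := fun n => by
    induction n with
    | zero => exact h2
    | succ n ih => exact hnx n _ ih
  choose a c hac using fun n => hnx' n (S n) (hS n)
  exact ⟨S, a, c, h1, h3, hS, hac⟩

/-- A sequence of smooth functions whose consecutive terms are geometrically close in norms of
increasing order converges, with all derivatives, to a smooth function. -/
theorem exists_smooth_limit {u : ℕ → ℝ → ℝ} {δ : ℕ → ℝ} {s : ℕ} (hu : ∀ n, Sm (u n))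
    (hδ : ∀ n, 0 ≤ δ n) (hδ2 : ∀ n, δ (n + 1) ≤ δ n / 2)
    (hc : ∀ n, CrClose (n + s) (δ n) (u (n + 1)) (u n)) :
    ∃ f, Sm f ∧ ∀ k, CrClose (k + s) (2 * δ k) f (u k) := by
  have hgeo : ∀ k n, δ (n + k) ≤ δ k * (1 / 2) ^ n := fun k n => by
    induction n with
    | zero => simp
    | succ n ih =>
      rw [show n + 1 + k = n + k + 1 by ring]
      refine (hδ2 _).trans ?_
      rw [pow_succ]; linarith
  have hsum : ∀ k, Summable fun n => δ (n + k) := fun k =>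
    Summable.of_nonneg_of_le (fun n => hδ _) (hgeo k) (summable_geometric_two.mul_left _)
  have htsum : ∀ k, ∑' n, δ (n + k) ≤ 2 * δ k := fun k => by
    refine ((hsum k).tsum_le_tsum (hgeo k) (summable_geometric_two.mul_left _)).trans ?_
    rw [tsum_mul_left, tsum_geometric_two, mul_comm]
  set v : ℕ → ℝ → ℝ := fun n x => u (n + 1) x - u n x with hv
  have hvs : ∀ n, Sm (v n) := fun n => (hu _).sub (hu _)
  have hv0 : ∀ x, Summable fun n => v n x := fun x => by
    refine Summable.of_norm_bounded (hsum 0) fun n => ?_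
    have := hc n 0 (Nat.zero_le _) x
    simpa using this
  set f : ℝ → ℝ := fun x => u 0 x + ∑' n, v n x with hf
  have hfk : ∀ k, f = fun x => u k x + ∑' n, v (n + k) x := fun k => by
    funext x
    have h1 := (hv0 x).sum_add_tsum_nat_add k
    have h2 : ∑ i ∈ Finset.range k, v i x = u k x - u 0 x := Finset.sum_range_sub (fun i => u i x) k
    rw [hf]
    show u 0 x + ∑' n, v n x = _
    rw [← h1, h2]; ring
  have hb : ∀ k i n x, i ≤ k + s → ‖iteratedFDeriv ℝ i (v (n + k)) x‖ ≤ δ (n + k) :=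
    fun k i n x hi => by
      rw [norm_iteratedFDeriv_eq_norm_iteratedDeriv, Real.norm_eq_abs]
      exact hc (n + k) i (by omega) x
  have hcd : ∀ k : ℕ, ContDiff ℝ ((k + s : ℕ) : ℕ∞) fun x => ∑' n, v (n + k) x := fun k =>
    contDiff_tsum (v := fun _ n => δ (n + k)) (fun n => (hvs _).of_le (by exact_mod_cast le_top))
      (fun _ _ => hsum k) (fun i n x hi => hb k i n x (by exact_mod_cast hi))
  have hfs : Sm f := contDiff_infty.2 fun k => by
    rw [hfk k]
    refine ((hu k).of_le (by exact_mod_cast le_top)).add ((hcd k).of_le ?_)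
    exact_mod_cast Nat.le_add_right k s
  refine ⟨f, hfs, fun k i hi x => ?_⟩
  have e : (fun x => f x - u k x) = fun x => ∑' n, v (n + k) x := by
    funext x; rw [hfk k]; ring
  rw [e, ← Real.norm_eq_abs, ← norm_iteratedFDeriv_eq_norm_iteratedDeriv,
    iteratedFDeriv_tsum_apply (N := ((k + s : ℕ) : ℕ∞)) (v := fun _ n => δ (n + k))
      (fun n => (hvs _).of_le (by exact_mod_cast le_top))
      (fun _ _ => hsum k) (fun i n x hi => hb k i n x (by exact_mod_cast hi))
        (by exact_mod_cast hi)]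
  exact (tsum_of_norm_bounded (hsum k).hasSum fun n => hb k i n x hi).trans (htsum k)

theorem CrClose.abs_sub_le {s : ℕ} {ε : ℝ} {f g : ℝ → ℝ} (h : CrClose s ε f g) (x : ℝ) :
    |f x - g x| ≤ ε := by
  simpa using h 0 (Nat.zero_le _) x

theorem CrClose.abs_deriv_sub_le {s : ℕ} {ε : ℝ} {f g : ℝ → ℝ} (hf : Sm f) (hg : Sm g)
    (h : CrClose s ε f g) (hs : 1 ≤ s) (x : ℝ) : |deriv f x - deriv g x| ≤ ε := by
  have := h 1 hs x
  rwa [iteratedDeriv_one, deriv_fun_sub (Sm.diff hf x) (Sm.diff hg x)] at this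

/-- The `j`-th iterate of the diffeomorphism approximated at a stage. -/
def Stage.F (S : Stage) (τ : ℝ) (j : ℕ) (x : ℝ) : ℝ := Function.invFun S.H (S.H x + j * τ)

theorem Stage.Good.F_lift {τ : ℝ} {n : ℕ} {S : Stage} (h : S.Good τ n) (j : ℕ) :
    IsCircleDiffeoLift (S.F τ j) := h.lift.conj _

theorem Stage.Good.F_iter {τ : ℝ} {n : ℕ} {S : Stage} (h : S.Good τ n) (j : ℕ) (x : ℝ) :
    (S.F τ 1)^[j] x = S.F τ j x := by
  have e : S.F τ 1 = fun x => Function.invFun S.H (S.H x + τ) := by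
    funext x; simp [Stage.F]
  rw [e, h.lift.conj_iter]; rfl

theorem IsCircleDiffeoLift.abs_conj_sub_lt {H : ℝ → ℝ} (hH : IsCircleDiffeoLift H) (s x : ℝ) :
    |Function.invFun H (H x + s) - x - s| < 1 := by
  set y := Function.invFun H (H x + s) with hy
  have h0 : H y = H x + s := hH.apply_inv _
  set m := ⌊y - x⌋ with hm
  have h1 : x + m ≤ y := by linarith [Int.floor_le (y - x)]
  have h2 : y < x + (m + 1 : ℤ) := by push_cast; linarith [Int.lt_floor_add_one (y - x)]
  have h3 := hH.strictMono.monotone h1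
  have h4 := hH.strictMono h2
  rw [hH.add_int] at h3 h4
  push_cast at h2 h4
  rw [abs_lt]; constructor <;> linarith

/-- The data of a run of the construction. -/
structure Run (τ : ℝ) (r : ℕ) (S : ℕ → Stage) (a : ℕ → ℝ → ℝ) (c : ℕ → ℝ) : Prop where
  good : ∀ n, (S n).Good τ n
  next : ∀ n, (S n).Next τ r n (S (n + 1)) (a n) (c n)

/-- The limit diffeomorphism of a run, together with the closeness of its iterates. -/
structure RunLimit (τ : ℝ) (S : ℕ → Stage) (f : ℝ → ℝ) : Prop where
  lift : IsCircleDiffeoLift f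
  close : ∀ n, ∀ j ≤ (S n).J, ∀ x, |f^[j] x - (S n).F τ j x| ≤ 2 * (S n).δ
  deriv_close : ∀ n, ∀ j ≤ (S n).J, ∀ x,
    |deriv (f^[j]) x - deriv ((S n).F τ j) x| ≤ 2 * (S n).δ

theorem Run.J_mono {τ : ℝ} {r : ℕ} {S : ℕ → Stage} {a : ℕ → ℝ → ℝ} {c : ℕ → ℝ}
    (h : Run τ r S a c) : Monotone fun n => (S n).J :=
  monotone_nat_of_le_succ fun n => (h.next n).Jle

theorem Run.exists_limit {τ : ℝ} {r : ℕ} {S : ℕ → Stage} {a : ℕ → ℝ → ℝ} {c : ℕ → ℝ}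
    (h : Run τ r S a c) (hr : 1 ≤ r) (hpos : ∀ x, 2 * (S 0).δ < deriv ((S 0).F τ 1) x) :
    ∃ f, RunLimit τ S f ∧ CrClose r (2 * (S 0).δ) f ((S 0).F τ 1) := by
  have hFs : ∀ n j, Sm ((S n).F τ j) := fun n j => ((h.good n).F_lift j).sm
  have hδ0 : ∀ n, 0 ≤ (S n).δ := fun n => (h.good n).δpos.le
  have key : ∀ n, ∀ j ≤ (S n).J, ∃ f, Sm f ∧
      ∀ k, CrClose (k + (n + r)) (2 * (S (k + n)).δ) f ((S (k + n)).F τ j) := fun n j hj =>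
    exists_smooth_limit (u := fun k => (S (k + n)).F τ j) (δ := fun k => (S (k + n)).δ)
      (fun k => hFs _ j) (fun k => hδ0 _)
      (fun k => by rw [show k + 1 + n = k + n + 1 by ring]; exact (h.next _).δle)
      (fun k => by
        rw [show k + 1 + n = k + n + 1 by ring, ← add_assoc]
        exact (h.next _).close j (hj.trans (h.J_mono (Nat.le_add_left n k))))
  have hδlim : Tendsto (fun n => 2 * (S n).δ) atTop (𝓝 0) := by
    have hb : ∀ n, (S n).δ ≤ (S 0).δ * (1 / 2) ^ n := fun n => by
      induction n with
      | zero => simp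
      | succ n ih =>
        refine ((h.next n).δle).trans ?_
        rw [pow_succ]; linarith
    have h1 : Tendsto (fun n : ℕ => 2 * ((S 0).δ * (1 / 2 : ℝ) ^ n)) atTop
        (𝓝 (2 * ((S 0).δ * 0))) :=
      ((tendsto_pow_atTop_nhds_zero_of_lt_one (by norm_num) (by norm_num)).const_mul _).const_mul _
    rw [mul_zero, mul_zero] at h1
    exact squeeze_zero (fun n => by linarith [hδ0 n]) (fun n => by linarith [hb n]) h1
  obtain ⟨f, hf, hfc⟩ := key 0 1 (by linarith [(h.good 0).le_J])
  simp only [add_zero, zero_add] at hfc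
  have hfx : ∀ n x, |f x - (S n).F τ 1 x| ≤ 2 * (S n).δ := fun n x => (hfc n).abs_sub_le x
  have hlim : ∀ (w : ℕ → ℝ) (y : ℝ), Tendsto w atTop (𝓝 y) →
      Tendsto (fun n => (S n).F τ 1 (w n)) atTop (𝓝 (f y)) := fun w y hw => by
    have h1 : Tendsto (fun n => f (w n)) atTop (𝓝 (f y)) := (hf.continuous.tendsto y).comp hw
    have h2 : Tendsto (fun n => f (w n) - (S n).F τ 1 (w n)) atTop (𝓝 0) :=
      squeeze_zero_norm (fun n => hfx n (w n)) hδlim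
    simpa using h1.sub h2
  have hflift : IsCircleDiffeoLift f := by
    refine ⟨hf, fun x => ?_, fun x => ?_⟩
    · have h1 := hlim (fun _ => x + 1) (x + 1) tendsto_const_nhds
      have h2 := (hlim (fun _ => x) x tendsto_const_nhds).add_const 1
      refine tendsto_nhds_unique h1 (h2.congr fun n => ?_)
      exact (((h.good n).F_lift 1).2.1 x).symm
    · have h1 := (hfc 0).abs_deriv_sub_le hf (hFs 0 1) (by omega) x
      have h2 := hpos x
      rw [abs_le] at h1; linarith
  have hiter : ∀ j x, Tendsto (fun n => (S n).F τ j x) atTop (𝓝 (f^[j] x)) := fun j x => by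
    simp only [← (h.good _).F_iter]
    induction j with
    | zero => exact tendsto_const_nhds
    | succ j ih =>
      simp only [Function.iterate_succ_apply']
      exact hlim _ _ ih
  have hclose : ∀ n, ∀ j ≤ (S n).J, CrClose (n + r) (2 * (S n).δ) (f^[j]) ((S n).F τ j) := by
    intro n j hj
    obtain ⟨φ, hφ, hφc⟩ := key n j hj
    have : φ = f^[j] := by
      funext x
      refine tendsto_nhds_unique ?_ (hiter j x)
      refine (tendsto_add_atTop_iff_nat n).1 ?_
      have h2 : Tendsto (fun k => φ x - (S (k + n)).F τ j x) atTop (𝓝 0) :=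
        squeeze_zero_norm (fun k => (hφc k).abs_sub_le x) ((tendsto_add_atTop_iff_nat n).2 hδlim)
      have h3 := (tendsto_const_nhds (x := φ x)).sub h2
      simpa using h3
    have := hφc 0
    simpa [← ‹φ = f^[j]›] using this
  refine ⟨f, ⟨hflift, fun n j hj x => (hclose n j hj).abs_sub_le x, fun n j hj x =>
    (hclose n j hj).abs_deriv_sub_le (hflift.iter j).sm (hFs n j) (by omega) x⟩, ?_⟩
  simpa using hfc 0

theorem Stage.Good.one_le_M {τ : ℝ} {n : ℕ} {S : Stage} (h : S.Good τ n) : 1 ≤ S.M n := by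
  have h1 : (1 : ℝ) ≤ spd n := by exact_mod_cast one_le_spd n
  have h2 : (1 : ℝ) ≤ S.q := by exact_mod_cast h.hq
  have h3 : (1 : ℝ) ≤ 2 ^ n := one_le_pow₀ (by norm_num)
  have h4 : (1 : ℝ) ≤ S.B ^ 3 := one_le_pow₀ (by linarith [h.hB])
  have e : S.M n = 100 * (2 ^ n * S.B ^ 3 * spd n * S.q) := by rw [Stage.M]; ring
  rw [e]
  have := one_le_mul_of_one_le_of_one_le (one_le_mul_of_one_le_of_one_le
    (one_le_mul_of_one_le_of_one_le h3 h4) h1) h2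
  linarith

theorem RunLimit.tendsto {τ : ℝ} {S : ℕ → Stage} {f : ℝ → ℝ} (h : RunLimit τ S f)
    (hG : ∀ n, (S n).Good τ n) : Tendsto (fun n : ℕ => f^[n] 0 / (n : ℝ)) atTop (𝓝 τ) := by
  have hb : ∀ n : ℕ, |f^[n] 0 - n * τ| ≤ 3 := fun n => by
    have h1 := h.close n n (by linarith [(hG n).le_J]) 0
    have h2 := ((hG n).lift.abs_conj_sub_lt (n * τ) 0).le
    have h3 : (S n).δ ≤ 1 := (le_mul_of_one_le_right (hG n).δpos.le (hG n).one_le_M).trans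
        (hG n).δle
    rw [Stage.F] at h1
    rw [abs_le] at *
    constructor <;> linarith
  have h1 : Tendsto (fun n : ℕ => (3 : ℝ) / n) atTop (𝓝 0) :=
      tendsto_const_div_atTop_nhds_zero_nat 3
  have h2 : Tendsto (fun n : ℕ => f^[n] 0 / (n : ℝ) - τ) atTop (𝓝 0) := by
    refine squeeze_zero_norm' ?_ h1
    filter_upwards [eventually_gt_atTop 0] with n hn
    have hn' : (0 : ℝ) < n := by exact_mod_cast hn
    rw [Real.norm_eq_abs, show f^[n] 0 / (n : ℝ) - τ = (f^[n] 0 - n * τ) / n by field_simp,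
      abs_div, Nat.abs_cast]
    have := hb n
    gcongr
  simpa using h2.add_const τ

theorem IsCircleDiffeoLift.deriv_conj {H : ℝ → ℝ} (hH : IsCircleDiffeoLift H) (s x : ℝ) :
    deriv (fun x => Function.invFun H (H x + s)) x =
      deriv H x / deriv H (Function.invFun H (H x + s)) := by
  have h1 : HasDerivAt (fun x => H x + s) (deriv H x) x := (Sm.diff hH.sm x).hasDerivAt.add_const s
  have h2 := (Sm.diff hH.inv.sm (H x + s)).hasDerivAt
  have h3 : HasDerivAt (fun x => Function.invFun H (H x + s))
      (deriv (Function.invFun H) (H x + s) * deriv H x) x :=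
        HasDerivAt.comp (h₂ := Function.invFun H) x h2 h1
  rw [h3.deriv, hH.deriv_inv]
  rw [div_eq_mul_inv, mul_comm]

theorem Stage.Good.deriv_F {τ : ℝ} {n : ℕ} {S : Stage} (h : S.Good τ n) (j : ℕ) (x : ℝ) :
    deriv (S.F τ j) x = deriv S.H x / deriv S.H (S.F τ j x) := h.lift.deriv_conj _ x

theorem Stage.Good.inv_B_le {τ : ℝ} {n : ℕ} {S : Stage} (h : S.Good τ n) (x : ℝ) :
    S.B⁻¹ ≤ deriv S.H x :=
  inv_le_of_inv_le₀ (h.lift.pos x) (h.inv_le x)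

theorem Stage.Good.deriv_F_ge {τ : ℝ} {n : ℕ} {S : Stage} (h : S.Good τ n) (j : ℕ) (x : ℝ) :
    (S.B ^ 2)⁻¹ ≤ deriv (S.F τ j) x := by
  have hB : 0 < S.B := by linarith [h.hB]
  rw [h.deriv_F, le_div_iff₀ (h.lift.pos _), pow_two, mul_inv, mul_assoc]
  have h1 : S.B⁻¹ * deriv S.H (S.F τ j x) ≤ 1 := by
    rw [inv_mul_le_iff₀ hB, mul_one]; exact h.le _
  have h2 := h.inv_B_le x
  calc _ ≤ S.B⁻¹ * 1 := by gcongr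
    _ ≤ _ := by rwa [mul_one]

theorem Stage.Good.δ_bound {τ : ℝ} {n : ℕ} {S : Stage} (h : S.Good τ n) :
    S.δ * S.B ^ 3 ≤ 1 / (100 * 2 ^ n) := by
  have h1 : (1 : ℝ) ≤ spd n := by exact_mod_cast one_le_spd n
  have h2 : (1 : ℝ) ≤ S.q := by exact_mod_cast h.hq
  have hB : 0 < S.B := by linarith [h.hB]
  have hδ := h.δpos
  rw [le_div_iff₀ (by positivity)]
  refine le_trans ?_ h.δle
  have e : S.δ * S.M n = S.δ * S.B ^ 3 * (100 * 2 ^ n) * (spd n * S.q) := by rw [Stage.M]; ring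
  rw [e]
  exact le_mul_of_one_le_right (by positivity) (one_le_mul_of_one_le_of_one_le h1 h2)

theorem abs_log_sub_log_le {u v : ℝ} (hu : 0 < u) (h : |v - u| ≤ u / 2) :
    |Real.log v - Real.log u| ≤ 2 * (|v - u| / u) := by
  have hv : u / 2 ≤ v := by rw [abs_le] at h; linarith
  have hv0 : 0 < v := by linarith
  rw [← Real.log_div hv0.ne' hu.ne', abs_le]
  have h1 := Real.log_le_sub_one_of_pos (div_pos hv0 hu)
  have h2 := Real.one_sub_inv_le_log_of_pos (div_pos hv0 hu)
  rw [inv_div] at h2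
  have e1 : v / u - 1 = (v - u) / u := by field_simp
  have e2 : 1 - u / v = (v - u) / v := by field_simp
  have h3 : (v - u) / u ≤ |v - u| / u := by gcongr; exact le_abs_self _
  have h4 : |v - u| / v ≤ 2 * (|v - u| / u) := by
    rw [← mul_div_assoc, div_le_div_iff₀ hv0 hu]
    nlinarith [abs_nonneg (v - u)]
  have h5 : -(|v - u| / v) ≤ (v - u) / v := by
    rw [← neg_div]; gcongr; exact neg_abs_le _
  have h6 : 0 ≤ |v - u| / u := by positivity
  constructor <;> linarith

theorem RunLimit.log_deriv {τ : ℝ} {S : ℕ → Stage} {f : ℝ → ℝ} (h : RunLimit τ S f) {n : ℕ}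
    (hG : (S n).Good τ n) {j : ℕ} (hj : j ≤ (S n).J) (x : ℝ) :
    |Real.log (deriv (f^[j]) x) - (Real.log (deriv (S n).H x) - Real.log (deriv (S n).H (f^[j] x)))|
      ≤ 1 / 2 ^ n := by
  have hB := hG.hB
  have hB0 : 0 < (S n).B := by linarith
  have hδ := hG.δpos
  have h1 := h.close n j hj x
  have h2 := h.deriv_close n j hj x
  have h3 := hG.deriv_F_ge j x
  have h4 := hG.δ_bound
  have h5 := hG.logLip (f^[j] x) ((S n).F τ j x)
  have hu : 0 < deriv ((S n).F τ j) x := (hG.F_lift j).pos x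
  have hp : (1 : ℝ) ≤ 2 ^ n := one_le_pow₀ (by norm_num)
  have h100 : 1 / (100 * 2 ^ n) = 1 / 100 * (1 / (2 : ℝ) ^ n) := by field_simp
  have hp' : 1 / (2 : ℝ) ^ n ≤ 1 := by rw [div_le_one (by positivity)]; exact hp
  have hB2 : (S n).δ * (S n).B ^ 2 ≤ (S n).δ * (S n).B ^ 3 := by
    have : (S n).B ^ 2 ≤ (S n).B ^ 3 := pow_le_pow_right₀ (by linarith) (by norm_num)
    gcongr
  have hB1 : (S n).δ * (S n).B ≤ (S n).δ * (S n).B ^ 3 := by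
    have : (S n).B ≤ (S n).B ^ 3 := le_self_pow₀ (by linarith) (by norm_num)
    gcongr
  have hratio : |deriv (f^[j]) x - deriv ((S n).F τ j) x| / deriv ((S n).F τ j) x
      ≤ 2 * ((S n).δ * (S n).B ^ 2) := by
    rw [div_le_iff₀ hu]
    refine h2.trans ?_
    calc 2 * (S n).δ = 2 * ((S n).δ * (S n).B ^ 2) * ((S n).B ^ 2)⁻¹ := by field_simp
      _ ≤ _ := by gcongr
  have hsmall : |deriv (f^[j]) x - deriv ((S n).F τ j) x| ≤ deriv ((S n).F τ j) x / 2 := by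
    rw [div_le_iff₀ hu] at hratio
    refine hratio.trans ?_
    rw [div_eq_inv_mul]
    gcongr
    linarith
  have h6 := abs_log_sub_log_le hu hsmall
  rw [hG.deriv_F, Real.log_div (hG.lift.pos _).ne' (hG.lift.pos _).ne', ← hG.deriv_F] at h6
  have h7 : (S n).B * |f^[j] x - (S n).F τ j x| ≤ 2 * ((S n).δ * (S n).B) := by
    calc _ ≤ (S n).B * (2 * (S n).δ) := by gcongr
      _ = _ := by ring
  have h8 := h5.trans h7
  have h9 : 2 * ((S n).δ * (S n).B) + 4 * ((S n).δ * (S n).B ^ 2) ≤ 1 / 2 ^ n := by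
    have : (0 : ℝ) < 1 / 2 ^ n := by positivity
    linarith
  rw [abs_le] at h6 h8 ⊢
  constructor <;> linarith [h6.1, h6.2, h8.1, h8.2]

theorem lacunary_dichotomy {Δ L : ℕ → ℝ} {κ : ℝ} {N : ℕ} (hL : ∀ n, L (n + 1) = 4 * L n)
    (hL0 : 0 < L N) (h0 : |Δ N| ≤ κ) (hκ : κ ≤ L N / 6)
    (hs : ∀ n, N ≤ n → Δ (n + 1) = Δ n ∨ Δ (n + 1) = Δ n + L n ∨ Δ (n + 1) = Δ n - L n) {n : ℕ}
    (hn : N ≤ n) : |Δ n| ≤ κ ∨ L N / 2 ≤ |Δ n| := by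
  have key : L N ≤ L n ∧ |Δ n| ≤ κ + L n / 3 ∧ (|Δ n| ≤ κ ∨ L N / 2 ≤ |Δ n|) := by
    induction n, hn using Nat.le_induction with
    | base => exact ⟨le_rfl, by linarith, Or.inl h0⟩
    | succ n hn ih =>
      obtain ⟨ih1, ih2, ih3⟩ := ih
      have hL' := hL n
      refine ⟨by linarith, ?_⟩
      rcases hs n hn with h | h | h
      · rw [h]; exact ⟨by linarith, ih3⟩
      · rw [abs_le] at ih2
        have h1 : Δ n + L n ≤ |Δ (n + 1)| := by rw [h]; exact le_abs_self _
        refine ⟨?_, Or.inr (by linarith)⟩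
        rw [h, abs_le]; constructor <;> linarith
      · rw [abs_le] at ih2
        have h1 : -(Δ n - L n) ≤ |Δ (n + 1)| := by rw [h]; exact neg_le_abs _
        refine ⟨?_, Or.inr (by linarith)⟩
        rw [h, abs_le]; constructor <;> linarith
  exact key.2.2

/-- The points at which the step after stage `n` has exactly one of its two speeds. -/
def goodSet (S : ℕ → Stage) (a : ℕ → ℝ → ℝ) (c : ℕ → ℝ) (n : ℕ) : Set ℝ :=
  {x | deriv (a n) ((S (n + 1)).q * (S n).H x) = c n ∨
    deriv (a n) ((S (n + 1)).q * (S n).H x) = c n / spd (n + 1)}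

section
variable {τ : ℝ} {r : ℕ} {S : ℕ → Stage} {a : ℕ → ℝ → ℝ} {c : ℕ → ℝ}

theorem Run.deriv_succ (h : Run τ r S a c) (n : ℕ) (x : ℝ) : deriv (S (n + 1)).H x =
    deriv (a n) ((S (n + 1)).q * (S n).H x) * deriv (S n).H x := by
  rw [(h.next n).eq]
  exact ((h.good n).lift.rescale (h.next n).lift (h.good (n + 1)).hq).2 x

theorem Run.log_deriv_succ (h : Run τ r S a c) {n : ℕ} {x : ℝ} (hx : x ∈ goodSet S a c n) :
    Real.log (deriv (S (n + 1)).H x) = Real.log (deriv (S n).H x) + Real.log (c n) ∨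
    Real.log (deriv (S (n + 1)).H x) = Real.log (deriv (S n).H x) + Real.log (c n) -
      4 ^ (n + 1) * Real.log 2 := by
  have hp := ((h.good n).lift.pos x).ne'
  have hc : c n ≠ 0 := by linarith [(h.next n).one_le]
  have hs : (spd (n + 1) : ℝ) ≠ 0 := by exact_mod_cast Nat.one_le_iff_ne_zero.1 (one_le_spd (n + 1))
  rw [h.deriv_succ]
  rcases hx with hx | hx <;> rw [hx]
  · left; rw [Real.log_mul hc hp, add_comm]
  · right; rw [Real.log_mul (div_ne_zero hc hs) hp, Real.log_div hc hs, log_spd]; ring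

theorem Run.measurableSet_goodSet (h : Run τ r S a c) (n : ℕ) :
    MeasurableSet (goodSet S a c n) := by
  have hcont : Continuous fun x => deriv (a n) ((S (n + 1)).q * (S n).H x) :=
    (Sm.deriv (h.next n).lift.sm).continuous.comp
      (continuous_const.mul (h.good n).lift.sm.continuous)
  exact ((isClosed_eq hcont continuous_const).union
    (isClosed_eq hcont continuous_const)).measurableSet

theorem Run.goodSet_add_one (h : Run τ r S a c) (n : ℕ) (x : ℝ) :
    x + 1 ∈ goodSet S a c n ↔ x ∈ goodSet S a c n := by
  have hp : Function.Periodic (deriv (a n)) 1 := lift_deriv_periodic (h.next n).lift.2.1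
  have e : deriv (a n) ((S (n + 1)).q * (S n).H (x + 1)) =
      deriv (a n) ((S (n + 1)).q * (S n).H x) := by
    rw [(h.good n).lift.2.1, mul_add, (hp.nat_mul _) _]
  simp only [goodSet, Set.mem_ofPred_eq, e]

theorem Run.volume_goodSet (h : Run τ r S a c) (N : ℕ) :
    0 < volume ((⋂ m ≥ N, goodSet S a c m) ∩ Set.Ioc (0 : ℝ) 1) := by
  by_contra! h0
  have h1 : Set.Ioc (0 : ℝ) 1 ⊆ ((⋂ m ≥ N, goodSet S a c m) ∩ Set.Ioc (0 : ℝ) 1) ∪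
      ⋃ m, {x | x ∈ Set.Ioc (0 : ℝ) 1 ∧ x ∉ goodSet S a c m} := fun x hx => by
    by_cases hg : ∀ m, x ∈ goodSet S a c m
    · exact Or.inl ⟨by simp [hg], hx⟩
    · push Not at hg
      obtain ⟨m, hm⟩ := hg
      exact Or.inr (Set.mem_iUnion.2 ⟨m, hx, hm⟩)
  have h2 := (measure_mono h1 (μ := volume)).trans (measure_union_le _ _)
  rw [le_antisymm h0 bot_le, zero_add, Real.volume_Ioc] at h2
  have h3 := (measure_iUnion_le _).trans (ENNReal.tsum_le_tsum fun m => (h.next m).bad)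
  have h4 : ∑' m : ℕ, (2⁻¹ : ENNReal) ^ (m + 3) = 2⁻¹ ^ 2 := by
    have : ∀ m : ℕ, (2⁻¹ : ENNReal) ^ (m + 3) = 2⁻¹ ^ 2 * 2⁻¹ ^ (m + 1) := fun m => by ring
    simp only [this]
    rw [ENNReal.tsum_mul_left, ENNReal.tsum_geometric_add_one]
    simp [ENNReal.inv_mul_cancel]
  rw [h4] at h3
  have h5 := h2.trans h3
  rw [sub_zero, ENNReal.ofReal_one, ← ENNReal.inv_pow, ENNReal.one_le_inv] at h5
  norm_num at h5

/-- Away from `0` and `1` a positive number is not in the ratio set of a limit diffeomorphism. -/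
theorem RunLimit.exists_avoiding {f : ℝ → ℝ} (hf : RunLimit τ S f) (h : Run τ r S a c) {T : ℝ}
    (hT : 0 < T) : ∃ A : Set ℝ, MeasurableSet A ∧ (∀ x, x + 1 ∈ A ↔ x ∈ A) ∧
      0 < volume (A ∩ Set.Ioc 0 1) ∧ ∀ x ∈ A, ∀ j : ℕ, f^[j] x ∈ A →
        |Real.log (deriv (f^[j]) x)| ≤ T / 2 ∨ 2 * T ≤ |Real.log (deriv (f^[j]) x)| := by
  have hlog : 0 < Real.log 2 := Real.log_pos (by norm_num)
  obtain ⟨N, hN⟩ : ∃ N : ℕ, 1 / (2 : ℝ) ^ N ≤ T / 4 ∧ 10 * T ≤ 4 ^ (N + 1) * Real.log 2 := by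
    obtain ⟨N₁, h1⟩ := exists_nat_gt (4 / T)
    obtain ⟨N₂, h2⟩ := exists_nat_gt (10 * T / Real.log 2)
    refine ⟨N₁ + N₂, ?_, ?_⟩
    · have h3 : ((N₁ + N₂ : ℕ) : ℝ) < 2 ^ (N₁ + N₂) := by exact_mod_cast Nat.lt_two_pow_self
      push_cast at h3
      have h4 : 4 / T < 2 ^ (N₁ + N₂) := by
        have : (0 : ℝ) ≤ N₂ := Nat.cast_nonneg _
        linarith
      rw [div_lt_iff₀ hT] at h4
      rw [div_le_iff₀ (by positivity)]; linarith
    · have h3 : ((N₁ + N₂ + 1 : ℕ) : ℝ) < 4 ^ (N₁ + N₂ + 1) := by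
        exact_mod_cast Nat.lt_pow_self (by norm_num)
      push_cast at h3
      have : (0 : ℝ) ≤ N₁ := Nat.cast_nonneg _
      have h4 : 10 * T / Real.log 2 ≤ 4 ^ (N₁ + N₂ + 1) := by linarith
      rwa [div_le_iff₀ hlog] at h4
  set ℓ : ℝ → ℝ := fun x => Real.log (deriv (S N).H x) with hℓ
  have hℓc : Continuous ℓ := (Sm.deriv (h.good N).lift.sm).continuous.log
    fun x => ((h.good N).lift.pos x).ne'
  set G := ⋂ m ≥ N, goodSet S a c m with hG
  set κ := T / 4 with hκ
  set A : ℤ → Set ℝ := fun l => G ∩ {x | l * κ ≤ ℓ x ∧ ℓ x ≤ (l + 1) * κ} with hA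
  have hcover : G ∩ Set.Ioc 0 1 ⊆ ⋃ l, A l ∩ Set.Ioc 0 1 := fun x hx => by
    refine Set.mem_iUnion.2 ⟨⌊ℓ x / κ⌋, ⟨hx.1, ?_, ?_⟩, hx.2⟩
    · rw [← le_div_iff₀ (by positivity)]; exact Int.floor_le _
    · rw [← div_le_iff₀ (by positivity)]; exact (Int.lt_floor_add_one _).le
  obtain ⟨l, hl⟩ : ∃ l, 0 < volume (A l ∩ Set.Ioc 0 1) := by
    by_contra! hcon
    have := measure_iUnion_null (μ := volume) fun l => le_antisymm (hcon l) bot_le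
    exact (h.volume_goodSet N).ne' (measure_mono_null hcover this)
  have hGm : MeasurableSet G := MeasurableSet.iInter fun m => MeasurableSet.iInter fun _ =>
    h.measurableSet_goodSet m
  refine ⟨A l, hGm.inter ((isClosed_le continuous_const hℓc).inter
    (isClosed_le hℓc continuous_const)).measurableSet, fun x => ?_, hl, fun x hx j hy => ?_⟩
  · have hp : ℓ (x + 1) = ℓ x := by
      rw [hℓ]
      show Real.log (deriv (S N).H (x + 1)) = _
      rw [lift_deriv_periodic (h.good N).lift.2.1 x]
    simp only [hA, hG, Set.mem_inter_iff, Set.mem_iInter, h.goodSet_add_one, Set.mem_ofPred_eq, hp]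
  · have hgx : ∀ m, N ≤ m → x ∈ goodSet S a c m := fun m hm => Set.mem_iInter₂.1 hx.1 m hm
    have hgy : ∀ m, N ≤ m → f^[j] x ∈ goodSet S a c m := fun m hm => Set.mem_iInter₂.1 hy.1 m hm
    set n := max N j with hn
    have hNn : N ≤ n := le_max_left _ _
    have hj : j ≤ (S n).J := by
      have := (h.good n).le_J
      have := le_max_right N j
      omega
    have h1 := hf.log_deriv (h.good n) hj x
    have h2 := lacunary_dichotomy (Δ := fun m => Real.log (deriv (S m).H x) -
      Real.log (deriv (S m).H (f^[j] x))) (L := fun m => 4 ^ (m + 1) * Real.log 2) (κ := κ) (N := N)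
      (fun m => by ring) (by positivity) (by
        have h3 := hx.2.1
        have h4 := hx.2.2
        have h5 := hy.2.1
        have h6 := hy.2.2
        simp only [hℓ] at h3 h4 h5 h6
        rw [abs_le]; constructor <;> linarith) (by simp only [hκ]; linarith [hN.2])
      (fun m hm => by
        rcases h.log_deriv_succ (hgx m hm) with h3 | h3 <;>
        rcases h.log_deriv_succ (hgy m hm) with h4 | h4 <;> simp only [h3, h4]
        · left; ring
        · right; left; ring
        · right; right; ring
        · left; ring) hNn
    have h3 : 1 / (2 : ℝ) ^ n ≤ T / 4 := le_trans (by gcongr; norm_num) hN.1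
    have h4 := abs_sub_abs_le_abs_sub (Real.log (deriv (f^[j]) x))
      (Real.log (deriv (S n).H x) - Real.log (deriv (S n).H (f^[j] x)))
    have h5 := abs_sub_abs_le_abs_sub (Real.log (deriv (S n).H x) -
      Real.log (deriv (S n).H (f^[j] x))) (Real.log (deriv (f^[j]) x)) |>.trans_eq
        (abs_sub_comm _ _)
    rcases h2 with h2 | h2
    · left; simp only [hκ] at h2; linarith
    · right; linarith [hN.2]

end

theorem sub_eq_of_deriv_eq_const {φ : ℝ → ℝ} (hφ : Differentiable ℝ φ) {κ x y : ℝ} (hxy : x ≤ y)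
    (h : ∀ z ∈ Set.Icc x y, deriv φ z = κ) : φ y - φ x = κ * (y - x) := by
  rcases hxy.eq_or_lt with rfl | hlt
  · simp
  obtain ⟨z, hz, hz'⟩ := exists_deriv_eq_slope φ hlt hφ.continuous.continuousOn hφ.differentiableOn
  rw [h z ⟨hz.1.le, hz.2.le⟩, eq_div_iff (by linarith)] at hz'
  exact hz'.symm

theorem half_le_sin_of_mem {i : ℤ} {s : ℝ} (h1 : 1 / 8 ≤ s) (h2 : s ≤ 3 / 8) :
    1 / 2 ≤ Real.sin (2 * Real.pi * (i + s)) := by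
  have hπ := Real.pi_pos
  have e : 2 * Real.pi * (i + s) = 2 * Real.pi * s + i * (2 * Real.pi) := by ring
  rw [e, Real.sin_add_int_mul_two_pi, ← Real.cos_sub_pi_div_two, ← Real.cos_pi_div_three,
    ← Real.cos_abs (2 * Real.pi * s - _)]
  refine Real.cos_le_cos_of_nonneg_of_le_pi (abs_nonneg _) (by linarith) ?_
  rw [abs_le]; constructor <;> nlinarith

theorem sin_le_neg_half_of_mem {i : ℤ} {s : ℝ} (h1 : 5 / 8 ≤ s) (h2 : s ≤ 7 / 8) :
    Real.sin (2 * Real.pi * (i + s)) ≤ -(1 / 2) := by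
  have h := half_le_sin_of_mem (i := i) (s := s - 1 / 2) (by linarith) (by linarith)
  rw [show 2 * Real.pi * (i + (s - 1 / 2)) = 2 * Real.pi * (i + s) - Real.pi by ring,
    Real.sin_sub_pi] at h
  linarith

/-- The point with coordinate `s` in the `i`-th cell of the partition into fundamental domains of
the modification that leads from the stage `S` to the stage `S'`. -/
def cellPt (S S' : Stage) (i : ℤ) (s : ℝ) : ℝ := Function.invFun S.H ((i + s) / S'.q)

section
variable {τ : ℝ} {r : ℕ} {S : ℕ → Stage} {a : ℕ → ℝ → ℝ} {c : ℕ → ℝ}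

theorem Run.H_cellPt (h : Run τ r S a c) (n : ℕ) (i : ℤ) (s : ℝ) :
    (S n).H (cellPt (S n) (S (n + 1)) i s) = (i + s) / (S (n + 1)).q :=
  (h.good n).lift.apply_inv _

theorem Run.q_pos (h : Run τ r S a c) (n : ℕ) : (0 : ℝ) < (S n).q := by
  exact_mod_cast (h.good n).hq

theorem Run.cellPt_strictMono (h : Run τ r S a c) (n : ℕ) (i : ℤ) :
    StrictMono (cellPt (S n) (S (n + 1)) i) := fun s t hst => by
  have := h.q_pos (n + 1)
  refine (h.good n).lift.inv.strictMono ?_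
  gcongr

theorem Run.exists_cellPt (h : Run τ r S a c) (n : ℕ) (i : ℤ) {s t x : ℝ}
    (hs : cellPt (S n) (S (n + 1)) i s ≤ x) (ht : x ≤ cellPt (S n) (S (n + 1)) i t) :
    ∃ w, s ≤ w ∧ w ≤ t ∧ x = cellPt (S n) (S (n + 1)) i w := by
  have hq := h.q_pos (n + 1)
  have e : x = cellPt (S n) (S (n + 1)) i ((S (n + 1)).q * (S n).H x - i) := by
    rw [cellPt, add_sub_cancel, mul_div_cancel_left₀ _ hq.ne', (h.good n).lift.inv_apply]
  refine ⟨_, ?_, ?_, e⟩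
  · rw [e] at hs; exact (h.cellPt_strictMono n i).le_iff_le.1 hs
  · rw [e] at ht; exact (h.cellPt_strictMono n i).le_iff_le.1 ht

theorem Run.abs_cellPt_sub_le (h : Run τ r S a c) (n : ℕ) (i : ℤ) (s t : ℝ) :
    |cellPt (S n) (S (n + 1)) i s - cellPt (S n) (S (n + 1)) i t| ≤
      (S n).B * (|s - t| / (S (n + 1)).q) := by
  have hq := h.q_pos (n + 1)
  refine (inv_lipschitz (h.good n).lift (h.good n).inv_le _ _).trans_eq ?_
  rw [← sub_div, add_sub_add_left_eq_sub, abs_div, Nat.abs_cast]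

theorem Run.scale' (h : Run τ r S a c) (n : ℕ) :
    (S n).B * ((S n).B / (S (n + 1)).q) ≤ 1 / (2 * (n + 2)) := by
  have hq := h.q_pos (n + 1)
  rw [← mul_div_assoc, div_le_div_iff₀ hq (by positivity)]
  have := (h.next n).scale
  nlinarith

theorem Run.deriv_cellPt_le (h : Run τ r S a c) (n : ℕ) (i : ℤ) {s t : ℝ}
    (hs : s ∈ Set.Icc (0 : ℝ) 1) (ht : t ∈ Set.Icc (0 : ℝ) 1) :
    deriv (S n).H (cellPt (S n) (S (n + 1)) i s) ≤
      2 * deriv (S n).H (cellPt (S n) (S (n + 1)) i t) := by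
  have hq := h.q_pos (n + 1)
  have hB : 0 < (S n).B := by linarith [(h.good n).hB]
  have h1 := (h.good n).logLip (cellPt (S n) (S (n + 1)) i s) (cellPt (S n) (S (n + 1)) i t)
  have h2 := h.abs_cellPt_sub_le n i s t
  have h3 : |s - t| ≤ 1 := by
    rw [abs_le]; constructor <;> linarith [hs.1, hs.2, ht.1, ht.2]
  have h4 : (S n).B * |cellPt (S n) (S (n + 1)) i s - cellPt (S n) (S (n + 1)) i t| ≤
      (S n).B * ((S n).B / (S (n + 1)).q) := by
    refine mul_le_mul_of_nonneg_left (h2.trans ?_) hB.le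
    rw [div_eq_mul_one_div (S n).B]
    gcongr
  have h5 : 1 / (2 * ((n : ℝ) + 2)) ≤ 1 / 4 := by
    apply one_div_le_one_div_of_le <;> linarith [Nat.cast_nonneg (α := ℝ) n]
  have h6 := (le_abs_self _).trans (h1.trans (h4.trans ((h.scale' n).trans h5)))
  have h7 := Real.log_two_gt_d9
  have p1 := (h.good n).lift.pos (cellPt (S n) (S (n + 1)) i s)
  have p2 := (h.good n).lift.pos (cellPt (S n) (S (n + 1)) i t)
  rw [← Real.log_le_log_iff p1 (by positivity), Real.log_mul two_ne_zero p2.ne']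
  linarith

theorem Run.cellPt_sub (h : Run τ r S a c) (n : ℕ) (i : ℤ) {s t : ℝ} (hst : s ≤ t)
    (hs : 0 ≤ s) (ht : t ≤ 1) :
    ((t - s) / (2 * (deriv (S n).H (cellPt (S n) (S (n + 1)) i 0) * (S (n + 1)).q)) ≤
      cellPt (S n) (S (n + 1)) i t - cellPt (S n) (S (n + 1)) i s) ∧
    (cellPt (S n) (S (n + 1)) i t - cellPt (S n) (S (n + 1)) i s ≤
      2 * (t - s) / (deriv (S n).H (cellPt (S n) (S (n + 1)) i 0) * (S (n + 1)).q)) := by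
  have hq := h.q_pos (n + 1)
  rcases hst.eq_or_lt with rfl | hlt
  · simp
  obtain ⟨z, hz, hz'⟩ := exists_deriv_eq_slope (S n).H (h.cellPt_strictMono n i hlt)
    (h.good n).lift.sm.continuous.continuousOn (Sm.diff (h.good n).lift.sm).differentiableOn
  obtain ⟨w, hw1, hw2, rfl⟩ := h.exists_cellPt n i hz.1.le hz.2.le
  have hpos := sub_pos.2 (h.cellPt_strictMono n i hlt)
  rw [h.H_cellPt, h.H_cellPt, eq_div_iff hpos.ne', ← sub_div, add_sub_add_left_eq_sub,
    eq_div_iff hq.ne'] at hz'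
  set D := deriv (S n).H (cellPt (S n) (S (n + 1)) i 0)
  have hw : w ∈ Set.Icc (0 : ℝ) 1 := ⟨by linarith, by linarith⟩
  have h1 := h.deriv_cellPt_le n i hw (t := 0) (by simp)
  have h2 := h.deriv_cellPt_le n i (s := 0) (by simp) hw
  have hD : 0 < D := (h.good n).lift.pos _
  constructor
  · rw [div_le_iff₀ (by positivity), ← hz']
    have := mul_le_mul_of_nonneg_right h1 (mul_pos hpos hq).le
    linarith
  · rw [le_div_iff₀ (by positivity), ← hz']
    have := mul_le_mul_of_nonneg_right h2 (mul_pos hpos hq).le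
    linarith

theorem Run.H_succ_cellPt (h : Run τ r S a c) (n : ℕ) (i : ℤ) (s : ℝ) :
    (S (n + 1)).H (cellPt (S n) (S (n + 1)) i s) = a n (i + s) / (S (n + 1)).q := by
  have hq := h.q_pos (n + 1)
  rw [(h.next n).eq]
  show a n (_ * (S n).H _) / _ = _
  rw [h.H_cellPt, mul_div_cancel₀ _ hq.ne']

theorem Run.deriv_succ_cellPt (h : Run τ r S a c) (n : ℕ) (i : ℤ) (s : ℝ) :
    deriv (S (n + 1)).H (cellPt (S n) (S (n + 1)) i s) =
      deriv (a n) (i + s) * deriv (S n).H (cellPt (S n) (S (n + 1)) i s) := by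
  have hq := h.q_pos (n + 1)
  rw [h.deriv_succ, h.H_cellPt, mul_div_cancel₀ _ hq.ne']

theorem Run.H_succ_fast (h : Run τ r S a c) (n : ℕ) (i : ℤ) {s t : ℝ} (hs : 1 / 8 ≤ s)
    (hst : s ≤ t) (ht : t ≤ 3 / 8) : (S (n + 1)).H (cellPt (S n) (S (n + 1)) i t) =
      (S (n + 1)).H (cellPt (S n) (S (n + 1)) i s) + c n * (t - s) / (S (n + 1)).q := by
  rw [h.H_succ_cellPt, h.H_succ_cellPt, ← add_div]
  congr 1
  have := sub_eq_of_deriv_eq_const (Sm.diff (h.next n).lift.sm) (κ := c n) (x := i + s) (y := i + t)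
    (by linarith) fun z hz => (h.next n).fast z (by
      have := half_le_sin_of_mem (i := i) (s := z - i) (by linarith [hz.1]) (by linarith [hz.2])
      rwa [add_sub_cancel] at this)
  linarith

theorem Run.H_succ_slow (h : Run τ r S a c) (n : ℕ) (i : ℤ) {s t : ℝ} (hs : 5 / 8 ≤ s)
    (hst : s ≤ t) (ht : t ≤ 7 / 8) : (S (n + 1)).H (cellPt (S n) (S (n + 1)) i t) =
      (S (n + 1)).H (cellPt (S n) (S (n + 1)) i s) +
        c n / spd (n + 1) * (t - s) / (S (n + 1)).q := by
  rw [h.H_succ_cellPt, h.H_succ_cellPt, ← add_div]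
  congr 1
  have := sub_eq_of_deriv_eq_const (Sm.diff (h.next n).lift.sm) (κ := c n / spd (n + 1))
    (x := i + s) (y := i + t) (by linarith) fun z hz => (h.next n).slow z (by
      have := sin_le_neg_half_of_mem (i := i) (s := z - i) (by linarith [hz.1]) (by linarith [hz.2])
      rwa [add_sub_cancel] at this)
  linarith

end

theorem exists_tile_le {μ : Measure ℝ} {A : Set ℝ} {t : ℕ → ℝ} (ht : Monotone t) {K : ℕ}
    (hK : 0 < K) {b : ENNReal} (h : μ (A ∩ Set.Ioc (t 0) (t K)) ≤ K * b) (hA : MeasurableSet A) :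
    ∃ i < K, μ (A ∩ Set.Ioc (t i) (t (i + 1))) ≤ b := by
  by_contra! hcon
  have hsum : ∀ k, ∑ i ∈ Finset.range k, μ (A ∩ Set.Ioc (t i) (t (i + 1))) =
      μ (A ∩ Set.Ioc (t 0) (t k)) := fun k => by
    induction k with
    | zero => simp
    | succ k ih =>
      rw [Finset.sum_range_succ, ih, ← measure_union _ (hA.inter measurableSet_Ioc),
        ← Set.inter_union_distrib_left, Set.Ioc_union_Ioc_eq_Ioc (ht (Nat.zero_le k))
          (ht (Nat.le_succ k))]
      exact (Set.Ioc_disjoint_Ioc_of_le le_rfl).mono Set.inter_subset_right Set.inter_subset_right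
  have h1 : ∑ i ∈ Finset.range K, b < ∑ i ∈ Finset.range K, μ (A ∩ Set.Ioc (t i) (t (i + 1))) :=
    ENNReal.sum_lt_sum_of_nonempty (Finset.nonempty_range_iff.2 hK.ne')
      fun i hi => hcon i (Finset.mem_range.1 hi)
  rw [hsum, Finset.sum_const, Finset.card_range, nsmul_eq_mul] at h1
  exact (h1.trans_le h).false

theorem mem_add_int_iff {A : Set ℝ} (hA : ∀ x, x + 1 ∈ A ↔ x ∈ A) (m : ℤ) (x : ℝ) :
    x + m ∈ A ↔ x ∈ A := by
  have hp : Function.Periodic (fun x => x ∈ A) 1 := fun x => propext (hA x)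
  have := hp.int_mul m x
  rw [mul_one] at this
  exact this.to_iff

section
variable {τ : ℝ} {r : ℕ} {S : ℕ → Stage} {a : ℕ → ℝ → ℝ} {c : ℕ → ℝ}

theorem Stage.Good.M_ge {n : ℕ} {S : Stage} (h : S.Good τ n) :
    100 * (S.B ^ 3 * spd n * S.q) ≤ S.M n := by
  have hB : 0 < S.B := by linarith [h.hB]
  have h3 : (1 : ℝ) ≤ 2 ^ n := one_le_pow₀ (by norm_num)
  have e : S.M n = 100 * (S.B ^ 3 * spd n * S.q) * 2 ^ n := by rw [Stage.M]; ring
  rw [e]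
  exact le_mul_of_one_le_right (by positivity) h3

/-- Some iterate of the limit diffeomorphism carries the slow part of a cell onto a prescribed tile
of its fast part, up to a small error. -/
theorem RunLimit.exists_steering {f : ℝ → ℝ} (hf : RunLimit τ S f) (h : Run τ r S a c) (n : ℕ)
    (i : ℤ) {p : ℕ} (hp : p < spd (n + 1)) : ∃ (j : ℕ) (m : ℤ), ∀ s ∈ Set.Icc (0 : ℝ) (1 / 4),
      |f^[j] (cellPt (S n) (S (n + 1)) i (5 / 8 + s)) - m -
        cellPt (S n) (S (n + 1)) i (1 / 8 + p / (4 * spd (n + 1)) + s / spd (n + 1))| ≤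
        2 * (S (n + 1)).B / (S (n + 1)).M (n + 1) ∧
      deriv (f^[j]) (cellPt (S n) (S (n + 1)) i (5 / 8 + s)) ≤ 4 / spd (n + 1) := by
  set u := cellPt (S n) (S (n + 1)) i with hu
  have hG := h.good (n + 1)
  have hG0 := h.good n
  set S' := S (n + 1) with hS'
  set M := S'.M (n + 1) with hM
  have hM1 : 1 ≤ M := hG.one_le_M
  have hM0 : 0 < M := by linarith
  have hK1 : (1 : ℝ) ≤ spd (n + 1) := by exact_mod_cast one_le_spd (n + 1)
  set K : ℝ := ((spd (n + 1) : ℕ) : ℝ) with hK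
  have hK0 : 0 < K := by linarith
  have hq : (1 : ℝ) ≤ S'.q := by exact_mod_cast hG.hq
  have hB := hG.hB
  have hpK : (p : ℝ) / (4 * K) + 1 / (4 * K) ≤ 1 / 4 := by
    have h1 : (p : ℝ) + 1 ≤ K := by rw [hK]; exact_mod_cast hp
    rw [← add_div, div_le_iff₀ (by positivity)]; linarith
  have hp0 : 0 ≤ (p : ℝ) / (4 * K) := by positivity
  obtain ⟨j, hj, m, hjm⟩ := hG.dense (S'.H (u (1 / 8 + p / (4 * K))) - S'.H (u (5 / 8)))
  set θ := S'.H (u (1 / 8 + p / (4 * K))) - S'.H (u (5 / 8)) with hθ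
  refine ⟨j, m, fun s hs => ?_⟩
  have hsK : s / K ≤ 1 / (4 * K) := by
    rw [div_le_div_iff₀ hK0 (by positivity)]; nlinarith [hs.2]
  have hsK0 : 0 ≤ s / K := div_nonneg hs.1 hK0.le
  set x := u (5 / 8 + s) with hx
  set y := u (1 / 8 + p / (4 * K) + s / K) with hy
  have hHy : S'.H y = S'.H x + θ := by
    have e1 := h.H_succ_fast n i (s := 1 / 8 + p / (4 * K)) (t := 1 / 8 + p / (4 * K) + s / K)
      (by linarith) (by linarith) (by linarith)
    have e2 := h.H_succ_slow n i (s := 5 / 8) (t := 5 / 8 + s)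
      (by linarith) (by linarith [hs.1]) (by linarith [hs.2])
    rw [hy, hx, hu, e1, e2, hθ]
    ring
  have hyx : y = Function.invFun S'.H (S'.H x + θ) := by rw [← hHy, hG.lift.inv_apply]
  have hFm : S'.F τ j x - m = Function.invFun S'.H (S'.H x + (j * τ - m)) := by
    have := hG.lift.inv.add_int (S'.H x + j * τ) (-m)
    push_cast at this
    rw [Stage.F, sub_eq_add_neg, ← this]
    congr 1; ring
  have hd1 : |S'.F τ j x - m - y| * M ≤ S'.B := by
    rw [hFm, hyx]
    have := inv_lipschitz hG.lift hG.inv_le (S'.H x + (j * τ - m)) (S'.H x + θ)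
    rw [show S'.H x + (j * τ - m) - (S'.H x + θ) = j * τ - θ - m by ring] at this
    calc _ ≤ S'.B * |j * τ - θ - m| * M := by gcongr
      _ = S'.B * (|j * τ - θ - m| * M) := by ring
      _ ≤ S'.B * 1 := by gcongr
      _ = _ := mul_one _
  have hd2 : |f^[j] x - S'.F τ j x| * M ≤ 2 := by
    calc _ ≤ 2 * S'.δ * M := by
          have := hf.close (n + 1) j hj x
          gcongr
      _ ≤ 2 := by linarith [hG.δle]
  have hd : |f^[j] x - m - y| ≤ 2 * S'.B / M := by
    rw [le_div_iff₀ hM0]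
    have : |f^[j] x - m - y| ≤ |f^[j] x - S'.F τ j x| + |S'.F τ j x - m - y| := by
      have := abs_add_le (f^[j] x - S'.F τ j x) (S'.F τ j x - m - y)
      rwa [show f^[j] x - S'.F τ j x + (S'.F τ j x - m - y) = f^[j] x - m - y by ring] at this
    have := mul_le_mul_of_nonneg_right this hM0.le
    linarith
  refine ⟨hd, ?_⟩
  have hlog := hf.log_deriv hG hj x
  have hper : deriv S'.H (f^[j] x - m) = deriv S'.H (f^[j] x) := by
    have hp : Function.Periodic (deriv S'.H) 1 := lift_deriv_periodic hG.lift.2.1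
    have := hp.sub_int_mul_eq (x := f^[j] x) m
    rwa [mul_one] at this
  have hl2 := hG.logLip (f^[j] x - m) y
  rw [hper] at hl2
  have hsmall : S'.B * |f^[j] x - m - y| ≤ 1 / 50 := by
    calc _ ≤ S'.B * (2 * S'.B / M) := by gcongr
      _ ≤ 1 / 50 := by
        rw [← mul_div_assoc, div_le_iff₀ hM0]
        have h1 := hG.M_ge
        have h2 : S'.B ^ 2 * 1 ≤ S'.B ^ 2 * (S'.B * (K * S'.q)) := by
          have : 1 ≤ S'.B * (K * S'.q) :=
            one_le_mul_of_one_le_of_one_le (by linarith) (one_le_mul_of_one_le_of_one_le hK1 hq)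
          gcongr
        nlinarith
  have hDx : deriv S'.H x = c n / K * deriv (S n).H x := by
    rw [hx, hu, h.deriv_succ_cellPt, (h.next n).slow _
      (sin_le_neg_half_of_mem (by linarith [hs.1]) (by linarith [hs.2]))]
  have hDy : deriv S'.H y = c n * deriv (S n).H y := by
    rw [hy, hu, h.deriv_succ_cellPt, (h.next n).fast _
      (half_le_sin_of_mem (by linarith) (by linarith))]
  have hc : 0 < c n := by linarith [(h.next n).one_le]
  have hD : deriv (S n).H x ≤ 2 * deriv (S n).H y :=
    h.deriv_cellPt_le n i ⟨by linarith [hs.1], by linarith [hs.2]⟩ ⟨by linarith, by linarith⟩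
  have px := hG0.lift.pos x
  have py := hG0.lift.pos y
  have hlx : Real.log (deriv S'.H x) ≤ Real.log (deriv S'.H y) + Real.log 2 - Real.log K := by
    rw [hDx, hDy, Real.log_mul (by positivity) px.ne', Real.log_mul hc.ne' py.ne',
      Real.log_div hc.ne' hK0.ne']
    have := Real.log_le_log px hD
    rw [Real.log_mul two_ne_zero py.ne'] at this
    linarith
  have hn : 1 / (2 : ℝ) ^ (n + 1) ≤ 1 / 2 := by
    apply one_div_le_one_div_of_le (by norm_num)
    exact le_self_pow₀ (by norm_num) (by omega)
  have h2 := Real.log_two_gt_d9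
  have h4 : Real.log 4 = 2 * Real.log 2 := by
    rw [show (4 : ℝ) = 2 ^ 2 by norm_num, Real.log_pow]; norm_num
  rw [← Real.log_le_log_iff ((hf.lift.iter j).pos x) (by positivity),
    Real.log_div (by norm_num) hK0.ne', h4]
  have h5 := (abs_le.1 hlog).2
  have h6 := (abs_le.1 (hl2.trans hsmall)).1
  linarith

/-- A set that almost fills a cell contains many points that return to it strongly contracted. -/
theorem RunLimit.exists_return {f : ℝ → ℝ} (hf : RunLimit τ S f) (h : Run τ r S a c) (n : ℕ)
    (i : ℤ) {A : Set ℝ} (hA : MeasurableSet A) (hA1 : ∀ x, x + 1 ∈ A ↔ x ∈ A)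
    (hAJ : volume (Aᶜ ∩ Set.Icc (cellPt (S n) (S (n + 1)) i 0) (cellPt (S n) (S (n + 1)) i 1)) ≤
      ENNReal.ofReal
        ((cellPt (S n) (S (n + 1)) i 1 - cellPt (S n) (S (n + 1)) i 0) / 200)) {ε : ℝ}
    (hε : 4 / spd (n + 1) < ε) :
    ∃ j : ℕ, 0 < volume {x | x ∈ A ∧ f^[j] x ∈ A ∧ deriv (f^[j]) x < ε} := by
  set u := cellPt (S n) (S (n + 1)) i with hu
  have hG := h.good (n + 1)
  have hum := h.cellPt_strictMono n i
  set S' := S (n + 1) with hS'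
  set M := S'.M (n + 1) with hM
  have hM0 : 0 < M := by linarith [hG.one_le_M]
  have hKN : 0 < spd (n + 1) := one_le_spd (n + 1)
  have hK1 : (1 : ℝ) ≤ spd (n + 1) := by exact_mod_cast one_le_spd (n + 1)
  set K : ℝ := ((spd (n + 1) : ℕ) : ℝ) with hK
  have hK0 : 0 < K := by linarith
  have hq : (1 : ℝ) ≤ S'.q := by exact_mod_cast hG.hq
  have hB := hG.hB
  set l := 1 / (deriv (S n).H (u 0) * S'.q) with hl
  have hD0 : 0 < deriv (S n).H (u 0) := (h.good n).lift.pos _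
  have hl0 : 0 < l := by positivity
  have hlen : ∀ s t, 0 ≤ s → s ≤ t → t ≤ 1 →
      (t - s) * l / 2 ≤ u t - u s ∧ u t - u s ≤ 2 * (t - s) * l := fun s t h1 h2 h3 => by
    have := h.cellPt_sub n i h2 h1 h3
    refine ⟨le_of_eq_of_le ?_ this.1, this.2.trans_eq ?_⟩
    · show _ = (t - s) / (2 * (deriv (S n).H (u 0) * S'.q))
      rw [hl]; field_simp
    · show 2 * (t - s) / (deriv (S n).H (u 0) * S'.q) = _
      rw [hl]; field_simp
  have hAJ' : ∀ I ⊆ Set.Icc (u 0) (u 1), volume (Aᶜ ∩ I) ≤ ENNReal.ofReal (l / 100) :=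
      fun I hI => by
    refine (measure_mono (Set.inter_subset_inter_right _ hI)).trans (hAJ.trans ?_)
    refine ENNReal.ofReal_le_ofReal ?_
    have := (hlen 0 1 le_rfl zero_le_one le_rfl).2
    linarith
  have hsub : ∀ s t, 0 ≤ s → t ≤ 1 → Set.Icc (u s) (u t) ⊆ Set.Icc (u 0) (u 1) := fun s t h1 h2 =>
    Set.Icc_subset_Icc (hum.monotone h1) (hum.monotone h2)
  obtain ⟨p, hp, hpA⟩ := exists_tile_le (μ := volume) (A := Aᶜ)
    (t := fun p : ℕ => u (1 / 8 + p / (4 * K)))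
    (fun p p' hpp => hum.monotone (by gcongr)) hKN (b := ENNReal.ofReal (l / (100 * K))) (by
      refine (hAJ' _ (Set.Ioc_subset_Icc_self.trans (hsub _ _ (by positivity) ?_))).trans_eq ?_
      · rw [← hK]
        have : K / (4 * K) = 1 / 4 := by field_simp
        rw [this]; norm_num
      · rw [← ENNReal.ofReal_natCast, ← hK, ← ENNReal.ofReal_mul hK0.le]
        congr 1; field_simp) hA.compl
  obtain ⟨j, m, hjm⟩ := hf.exists_steering h n i hp
  rw [← hu, ← hS', ← hM, ← hK] at hjm
  refine ⟨j, pos_iff_ne_zero.2 fun h0 => ?_⟩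
  have hpK : (p : ℝ) / (4 * K) + 1 / (4 * K) ≤ 1 / 4 := by
    have h1 : (p : ℝ) + 1 ≤ K := by rw [hK]; exact_mod_cast hp
    rw [← add_div, div_le_iff₀ (by positivity)]; linarith
  have hp0 : 0 ≤ (p : ℝ) / (4 * K) := by positivity
  have hk0 : 0 < 1 / (4 * K) := by positivity
  set t := u (1 / 8 + p / (4 * K)) with ht
  set t' := u (1 / 8 + p / (4 * K) + 1 / (4 * K)) with ht'
  have e' : u (1 / 8 + ((p + 1 : ℕ) : ℝ) / (4 * K)) = t' := by rw [ht']; congr 1; push_cast; ring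
  rw [e'] at hpA
  set κ := 2 * S'.B / M with hκ
  have hκ0 : 0 < κ := by positivity
  have htt : l / (8 * K) ≤ t' - t := by
    refine le_of_eq_of_le ?_ (hlen _ _ (by positivity) (by linarith) (by linarith)).1
    field_simp; ring
  have htB : 1 / (4 * K * S'.q) ≤ S'.B * (t' - t) := by
    have h1 := h.H_succ_fast n i (s := 1 / 8 + p / (4 * K)) (t := 1 / 8 + p / (4 * K) + 1 / (4 * K))
      (by linarith) (by linarith) (by linarith)
    have h2 : S'.H t' - S'.H t ≤ S'.B * (t' - t) :=
      image_sub_le_mul_sub_of_deriv_le (Sm.diff hG.lift.sm) (fun x => hG.le x)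
        (hum.monotone (by linarith))
    refine le_trans ?_ h2
    rw [ht', ht, h1, add_sub_cancel_left, add_sub_cancel_left]
    have := (h.next n).one_le
    rw [mul_one_div, div_div]
    gcongr
  have hκt : 4 * κ ≤ t' - t := by
    have h1 := hG.M_ge
    have h2 : 4 * κ * S'.B ≤ 1 / (4 * K * S'.q) := by
      rw [le_div_iff₀ (by positivity), hκ]
      have e : 4 * (2 * S'.B / M) * S'.B * (4 * K * S'.q) =
          32 * (S'.B ^ 2 * K * S'.q) / M := by ring
      rw [e, div_le_one hM0]
      have h3 : S'.B ^ 2 * K * S'.q ≤ S'.B ^ 3 * K * S'.q := by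
        have : S'.B ^ 2 ≤ S'.B ^ 3 := pow_le_pow_right₀ (by linarith) (by norm_num)
        gcongr
      have h4 : 0 < S'.B ^ 3 * K * S'.q := by positivity
      linarith
    have h3 := h2.trans htB
    have h4 : 0 < S'.B := by linarith
    rw [mul_comm] at h3
    exact le_of_mul_le_mul_left h3 h4
  set C := Set.Icc (u (5 / 8)) (u (7 / 8)) with hC
  have hCu : ∀ x ∈ C, ∃ s ∈ Set.Icc (0 : ℝ) (1 / 4), x = u (5 / 8 + s) := fun x hx => by
    obtain ⟨w, hw1, hw2, rfl⟩ := h.exists_cellPt n i hx.1 hx.2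
    exact ⟨w - 5 / 8, ⟨by linarith, by linarith⟩, by rw [add_sub_cancel]⟩
  have hdC : ∀ x ∈ C, deriv (f^[j]) x ≤ 4 / K := fun x hx => by
    obtain ⟨s, hs, rfl⟩ := hCu x hx
    exact (hjm s hs).2
  have hfj := hf.lift.iter j
  have hLip : LipschitzOnWith (4 / K).toNNReal (f^[j]) C :=
    (convex_Icc _ _).lipschitzOnWith_of_nnnorm_deriv_le (fun x _ => Sm.diff hfj.sm x) fun x hx => by
      rw [← NNReal.coe_le_coe, coe_nnnorm, Real.norm_eq_abs, abs_of_pos (hfj.pos x),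
        Real.coe_toNNReal _ (by positivity)]
      exact hdC x hx
  set E := (Aᶜ ∩ C) ∪ ({x | x ∈ A ∧ f^[j] x ∈ A ∧ deriv (f^[j]) x < ε} ∩ C) with hE
  have hEC : E ⊆ C := Set.union_subset Set.inter_subset_right Set.inter_subset_right
  have hEv : volume E ≤ ENNReal.ofReal (l / 100) := by
    refine (measure_union_le _ _).trans ?_
    rw [measure_mono_null Set.inter_subset_left h0, add_zero]
    exact hAJ' _ (hsub _ _ (by norm_num) (by norm_num))
  have hcov : Set.Icc (t + κ) (t' - κ) ⊆ (Aᶜ ∩ Set.Ioc t t') ∪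
      (fun z : ℝ => z + m) ⁻¹' (f^[j] '' E) := fun z hz => by
    have hl := (abs_le.1 (hjm 0 ⟨le_rfl, by norm_num⟩).1).2
    have hr := (abs_le.1 (hjm (1 / 4) ⟨by norm_num, le_rfl⟩).1).1
    have er : 1 / 4 / K = 1 / (4 * K) := by field_simp
    rw [zero_div, add_zero, add_zero, ← ht] at hl
    rw [er, ← ht', show (5 / 8 + 1 / 4 : ℝ) = 7 / 8 by norm_num] at hr
    obtain ⟨x, hx, hxz⟩ := intermediate_value_Icc (hum.monotone (by norm_num))
      hfj.sm.continuous.continuousOn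
      (show z + m ∈ Set.Icc (f^[j] (u (5 / 8))) (f^[j] (u (7 / 8))) from
        ⟨by linarith [hz.1], by linarith [hz.2]⟩)
    by_cases hzA : z ∈ A
    · right
      refine ⟨x, ?_, hxz⟩
      by_cases hxA : x ∈ A
      · refine Or.inr ⟨⟨hxA, ?_, (hdC x hx).trans_lt hε⟩, hx⟩
        rw [hxz]; exact (mem_add_int_iff hA1 m z).2 hzA
      · exact Or.inl ⟨hxA, hx⟩
    · exact Or.inl ⟨hzA, by linarith [hz.1], by linarith [hz.2]⟩
  have hv := (measure_mono hcov (μ := volume)).trans (measure_union_le _ _)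
  rw [Real.volume_Icc, measure_preimage_add_right] at hv
  have hv2 := hv.trans (add_le_add hpA
    ((volume_image_le (hLip.mono hEC)).trans (mul_le_mul_right hEv _)))
  rw [← ENNReal.ofReal, ← ENNReal.ofReal_mul (by positivity),
    ← ENNReal.ofReal_add (by positivity) (by positivity),
    ENNReal.ofReal_le_ofReal_iff (by positivity)] at hv2
  have e2 : l / (100 * K) + 4 / K * (l / 100) = 5 * (l / (100 * K)) := by field_simp; ring
  have e3 : l / (8 * K) = 25 / 2 * (l / (100 * K)) := by field_simp; norm_num
  have h6 : 0 < l / (100 * K) := by positivity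
  rw [e2] at hv2
  rw [e3] at htt
  linarith

end

theorem eventually_volume_compl_le {A : Set ℝ} (hA : MeasurableSet A) (hA0 : 0 < volume A) :
    ∃ x : ℝ, ∀ b e : ℕ → ℝ, (∀ n, b n < e n) → (∀ n, x ∈ Set.Icc (b n) (e n)) →
      Tendsto (fun n => e n - b n) atTop (𝓝 0) → ∀ η : ℝ, 0 < η → η < 1 →
      ∀ᶠ n in atTop, volume (Aᶜ ∩ Set.Icc (b n) (e n)) ≤ ENNReal.ofReal (η * (e n - b n)) := by
  have hae := IsUnifLocDoublingMeasure.ae_tendsto_measure_inter_div (volume : Measure ℝ) A 1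
  have hne : (ae (volume.restrict A)).NeBot := by
    rw [ae_neBot, Ne, Measure.restrict_eq_zero]; exact hA0.ne'
  obtain ⟨x, hx⟩ := hae.exists
  refine ⟨x, fun b e hbe hxI hlim η hη hη1 => ?_⟩
  have hI : ∀ n, Metric.closedBall ((b n + e n) / 2) ((e n - b n) / 2) = Set.Icc (b n) (e n) :=
    fun n => by rw [Real.closedBall_eq_Icc]; congr 1 <;> ring
  have h1 := hx (l := atTop) (fun n => (b n + e n) / 2) (fun n => (e n - b n) / 2) (by
    refine tendsto_nhdsWithin_iff.2 ⟨?_, Eventually.of_forall fun n => ?_⟩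
    · simpa using hlim.div_const 2
    · have := hbe n
      show 0 < (e n - b n) / 2
      linarith) (Eventually.of_forall fun n => by rw [one_mul, hI]; exact hxI n)
  simp only [hI] at h1
  have h2 : ENNReal.ofReal (1 - η) < 1 := by
    rw [← ENNReal.ofReal_one, ENNReal.ofReal_lt_ofReal_iff one_pos]; linarith
  filter_upwards [h1.eventually (lt_mem_nhds h2)] with n hn
  have hpos : 0 < e n - b n := sub_pos.2 (hbe n)
  rw [Real.volume_Icc] at hn
  have h3 : ENNReal.ofReal ((1 - η) * (e n - b n)) ≤ volume (A ∩ Set.Icc (b n) (e n)) := by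
    rw [ENNReal.ofReal_mul (by linarith)]
    exact (ENNReal.mul_lt_of_lt_div hn).le
  by_contra! hcon
  have h4 := ENNReal.add_lt_add_of_lt_of_le ENNReal.ofReal_ne_top hcon h3
  rw [← ENNReal.ofReal_add (by positivity) (mul_nonneg (by linarith) hpos.le),
    Set.inter_comm Aᶜ, Set.inter_comm A, add_comm (volume _), ← Set.sdiff_eq,
    measure_inter_add_sdiff _ hA, Real.volume_Icc] at h4
  exact h4.ne (by congr 1; ring)

section
variable {τ : ℝ} {r : ℕ} {S : ℕ → Stage} {a : ℕ → ℝ → ℝ} {c : ℕ → ℝ}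

theorem lt_spd (n : ℕ) : n < spd n :=
  (Nat.lt_pow_self (by norm_num : 1 < 4)).trans Nat.lt_two_pow_self

theorem RunLimit.exists_contraction {f : ℝ → ℝ} (hf : RunLimit τ S f) (h : Run τ r S a c)
    {A : Set ℝ} (hA : MeasurableSet A) (hA1 : ∀ x, x + 1 ∈ A ↔ x ∈ A) (hA0 : 0 < volume A) {ε : ℝ}
    (hε : 0 < ε) : ∃ j : ℕ, 0 < volume {x | x ∈ A ∧ f^[j] x ∈ A ∧ deriv (f^[j]) x < ε} := by
  obtain ⟨x, hx⟩ := eventually_volume_compl_le hA hA0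
  set i : ℕ → ℤ := fun n => ⌊(S (n + 1)).q * (S n).H x⌋ with hi
  have hxu : ∀ n, x = cellPt (S n) (S (n + 1)) (i n) (Int.fract ((S (n + 1)).q * (S n).H x)) :=
    fun n => by
      rw [cellPt, hi, Int.floor_add_fract, mul_div_cancel_left₀ _ (h.q_pos (n + 1)).ne',
        (h.good n).lift.inv_apply]
  have hmono := fun n => h.cellPt_strictMono n (i n)
  have hlim : Tendsto (fun n => cellPt (S n) (S (n + 1)) (i n) 1 -
      cellPt (S n) (S (n + 1)) (i n) 0) atTop (𝓝 0) := by
    refine squeeze_zero (fun n => (sub_pos.2 (hmono n one_pos)).le) (fun n => ?_)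
      (tendsto_one_div_add_atTop_nhds_zero_nat (𝕜 := ℝ))
    refine (le_abs_self _).trans ((h.abs_cellPt_sub_le n (i n) 1 0).trans ?_)
    have hB := (h.good n).hB
    have hq := h.q_pos (n + 1)
    have h1 := h.scale' n
    have h2 : 1 / (2 * ((n : ℝ) + 2)) ≤ 1 / (n + 1) := by
      apply one_div_le_one_div_of_le <;> linarith [Nat.cast_nonneg (α := ℝ) n]
    refine le_trans ?_ (h1.trans h2)
    rw [sub_zero, abs_one]
    have : (1 : ℝ) / (S (n + 1)).q ≤ (S n).B / (S (n + 1)).q := by gcongr; linarith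
    gcongr
  have hev := hx (fun n => cellPt (S n) (S (n + 1)) (i n) 0)
    (fun n => cellPt (S n) (S (n + 1)) (i n) 1) (fun n => hmono n one_pos)
    (fun n => by
      have h0 := (hmono n).monotone (Int.fract_nonneg ((S (n + 1)).q * (S n).H x))
      have h1 := (hmono n).monotone (Int.fract_lt_one ((S (n + 1)).q * (S n).H x)).le
      rw [← hxu n] at h0 h1
      exact ⟨h0, h1⟩) hlim (1 / 200) (by norm_num) (by norm_num)
  obtain ⟨N, hN⟩ := exists_nat_gt (4 / ε)
  obtain ⟨n, hn, hnN⟩ := (hev.and (eventually_ge_atTop N)).exists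
  refine hf.exists_return h n (i n) hA hA1 (hn.trans_eq (by congr 1; ring)) ?_
  have h1 : (N : ℝ) < spd (n + 1) := by
    exact_mod_cast (hnN.trans (Nat.le_succ n)).trans_lt (lt_spd (n + 1))
  rw [div_lt_iff₀ hε] at hN
  rw [div_lt_iff₀ (by linarith [Nat.cast_nonneg (α := ℝ) N])]
  nlinarith

end

theorem exists_circle_set {A : Set ℝ} (hA : MeasurableSet A) (hA1 : ∀ x, x + 1 ∈ A ↔ x ∈ A) :
    ∃ A' : Set UnitAddCircle, MeasurableSet A' ∧ ∀ x : ℝ, (x : UnitAddCircle) ∈ A' ↔ x ∈ A := by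
  refine ⟨(fun z => ((AddCircle.measurableEquivIoc (1 : ℝ) 0 z : Set.Ioc (0 : ℝ) (0 + 1)) :
      ℝ)) ⁻¹' A,
    (measurable_subtype_coe.comp (AddCircle.measurableEquivIoc (1 : ℝ) 0).measurable) hA,
    fun x => ?_⟩
  set y : ℝ := ((AddCircle.measurableEquivIoc (1 : ℝ) 0 (x : UnitAddCircle) :
    Set.Ioc (0 : ℝ) (0 + 1)) : ℝ) with hy
  have h1 : (y : UnitAddCircle) = (x : UnitAddCircle) := AddCircle.coe_equivIoc
  have h2 : ((y - x : ℝ) : UnitAddCircle) = 0 := by rw [AddCircle.coe_sub, h1, sub_self]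
  obtain ⟨m, hm⟩ := (AddCircle.coe_eq_zero_iff (1 : ℝ)).1 h2
  have h3 : y = x + m := by rw [zsmul_eq_mul, mul_one] at hm; linarith
  show y ∈ A ↔ x ∈ A
  rw [h3, mem_add_int_iff hA1]

theorem volume_circle {A : Set UnitAddCircle} (hA : MeasurableSet A) :
    volume A = volume (((fun x : ℝ => (x : UnitAddCircle)) ⁻¹' A) ∩ Set.Ioc 0 1) := by
  have h := AddCircle.measurePreserving_mk (1 : ℝ) 0
  rw [← h.measure_preimage hA.nullMeasurableSet, Measure.restrict_apply (h.measurable hA), zero_add]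

theorem volume_inter_Ioc_pos {A : Set ℝ} (hA1 : ∀ x, x + 1 ∈ A ↔ x ∈ A) (hA0 : 0 < volume A) :
    0 < volume (A ∩ Set.Ioc 0 1) := by
  rw [pos_iff_ne_zero]
  intro h0
  have hcov : A ⊆ ⋃ m : ℤ, (fun x : ℝ => x + m) ⁻¹' (A ∩ Set.Ioc 0 1) := fun x hx => by
    obtain ⟨m, hm, -⟩ := existsUnique_add_zsmul_mem_Ioc (one_pos : (0 : ℝ) < 1) x 0
    rw [zsmul_eq_mul, mul_one, zero_add] at hm
    exact Set.mem_iUnion.2 ⟨m, (mem_add_int_iff hA1 m x).2 hx, hm⟩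
  refine hA0.ne' (measure_mono_null hcov (measure_iUnion_null fun m => ?_))
  rw [measure_preimage_add_right, h0]

theorem IsCircleDiffeoLift.lift_zpow {f : ℝ → ℝ} (hf : IsCircleDiffeoLift f) (i : ℤ) :
    IsCircleDiffeoLift (zpowLift f i) := by
  unfold zpowLift
  split_ifs
  exacts [hf.iter _, hf.inv.iter _]

theorem zpowLift_natCast (f : ℝ → ℝ) (j : ℕ) : zpowLift f j = f^[j] := by
  simp [zpowLift]

theorem exists_circle_iterates {f : ℝ → ℝ} (hf : IsCircleDiffeoLift f) :
    ∃ (Fz : ℤ → UnitAddCircle → UnitAddCircle) (D : ℤ → UnitAddCircle → ℝ),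
      (∀ i : ℤ, ∀ x : ℝ, Fz i ↑x = ↑(zpowLift f i x)) ∧
      ∀ i : ℤ, ∀ x : ℝ, D i ↑x = deriv (zpowLift f i) x := by
  have h1 : ∀ i : ℤ, Function.Periodic (fun x : ℝ => (zpowLift f i x : UnitAddCircle)) 1 :=
    fun i x => by
      show (zpowLift f i (x + 1) : UnitAddCircle) = _
      rw [(hf.lift_zpow i).2.1, AddCircle.coe_add, AddCircle.coe_period, add_zero]
  have h2 : ∀ i : ℤ, Function.Periodic (deriv (zpowLift f i)) 1 :=
    fun i => lift_deriv_periodic (hf.lift_zpow i).2.1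
  exact ⟨fun i => (h1 i).lift, fun i => (h2 i).lift, fun i x => (h1 i).lift_coe x,
    fun i x => (h2 i).lift_coe x⟩

/-- A set avoided by the logarithmic derivatives of the forward returns is also avoided by those
of the backward returns. -/
theorem IsCircleDiffeoLift.zpowLift_avoid {f : ℝ → ℝ} (hf : IsCircleDiffeoLift f) {A : Set ℝ}
    {s t : ℝ} (h : ∀ x ∈ A, ∀ j : ℕ, f^[j] x ∈ A → |Real.log (deriv (f^[j]) x)| ≤ s ∨
      t ≤ |Real.log (deriv (f^[j]) x)|) {x : ℝ} (hx : x ∈ A) {i : ℤ} (hi : zpowLift f i x ∈ A) :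
    |Real.log (deriv (zpowLift f i) x)| ≤ s ∨ t ≤ |Real.log (deriv (zpowLift f i) x)| := by
  unfold zpowLift at hi ⊢
  split_ifs at hi ⊢
  · exact h x hx _ hi
  · set j := (-i).toNat
    have hfg : Function.RightInverse (Function.invFun f)^[j] f^[j] :=
      Function.RightInverse.iterate hf.apply_inv j
    have hinv : Function.invFun f^[j] = (Function.invFun f)^[j] := by
      funext y
      rw [← hfg y, (hf.iter j).inv_apply, hfg y]
    rw [← hinv] at hi ⊢
    rw [(hf.iter j).deriv_inv, Real.log_inv, abs_neg]
    exact h _ hi j (by rwa [(hf.iter j).apply_inv])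

section
variable {τ : ℝ} {r : ℕ} {S : ℕ → Stage} {a : ℕ → ℝ → ℝ} {c : ℕ → ℝ} {f : ℝ → ℝ}
  {Fz : ℤ → UnitAddCircle → UnitAddCircle} {D : ℤ → UnitAddCircle → ℝ}

theorem RunLimit.ratioSet_subset (hf : RunLimit τ S f) (h : Run τ r S a c)
    (hF : ∀ i : ℤ, ∀ x : ℝ, Fz i ↑x = ↑(zpowLift f i x))
    (hD : ∀ i : ℤ, ∀ x : ℝ, D i ↑x = deriv (zpowLift f i) x) : ratioSet Fz D ⊆ {0, 1} := by
  rintro t ⟨ht0, ht⟩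
  by_contra! hcon
  simp only [Set.mem_insert_iff, Set.mem_singleton_iff, not_or] at hcon
  have htpos : 0 < t := lt_of_le_of_ne ht0 (Ne.symm hcon.1)
  have hT : 0 < |Real.log t| := abs_pos.2 (Real.log_ne_zero_of_pos_of_ne_one htpos hcon.2)
  obtain ⟨A, hA, hA1, hA0, hav⟩ := hf.exists_avoiding h hT
  obtain ⟨A', hA', hmem⟩ := exists_circle_set hA hA1
  have hvol : 0 < volume A' := by
    rw [volume_circle hA']
    convert hA0 using 3
    ext x
    exact hmem x
  obtain ⟨ε, hε, hlog⟩ := Metric.continuousAt_iff.1 (Real.continuousAt_log hcon.1) _ (half_pos hT)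
  obtain ⟨B, -, hBA, hB0, i, hi, hBD⟩ := ht A' hA' hvol ε hε
  obtain ⟨z, hz⟩ := nonempty_of_measure_ne_zero hB0.ne'
  obtain ⟨x, rfl⟩ := QuotientAddGroup.mk_surjective z
  have hx : x ∈ A := (hmem x).1 (hBA hz)
  have hix : zpowLift f i x ∈ A := by
    rw [← hmem, ← hF]
    exact hi ⟨_, hz, rfl⟩
  have h1 := hBD _ hz
  erw [hD] at h1
  have h2 := hlog (by rwa [Real.dist_eq])
  rw [Real.dist_eq] at h2
  have h3 := abs_sub_abs_le_abs_sub (Real.log (deriv (zpowLift f i) x)) (Real.log t)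
  have h4 := abs_sub_abs_le_abs_sub (Real.log t) (Real.log (deriv (zpowLift f i) x))
  rw [abs_sub_comm] at h4
  rcases hf.lift.zpowLift_avoid hav hx hix with h5 | h5 <;> linarith

theorem one_mem_ratioSet (hF : ∀ i : ℤ, ∀ x : ℝ, Fz i ↑x = ↑(zpowLift f i x))
    (hD : ∀ i : ℤ, ∀ x : ℝ, D i ↑x = deriv (zpowLift f i) x) : 1 ∈ ratioSet Fz D := by
  refine ⟨zero_le_one, fun A hA hA0 ε hε => ⟨A, hA, subset_rfl, hA0, 0, ?_, fun z _ => ?_⟩⟩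
  · rintro _ ⟨z, hz, rfl⟩
    obtain ⟨x, rfl⟩ := QuotientAddGroup.mk_surjective z
    erw [hF]
    simpa [zpowLift] using hz
  · obtain ⟨x, rfl⟩ := QuotientAddGroup.mk_surjective z
    erw [hD]
    simpa [zpowLift] using hε

theorem RunLimit.zero_mem_ratioSet (hf : RunLimit τ S f) (h : Run τ r S a c)
    (hF : ∀ i : ℤ, ∀ x : ℝ, Fz i ↑x = ↑(zpowLift f i x))
    (hD : ∀ i : ℤ, ∀ x : ℝ, D i ↑x = deriv (zpowLift f i) x) : 0 ∈ ratioSet Fz D := by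
  refine ⟨le_rfl, fun A' hA' hA0' ε hε => ?_⟩
  set A : Set ℝ := (fun x : ℝ => (x : UnitAddCircle)) ⁻¹' A' with hAdef
  have hA : MeasurableSet A := (AddCircle.measurable_mk' (a := (1 : ℝ))) hA'
  have hA1 : ∀ x, x + 1 ∈ A ↔ x ∈ A := fun x => by
    simp only [hAdef, Set.mem_preimage, AddCircle.coe_add, AddCircle.coe_period, add_zero]
  have hA0 : 0 < volume A := by
    rw [volume_circle hA'] at hA0'
    exact hA0'.trans_le (measure_mono Set.inter_subset_left)
  obtain ⟨j, hj⟩ := hf.exists_contraction h hA hA1 hA0 hε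
  have hfj := hf.lift.iter j
  set B : Set ℝ := {x | x ∈ A ∧ f^[j] x ∈ A ∧ deriv (f^[j]) x < ε} with hB
  have hDm : MeasurableSet {x | deriv (f^[j]) x < ε} :=
    measurableSet_lt (measurable_deriv _) measurable_const
  have hBm : MeasurableSet B := hA.inter ((hfj.cont.measurable hA).inter hDm)
  have hB1 : ∀ x, x + 1 ∈ B ↔ x ∈ B := fun x => by
    simp only [hB, Set.mem_ofPred_eq, hA1, hfj.2.1, lift_deriv_periodic hfj.2.1]
  obtain ⟨B', hB', hmem⟩ := exists_circle_set hBm hB1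
  refine ⟨B', hB', fun z hz => ?_, ?_, j, ?_, fun z hz => ?_⟩
  · obtain ⟨x, rfl⟩ := QuotientAddGroup.mk_surjective z
    exact ((hmem x).1 hz).1
  · rw [volume_circle hB']
    convert volume_inter_Ioc_pos hB1 hj using 3
    ext x
    exact hmem x
  · rintro _ ⟨z, hz, rfl⟩
    obtain ⟨x, rfl⟩ := QuotientAddGroup.mk_surjective z
    erw [hF]
    rw [zpowLift_natCast]
    exact ((hmem x).1 hz).2.1
  · obtain ⟨x, rfl⟩ := QuotientAddGroup.mk_surjective z
    erw [hD]
    rw [zpowLift_natCast, sub_zero, abs_of_pos (hfj.pos x)]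
    exact ((hmem x).1 hz).2.2

theorem RunLimit.ratioSet_eq (hf : RunLimit τ S f) (h : Run τ r S a c)
    (hF : ∀ i : ℤ, ∀ x : ℝ, Fz i ↑x = ↑(zpowLift f i x))
    (hD : ∀ i : ℤ, ∀ x : ℝ, D i ↑x = deriv (zpowLift f i) x) : ratioSet Fz D = {0, 1} :=
  (hf.ratioSet_subset h hF hD).antisymm (Set.insert_subset (hf.zero_mem_ratioSet h hF hD)
    (Set.singleton_subset_iff.2 (one_mem_ratioSet hF hD)))

end

/-- For a Liouville number `α ∈ (0,1)`, type `III₀` diffeomorphisms are `C^∞`-dense in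
the set of smooth circle diffeomorphisms with rotation number `α`. -/
theorem stmt_4 (α : ℝ) (hα0 : 0 < α) (hα1 : α < 1) (hL : Liouville α)
    (g : ℝ → ℝ) (hg : IsCircleDiffeoLift g) (hρg : HasRotationNumber g α)
    (r : ℕ) (ε : ℝ) (hε : 0 < ε) :
    ∃ f : ℝ → ℝ, IsCircleDiffeoLift f ∧ HasRotationNumber f α ∧
      liftDist r f g < ε ∧
      ∃ Fz : ℤ → UnitAddCircle → UnitAddCircle, ∃ D : ℤ → UnitAddCircle → ℝ,
        (∀ i : ℤ, ∀ x : ℝ, Fz i ↑x = ↑(zpowLift f i x)) ∧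
        (∀ i : ℤ, ∀ x : ℝ, D i ↑x = deriv (zpowLift f i) x) ∧
        ratioSet Fz D = ({0, 1} : Set ℝ) := by
  obtain ⟨k, hk⟩ := hρg
  have hτ : Liouville (α + k) :=
    forall_liouvilleWith_iff.1 fun p => (forall_liouvilleWith_iff.2 hL p).add_int k
  obtain ⟨δ, hδ, hinv⟩ := inverse_close hg r (half_pos hε)
  set e := min δ (ε / 2) with he
  have he0 : 0 < e := lt_min hδ (half_pos hε)
  obtain ⟨h, hh, hhg⟩ := exists_conj_close hg hτ hk (r + 1) (half_pos he0)
  obtain ⟨d, hd, hdl⟩ := lift_deriv_lower (hh.conj (α + k))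
  obtain ⟨S, a, c, hS0, hSδ, hgood, hnext⟩ := exists_stages hτ (r + 1) hh
    (lt_min (by linarith : 0 < e / 4) (by linarith : 0 < d / 4))
  have hrun : Run (α + k) (r + 1) S a c := ⟨hgood, hnext⟩
  have hF : (S 0).F (α + k) 1 = fun x => Function.invFun h (h x + (α + k)) := by
    funext x
    rw [Stage.F, hS0, Nat.cast_one, one_mul]
  have hS1 := hSδ.trans (min_le_left _ _)
  have hS2 := hSδ.trans (min_le_right _ _)
  obtain ⟨f, hf, hfF⟩ := hrun.exists_limit (Nat.le_add_left 1 r) fun x => by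
    rw [hF]
    linarith [hdl x]
  rw [hF] at hfF
  have hfg : CrClose (r + 1) e f g :=
    (hfF.trans hf.lift.sm (hh.conj (α + k)).sm hg.sm hhg).mono le_rfl (by linarith)
  obtain ⟨Fz, D, hFz, hD⟩ := exists_circle_iterates hf.lift
  refine ⟨f, hf.lift, ⟨k, hf.tendsto hgood⟩, max_lt ?_ ?_, Fz, D, hFz, hD,
    hf.ratioSet_eq hrun hFz hD⟩
  · exact CrNorm_lt (half_lt_self hε) (hfg.mono (Nat.le_succ r) (min_le_right _ _))
  · exact CrNorm_lt (half_lt_self hε)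
      (hinv f hf.lift (hfg.mono le_rfl (min_le_left _ _)))
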